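/- Let a and b be positive coprime squarefree integers with a ≡ b ≡ 1 (mod 4). Define σ_∞ = 2·( arsinh(√(a/b))/√a + arsinh(√(b/a))/√b ) and c = (2σ_∞/π²) · Σ_v γ(abv)·ρ(a,b,v)·v^{−3/2}, where the sum is over positive integers v with v ≡ 1 (mod 4) and abv squarefree. Then for every ε > 0 there exists a constant C > 0 (depending only on a, b, ε) such that for all real B ≥ 2, | #{(x,y) ∈ ℤ² : gcd(x,y) = 1, |x| ≤ B, |y| ≤ B, ax² + by² squareful} − 2cB | ≤ C·B^{85/86 + ε}. -/

import Mathlib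

open Real

/-- A nonzero integer `z` is *squareful* if every prime `p` dividing `z`
satisfies `p² ∣ z`. -/
def Squareful (z : ℤ) : Prop :=
  z ≠ 0 ∧ ∀ p : ℕ, p.Prime → (p : ℤ) ∣ z → (p : ℤ) ^ 2 ∣ z

/-- `γ(d) = ∏_{p ∣ d, p odd prime} (1 + 1/p)⁻¹`. -/
noncomputable def gammaF (d : ℕ) : ℝ :=
  ∏ p ∈ d.primeFactors.filter (· ≠ 2), (1 + (p : ℝ)⁻¹)⁻¹

/-- `ρ(a,b,v) = ∏_{odd p ∣ a}(1 + (bv/p)) ∏_{odd p ∣ b}(1 + (av/p))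
∏_{odd p ∣ v}(1 + (−ab/p))`, the symbols being Legendre symbols. -/
def rho (a b v : ℕ) : ℤ :=
  (∏ p ∈ a.primeFactors.filter (· ≠ 2), (1 + jacobiSym ((b : ℤ) * v) p)) *
  (∏ p ∈ b.primeFactors.filter (· ≠ 2), (1 + jacobiSym ((a : ℤ) * v) p)) *
  (∏ p ∈ v.primeFactors.filter (· ≠ 2), (1 + jacobiSym (-((a : ℤ) * b)) p))

lemma integral_inv_cos {θ : ℝ} (h0 : 0 ≤ θ) (h1 : θ < π / 2) :
    ∫ x in (0 : ℝ)..θ, (cos x)⁻¹ = arsinh (tan θ) := by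
  have hcos : ∀ x ∈ Set.uIcc 0 θ, 0 < cos x := by
    intro x hx
    rw [Set.uIcc_of_le h0] at hx
    exact cos_pos_of_mem_Ioo ⟨by linarith [hx.1, pi_pos], by linarith [hx.2]⟩
  have hd : ∀ x ∈ Set.uIcc 0 θ, HasDerivAt (fun y => arsinh (tan y)) ((cos x)⁻¹) x := by
    intro x hx
    have hc := hcos x hx
    have h := (hasDerivAt_arsinh (tan x)).comp x (hasDerivAt_tan hc.ne')
    refine h.congr_deriv ?_
    have : √(1 + tan x ^ 2) = (cos x)⁻¹ := by
      rw [show 1 + tan x ^ 2 = ((cos x)⁻¹) ^ 2 by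
        rw [inv_pow, ← inv_one_add_tan_sq hc.ne', inv_inv]]
      exact sqrt_sq (by positivity)
    rw [this]
    field_simp
  rw [intervalIntegral.integral_eq_sub_of_hasDerivAt hd]
  · simp
  · apply ContinuousOn.intervalIntegrable
    exact continuous_cos.continuousOn.inv₀ fun x hx => (hcos x hx).ne'

noncomputable def boxGauge (α β ψ : ℝ) : ℝ := max (α * |cos ψ|) (β * |sin ψ|)

section gauge
variable {α β : ℝ}

lemma boxGauge_pos (hα : 0 < α) (hβ : 0 < β) (ψ : ℝ) : 0 < boxGauge α β ψ := by
  unfold boxGauge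
  by_cases h : cos ψ = 0
  · have : sin ψ ≠ 0 := by
      intro h'
      have := sin_sq_add_cos_sq ψ
      rw [h, h'] at this
      norm_num at this
    exact lt_max_of_lt_right (by positivity)
  · exact lt_max_of_lt_left (by positivity)

lemma continuous_inv_boxGauge (hα : 0 < α) (hβ : 0 < β) : Continuous fun ψ => (boxGauge α β ψ)⁻¹ := by
  apply Continuous.inv₀
  · unfold boxGauge; fun_prop
  · exact fun ψ => (boxGauge_pos hα hβ ψ).ne'

lemma integral_inv_boxGauge_fst (hα : 0 < α) (hβ : 0 < β) :
    ∫ ψ in (0 : ℝ)..arctan (α / β), (boxGauge α β ψ)⁻¹ = arsinh (α / β) / α := by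
  have h0 : 0 ≤ arctan (α / β) := arctan_nonneg.2 (by positivity)
  have h1 := arctan_lt_pi_div_two (α / β)
  rw [show arsinh (α / β) / α = α⁻¹ * arsinh (tan (arctan (α / β))) by
    rw [tan_arctan]; field_simp, ← integral_inv_cos h0 h1,
    ← intervalIntegral.integral_const_mul]
  apply intervalIntegral.integral_congr
  intro ψ hψ
  rw [Set.uIcc_of_le h0] at hψ
  have hc : 0 < cos ψ := cos_pos_of_mem_Ioo ⟨by linarith [hψ.1, pi_pos], by linarith [hψ.2]⟩
  have hs : 0 ≤ sin ψ := sin_nonneg_of_nonneg_of_le_pi hψ.1 (by linarith [hψ.2, pi_pos])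
  have ht : tan ψ ≤ α / β := by
    rw [← tan_arctan (α / β)]
    exact strictMonoOn_tan.monotoneOn
      ⟨by linarith [hψ.1, pi_pos], by linarith [hψ.2]⟩
      ⟨by linarith [pi_pos], h1⟩ hψ.2
  rw [tan_eq_sin_div_cos, div_le_div_iff₀ hc hβ] at ht
  simp only [boxGauge]
  rw [abs_of_pos hc, abs_of_nonneg hs, max_eq_left (by linarith), mul_inv]

lemma integral_inv_boxGauge (hα : 0 < α) (hβ : 0 < β) :
    ∫ ψ in (0 : ℝ)..π / 2, (boxGauge α β ψ)⁻¹ = arsinh (α / β) / α + arsinh (β / α) / β := by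
  have hc := continuous_inv_boxGauge hα hβ
  rw [← intervalIntegral.integral_add_adjacent_intervals (b := arctan (α / β))
    (hc.intervalIntegrable _ _) (hc.intervalIntegrable _ _),
    integral_inv_boxGauge_fst hα hβ, ← integral_inv_boxGauge_fst hβ hα]
  congr 1
  have h2 : arctan (β / α) = π / 2 - arctan (α / β) := by
    rw [← arctan_inv_of_pos (by positivity), inv_div]
  rw [h2]
  have := intervalIntegral.integral_comp_sub_left (a := arctan (α / β)) (b := π / 2)
    (fun ψ => (boxGauge β α ψ)⁻¹) (π / 2)
  rw [sub_self] at this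
  rw [← this]
  apply intervalIntegral.integral_congr
  intro ψ _
  simp only [boxGauge, cos_pi_div_two_sub, sin_pi_div_two_sub, max_comm]

lemma boxGauge_periodic : Function.Periodic (fun ψ => (boxGauge α β ψ)⁻¹) π := by
  intro ψ
  simp [boxGauge]

lemma boxGauge_neg (ψ : ℝ) : boxGauge α β (-ψ) = boxGauge α β ψ := by
  simp [boxGauge]

lemma integral_inv_boxGauge_period (hα : 0 < α) (hβ : 0 < β) :
    ∫ ψ in (0 : ℝ)..π, (boxGauge α β ψ)⁻¹ =
      2 * (arsinh (α / β) / α + arsinh (β / α) / β) := by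
  have hc := continuous_inv_boxGauge hα hβ
  have hp := (boxGauge_periodic (α := α) (β := β)).intervalIntegral_add_eq 0 (-(π / 2))
  rw [zero_add, show -(π / 2) + π = π / 2 by ring] at hp
  rw [hp, ← intervalIntegral.integral_add_adjacent_intervals (b := 0)
    (hc.intervalIntegrable _ _) (hc.intervalIntegrable _ _), integral_inv_boxGauge hα hβ]
  have := intervalIntegral.integral_comp_neg (a := 0) (b := π / 2)
    (fun ψ => (boxGauge α β ψ)⁻¹)
  rw [neg_zero] at this
  rw [← this]
  simp only [boxGauge_neg]
  rw [integral_inv_boxGauge hα hβ]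
  ring

lemma integral_inv_boxGauge_double (hα : 0 < α) (hβ : 0 < β) (φ : ℝ) :
    ∫ θ in (-π)..π, (boxGauge α β (2 * θ - φ))⁻¹ =
      4 * (arsinh (α / β) / α + arsinh (β / α) / β) := by
  have hp := boxGauge_periodic (α := α) (β := β)
  have hc := continuous_inv_boxGauge hα hβ
  have h := intervalIntegral.integral_comp_mul_sub (a := -π) (b := π)
    (fun ψ => (boxGauge α β ψ)⁻¹) (c := 2) (by norm_num) φ
  rw [h]
  have h4 : ∀ t : ℝ, ∫ ψ in t..t + π, (boxGauge α β ψ)⁻¹ =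
      2 * (arsinh (α / β) / α + arsinh (β / α) / β) := by
    intro t
    rw [← integral_inv_boxGauge_period hα hβ, hp.intervalIntegral_add_eq t 0, zero_add]
  set t := 2 * -π - φ with ht
  rw [show 2 * π - φ = t + π + π + π + π by rw [ht]; ring,
    ← intervalIntegral.integral_add_adjacent_intervals (b := t + π + π + π)
      (hc.intervalIntegrable _ _) (hc.intervalIntegrable _ _),
    ← intervalIntegral.integral_add_adjacent_intervals (b := t + π + π)
      (hc.intervalIntegrable _ _) (hc.intervalIntegrable _ _),
    ← intervalIntegral.integral_add_adjacent_intervals (b := t + π)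
      (hc.intervalIntegrable _ _) (hc.intervalIntegrable _ _), h4, h4, h4, h4, smul_eq_mul]
  ring

end gauge

lemma lintegral_radial {H B : ℝ} (hH : 0 < H) (hB : 0 ≤ B) :
    ∫⁻ r in Set.Ioi (0 : ℝ), ENNReal.ofReal r * Set.indicator {r : ℝ | r ^ 2 * H ≤ B} 1 r =
      ENNReal.ofReal (B / 2 * H⁻¹) := by
  have hs : √(B / H) ^ 2 = B / H := sq_sqrt (by positivity)
  have h1 : ∫⁻ r in Set.Ioi (0 : ℝ),
        ENNReal.ofReal r * Set.indicator {r : ℝ | r ^ 2 * H ≤ B} 1 r =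
      ∫⁻ r in Set.Ioc (0 : ℝ) (√(B / H)), ENNReal.ofReal r := by
    rw [← MeasureTheory.lintegral_indicator measurableSet_Ioi,
      ← MeasureTheory.lintegral_indicator measurableSet_Ioc]
    congr 1
    ext r
    by_cases hr : 0 < r
    · have : r ^ 2 * H ≤ B ↔ r ≤ √(B / H) := by
        rw [← le_div_iff₀ hH, le_sqrt' hr]
      by_cases h : r ≤ √(B / H)
      · simp [Set.indicator, hr, h, this]
      · simp [Set.indicator, hr, h, this]
    · simp [Set.indicator, hr]
  rw [h1, ← MeasureTheory.ofReal_integral_eq_lintegral_ofReal,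
    ← intervalIntegral.integral_of_le (sqrt_nonneg _), integral_id, hs]
  · congr 1
    field_simp
    ring
  · exact (continuous_id.integrableOn_Icc).mono_set Set.Ioc_subset_Icc_self
  · filter_upwards [MeasureTheory.self_mem_ae_restrict measurableSet_Ioc] with r hr
    exact hr.1.le

lemma volume_polar_region {f : ℝ × ℝ → ℝ} {H : ℝ → ℝ} {B : ℝ} (hB : 0 ≤ B)
    (hf : Continuous f) (hH : Continuous fun θ => (H θ)⁻¹) (hH0 : ∀ θ, 0 < H θ)
    (hfH : ∀ r θ, f (r * cos θ, r * sin θ) = r ^ 2 * H θ) :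
    MeasureTheory.volume {z : ℝ × ℝ | f z ≤ B} =
      ENNReal.ofReal (B / 2 * ∫ θ in (-π)..π, (H θ)⁻¹) := by
  have hm : MeasurableSet {z : ℝ × ℝ | f z ≤ B} := (isClosed_le hf continuous_const).measurableSet
  rw [← MeasureTheory.lintegral_indicator_one hm, ← lintegral_comp_polarCoord_symm]
  have htar : polarCoord.target = Set.Ioi (0 : ℝ) ×ˢ Set.Ioo (-π) π := rfl
  rw [htar, MeasureTheory.Measure.volume_eq_prod, MeasureTheory.setLIntegral_prod_symm]
  · have : ∀ θ : ℝ, ∫⁻ r in Set.Ioi (0 : ℝ), ENNReal.ofReal r •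
        Set.indicator {z : ℝ × ℝ | f z ≤ B} 1 (polarCoord.symm (r, θ)) =
        ENNReal.ofReal (B / 2 * (H θ)⁻¹) := by
      intro θ
      rw [← lintegral_radial (hH0 θ) hB]
      congr 1
      ext r
      simp only [polarCoord_symm_apply, smul_eq_mul, Set.indicator, Set.mem_ofPred_eq, hfH,
        Pi.one_apply]
    simp only [this]
    rw [← MeasureTheory.ofReal_integral_eq_lintegral_ofReal]
    · rw [intervalIntegral.integral_of_le (by linarith [pi_pos]),
        MeasureTheory.integral_Ioc_eq_integral_Ioo, MeasureTheory.integral_const_mul]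
    · exact ((continuous_const.mul hH).integrableOn_Icc).mono_set Set.Ioo_subset_Icc_self
    · filter_upwards with θ
      have := hH0 θ
      positivity
  · apply Measurable.aemeasurable
    refine Measurable.mul (f := fun p : ℝ × ℝ => ENNReal.ofReal p.1) ?_ ?_
    · fun_prop
    · exact (measurable_one.indicator hm).comp
        (continuous_polarCoord_symm.measurable)

/-- The region cut out by two orthogonal harmonic quadratic forms. -/
lemma volume_harmonic_region {α β P Q P' Q' B : ℝ} (hα : 0 < α) (hβ : 0 < β) (hB : 0 ≤ B)
    (h1 : P ^ 2 + Q ^ 2 = α ^ 2) (h2 : P' ^ 2 + Q' ^ 2 = β ^ 2) (h3 : P * P' + Q * Q' = 0) :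
    MeasureTheory.volume {z : ℝ × ℝ |
        max |P * (z.1 ^ 2 - z.2 ^ 2) + 2 * Q * (z.1 * z.2)|
          |P' * (z.1 ^ 2 - z.2 ^ 2) + 2 * Q' * (z.1 * z.2)| ≤ B} =
      ENNReal.ofReal (2 * B * (arsinh (α / β) / α + arsinh (β / α) / β)) := by
  obtain ⟨φ, hφ1, hφ2⟩ : ∃ φ : ℝ, P = α * cos φ ∧ Q = α * sin φ := by
    refine ⟨Complex.arg ⟨P, Q⟩, ?_, ?_⟩
    · have hn : ‖(⟨P, Q⟩ : ℂ)‖ = α := by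
        rw [Complex.norm_eq_sqrt_sq_add_sq, h1, sqrt_sq hα.le]
      have := Complex.norm_mul_cos_arg ⟨P, Q⟩
      rw [hn] at this
      exact this.symm
    · have hn : ‖(⟨P, Q⟩ : ℂ)‖ = α := by
        rw [Complex.norm_eq_sqrt_sq_add_sq, h1, sqrt_sq hα.le]
      have := Complex.norm_mul_sin_arg ⟨P, Q⟩
      rw [hn] at this
      exact this.symm
  have hP' : ∃ τ : ℝ, P' = -(τ * sin φ) ∧ Q' = τ * cos φ ∧ τ ^ 2 = β ^ 2 := by
    have hsc := sin_sq_add_cos_sq φ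
    have h3' : cos φ * P' + sin φ * Q' = 0 := by
      have : α * (cos φ * P' + sin φ * Q') = 0 := by rw [← h3, hφ1, hφ2]; ring
      exact (mul_eq_zero.1 this).resolve_left hα.ne'
    refine ⟨cos φ * Q' - sin φ * P', ?_, ?_, ?_⟩
    · linear_combination (-P') * hsc + cos φ * h3'
    · linear_combination (-Q') * hsc + sin φ * h3'
    · rw [← h2]
      linear_combination (P' ^ 2 + Q' ^ 2) * hsc - (cos φ * P' + sin φ * Q') * h3'
  obtain ⟨τ, hτ1, hτ2, hτ⟩ := hP'
  have hτβ : |τ| = β := by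
    rw [← abs_of_pos hβ]; exact (sq_eq_sq_iff_abs_eq_abs _ _).1 hτ
  rw [volume_polar_region (H := fun θ => boxGauge α β (2 * θ - φ)) hB (by fun_prop)
    ((continuous_inv_boxGauge hα hβ).comp (by fun_prop)) (fun θ => boxGauge_pos hα hβ _),
    integral_inv_boxGauge_double hα hβ]
  · congr 1
    ring
  · intro r θ
    simp only [boxGauge]
    rw [mul_max_of_nonneg _ _ (sq_nonneg r)]
    congr 1
    · rw [show r ^ 2 * (α * |cos (2 * θ - φ)|) = |r ^ 2 * (α * cos (2 * θ - φ))| by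
        rw [abs_mul, abs_mul, abs_of_pos hα, abs_of_nonneg (sq_nonneg r)], cos_sub, cos_two_mul',
        sin_two_mul, hφ1, hφ2]
      congr 1
      ring
    · rw [show r ^ 2 * (β * |sin (2 * θ - φ)|) = |r ^ 2 * (τ * sin (2 * θ - φ))| by
        rw [abs_mul, abs_mul, hτβ, abs_of_nonneg (sq_nonneg r)], sin_sub, cos_two_mul',
        sin_two_mul, hτ1, hτ2]
      congr 1
      ring

/-- The binary quadratic form `A s² + 2 B s t + C t²`. -/
def evenForm {R : Type*} [CommRing R] (A B C s t : R) : R := A * s ^ 2 + 2 * B * s * t + C * t ^ 2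

/-- Three integral binary quadratic forms parametrizing the conic `a x² + b y² = w u²`. -/
structure ConicParam (a b w : ℕ) where
  (xA xB xC yA yB yC uA uB uC : ℤ)
  disc_x : xB ^ 2 - xA * xC = b * w
  disc_y : yB ^ 2 - yA * yC = a * w
  disc_u : uA * uC - uB ^ 2 = a * b
  polar_xy : xA * yC + xC * yA - 2 * xB * yB = 0
  polar_xu : xA * uC + xC * uA - 2 * xB * uB = 0
  polar_yu : yA * uC + yC * uA - 2 * yB * uB = 0
  uA_pos : 0 < uA
  conic : ∀ s t : ℝ, a * evenForm (xA : ℝ) xB xC s t ^ 2 + b * evenForm (yA : ℝ) yB yC s t ^ 2 =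
    w * evenForm (uA : ℝ) uB uC s t ^ 2

namespace ConicParam

variable {a b w : ℕ} (P : ConicParam a b w)

def x (s t : ℝ) : ℝ := evenForm (P.xA : ℝ) P.xB P.xC s t
def y (s t : ℝ) : ℝ := evenForm (P.yA : ℝ) P.yB P.yC s t
def u (s t : ℝ) : ℝ := evenForm (P.uA : ℝ) P.uB P.uC s t

def gauge (z : ℝ × ℝ) : ℝ := max |P.x z.1 z.2| |P.y z.1 z.2|

lemma gauge_nonneg (z : ℝ × ℝ) : 0 ≤ P.gauge z := le_max_of_le_left (abs_nonneg _)

lemma gauge_smul (k : ℝ) (z : ℝ × ℝ) : P.gauge (k * z.1, k * z.2) = k ^ 2 * P.gauge z := by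
  simp only [gauge]
  rw [mul_max_of_nonneg _ _ (sq_nonneg k)]
  congr 1
  · rw [show k ^ 2 * |P.x z.1 z.2| = |k ^ 2 * P.x z.1 z.2| by
      rw [abs_mul, abs_of_nonneg (sq_nonneg k)]]
    congr 1
    simp only [x, evenForm]
    ring
  · rw [show k ^ 2 * |P.y z.1 z.2| = |k ^ 2 * P.y z.1 z.2| by
      rw [abs_mul, abs_of_nonneg (sq_nonneg k)]]
    congr 1
    simp only [y, evenForm]
    ring

end ConicParam

/-- The constant `σ_∞`. -/
noncomputable def sigmaInf (a b : ℝ) : ℝ := 2 * (arsinh √(a / b) / √a + arsinh √(b / a) / √b)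

lemma sigmaInf_nonneg (a b : ℝ) : 0 ≤ sigmaInf a b := by
  have h : ∀ r : ℝ, 0 ≤ arsinh √r := fun r => arsinh_nonneg_iff.2 (sqrt_nonneg _)
  have h1 := h (a / b)
  have h2 := h (b / a)
  unfold sigmaInf
  positivity

namespace ConicParam
variable {a b w : ℕ} (P : ConicParam a b w)

lemma volume_gauge_le (ha : 0 < a) (hb : 0 < b) (hw : 0 < w) {B : ℝ} (hB : 0 ≤ B) :
    MeasureTheory.volume {z : ℝ × ℝ | P.gauge z ≤ B} =
      ENNReal.ofReal (sigmaInf a b * B / √w) := by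
  have ha' : (0 : ℝ) < a := by exact_mod_cast ha
  have hb' : (0 : ℝ) < b := by exact_mod_cast hb
  have hw' : (0 : ℝ) < w := by exact_mod_cast hw
  obtain ⟨xA, xB, xC, yA, yB, yC, uA, uB, uC, dx, dy, du, pxy, pxu, pyu, hu, hc⟩ := P
  simp only [gauge, x, y]
  have hu' : (0 : ℝ) < uA := by exact_mod_cast hu
  have dx' : (xB : ℝ) ^ 2 - xA * xC = b * w := by exact_mod_cast dx
  have dy' : (yB : ℝ) ^ 2 - yA * yC = a * w := by exact_mod_cast dy
  have du' : (uA : ℝ) * uC - uB ^ 2 = a * b := by exact_mod_cast du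
  have pxy' : (xA : ℝ) * yC + xC * yA - 2 * xB * yB = 0 := by exact_mod_cast pxy
  have pxu' : (xA : ℝ) * uC + xC * uA - 2 * xB * uB = 0 := by exact_mod_cast pxu
  have pyu' : (yA : ℝ) * uC + yC * uA - 2 * yB * uB = 0 := by exact_mod_cast pyu
  generalize (xA : ℝ) = xA at *
  generalize (xB : ℝ) = xB at *
  generalize (xC : ℝ) = xC at *
  generalize (yA : ℝ) = yA at *
  generalize (yB : ℝ) = yB at *
  generalize (yC : ℝ) = yC at *
  generalize (uA : ℝ) = uA at *
  generalize (uB : ℝ) = uB at *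
  generalize (uC : ℝ) = uC at *
  obtain ⟨k, hk, hk2⟩ : ∃ k : ℝ, 0 < k ∧ k ^ 2 = a * b :=
    ⟨√(a * b), by positivity, sq_sqrt (by positivity)⟩
  obtain ⟨r, hr, hr2⟩ : ∃ r : ℝ, 0 < r ∧ r ^ 2 = uA := ⟨√uA, by positivity, sq_sqrt hu'.le⟩
  set L := Matrix.toLin (Module.Basis.finTwoProd ℝ) (Module.Basis.finTwoProd ℝ)
    !![1 / r, -uB / (r * k); 0, r / k] with hL
  have hdet : LinearMap.det L = 1 / k := by
    rw [hL, LinearMap.det_toLin, Matrix.det_fin_two_of]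
    field_simp
    simp
  have hvol := MeasureTheory.Measure.addHaar_preimage_linearMap
    (MeasureTheory.volume : MeasureTheory.Measure (ℝ × ℝ)) (f := L)
    (by rw [hdet]; positivity)
    {z : ℝ × ℝ | max |evenForm xA xB xC z.1 z.2| |evenForm yA yB yC z.1 z.2| ≤ B}
  have key : ∀ A B' C : ℝ, A * uC + C * uA - 2 * B' * uB = 0 → ∀ p q : ℝ,
      evenForm A B' C (1 / r * p + -uB / (r * k) * q) (0 * p + r / k * q) =
        A / uA * (p ^ 2 - q ^ 2) + 2 * ((B' * uA - A * uB) / (uA * k)) * (p * q) := by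
    intro A B' C h p q
    have hq : A * uB ^ 2 / (uA * k ^ 2) - 2 * B' * uB / k ^ 2 + C * uA / k ^ 2 = -(A / uA) := by
      field_simp
      rw [hk2]
      linear_combination uA * h - A * du'
    rw [evenForm, ← hr2] at *
    rw [← sub_eq_zero]
    rw [← sub_eq_zero] at hq
    field_simp at hq ⊢
    linear_combination (q ^ 2) * hq
  have key2 : ∀ A B' C D : ℝ, A * uC + C * uA - 2 * B' * uB = 0 → B' ^ 2 - A * C = D →
      (A / uA) ^ 2 + ((B' * uA - A * uB) / (uA * k)) ^ 2 = D / (a * b) := by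
    intro A B' C D h hD
    rw [← hk2]
    field_simp
    rw [hk2]
    linear_combination A * uA * h - A ^ 2 * du' + uA ^ 2 * hD
  have hset : L ⁻¹' {z : ℝ × ℝ | max |evenForm xA xB xC z.1 z.2| |evenForm yA yB yC z.1 z.2| ≤ B} =
      {z : ℝ × ℝ |
        max |xA / uA * (z.1 ^ 2 - z.2 ^ 2) + 2 * ((xB * uA - xA * uB) / (uA * k)) * (z.1 * z.2)|
          |yA / uA * (z.1 ^ 2 - z.2 ^ 2) + 2 * ((yB * uA - yA * uB) / (uA * k)) * (z.1 * z.2)|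
            ≤ B} := by
    ext z
    rw [Set.mem_preimage, hL, Matrix.toLin_finTwoProd_apply]
    simp only [Set.mem_ofPred_eq, key xA xB xC pxu', key yA yB yC pyu']
  rw [hset, volume_harmonic_region (α := √w / √a) (β := √w / √b) (by positivity) (by positivity) hB,
    hdet] at hvol
  · rw [one_div, inv_inv, abs_of_pos hk] at hvol
    have h2 : MeasureTheory.volume {z : ℝ × ℝ |
        max |evenForm xA xB xC z.1 z.2| |evenForm yA yB yC z.1 z.2| ≤ B} =
        ENNReal.ofReal k⁻¹ * (ENNReal.ofReal k * MeasureTheory.volume {z : ℝ × ℝ |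
        max |evenForm xA xB xC z.1 z.2| |evenForm yA yB yC z.1 z.2| ≤ B}) := by
      rw [← mul_assoc, ← ENNReal.ofReal_mul (by positivity), inv_mul_cancel₀ hk.ne',
        ENNReal.ofReal_one, one_mul]
    rw [h2, ← hvol, ← ENNReal.ofReal_mul (by positivity)]
    congr 1
    have hk3 : k = √a * √b := by
      rw [← sqrt_mul ha'.le, ← hk2, sqrt_sq hk.le]
    have e1 : √w / √a / (√w / √b) = √(b / a) := by
      rw [sqrt_div hb'.le]; field_simp
    have e2 : √w / √b / (√w / √a) = √(a / b) := by
      rw [sqrt_div ha'.le]; field_simp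
    rw [e1, e2, hk3, sigmaInf]
    field_simp
    ring
  · rw [key2 xA xB xC _ pxu' dx', div_pow, sq_sqrt hw'.le, sq_sqrt ha'.le]
    field_simp
  · rw [key2 yA yB yC _ pyu' dy', div_pow, sq_sqrt hw'.le, sq_sqrt hb'.le]
    field_simp
  · field_simp
    rw [hk2]
    linear_combination (-xA * yA) * du' + uA / 2 * yA * pxu' + uA / 2 * xA * pyu'
      - uA ^ 2 / 2 * pxy'

end ConicParam

/-- A planar function, homogeneous of degree two, with linear area function and uniform growth and
continuity bounds. -/
structure QuadGauge (σ c K : ℝ) where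
  N : ℝ × ℝ → ℝ
  smul : ∀ (k : ℝ) (z : ℝ × ℝ), N (k * z.1, k * z.2) = k ^ 2 * N z
  area : ∀ T : ℝ, 0 ≤ T → MeasureTheory.volume {z | N z ≤ T} = ENNReal.ofReal (σ * T)
  lower : ∀ z : ℝ × ℝ, c * (z.1 ^ 2 + z.2 ^ 2) ≤ N z
  lip : ∀ (R : ℝ) (z e : ℝ × ℝ), |z.1| ≤ R → |z.2| ≤ R → |e.1| ≤ 1 → |e.2| ≤ 1 →
    N (z.1 + e.1, z.2 + e.2) ≤ N z + K * (R + 1)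

namespace QuadGauge

variable {σ c K : ℝ} (G : QuadGauge σ c K)

lemma abs_le_of_N_le (hc : 0 < c) {z : ℝ × ℝ} {T : ℝ} (h : G.N z ≤ T) :
    |z.1| ≤ √(T / c) ∧ |z.2| ≤ √(T / c) := by
  have h1 := (G.lower z).trans h
  have h2 : z.1 ^ 2 + z.2 ^ 2 ≤ T / c := by
    rw [le_div_iff₀ hc]; linarith
  constructor <;> apply Real.abs_le_sqrt <;> nlinarith [sq_nonneg z.1, sq_nonneg z.2]

lemma finite_le (hc : 0 < c) (s : ℝ × ℝ) (T : ℝ) :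
    {z : ℤ × ℤ | G.N (s.1 + z.1, s.2 + z.2) ≤ T}.Finite := by
  apply Set.Finite.subset (Set.finite_Icc
    ((⌊-√(T / c) - s.1⌋, ⌊-√(T / c) - s.2⌋) : ℤ × ℤ) (⌈√(T / c) - s.1⌉, ⌈√(T / c) - s.2⌉))
  intro z hz
  obtain ⟨h1, h2⟩ := G.abs_le_of_N_le hc hz
  rw [abs_le] at h1 h2
  simp only at h1 h2
  refine ⟨⟨?_, ?_⟩, ?_, ?_⟩ <;> simp only [Int.floor_le_iff, Int.le_ceil_iff] <;> linarith

/-- The unit cell with lower left corner `s + z`. -/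
lemma volume_cell (s : ℝ × ℝ) (z : ℤ × ℤ) :
    MeasureTheory.volume (Set.Ico (s.1 + z.1) (s.1 + z.1 + 1) ×ˢ
      Set.Ico (s.2 + z.2) (s.2 + z.2 + 1)) = 1 := by
  rw [MeasureTheory.Measure.volume_eq_prod, MeasureTheory.Measure.prod_prod, Real.volume_Ico,
    Real.volume_Ico]
  simp

lemma mem_cell_iff (s p : ℝ × ℝ) (z : ℤ × ℤ) :
    p ∈ Set.Ico (s.1 + z.1) (s.1 + z.1 + 1) ×ˢ Set.Ico (s.2 + z.2) (s.2 + z.2 + 1) ↔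
      z = (⌊p.1 - s.1⌋, ⌊p.2 - s.2⌋) := by
  rw [Prod.ext_iff, eq_comm, Int.floor_eq_iff, eq_comm (a := z.2), Int.floor_eq_iff]
  simp only [Set.mem_prod, Set.mem_Ico]
  constructor
  · rintro ⟨⟨h1, h2⟩, h3, h4⟩
    refine ⟨⟨?_, ?_⟩, ?_, ?_⟩ <;> linarith
  · rintro ⟨⟨h1, h2⟩, h3, h4⟩
    refine ⟨⟨?_, ?_⟩, ?_, ?_⟩ <;> linarith

lemma volume_cells (s : ℝ × ℝ) (S : Finset (ℤ × ℤ)) :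
    MeasureTheory.volume (⋃ z ∈ S, Set.Ico (s.1 + (z.1 : ℝ)) (s.1 + z.1 + 1) ×ˢ
      Set.Ico (s.2 + (z.2 : ℝ)) (s.2 + z.2 + 1)) = S.card := by
  rw [MeasureTheory.measure_biUnion_finset]
  · rw [Finset.sum_congr rfl (fun z _ => volume_cell s z)]
    simp
  · intro z _ z' _ hne
    rw [Function.onFun, Set.disjoint_left]
    intro p hp hp'
    rw [mem_cell_iff] at hp hp'
    exact hne (hp.trans hp'.symm)
  · intro z _
    exact measurableSet_Ico.prod measurableSet_Ico

/-- Counting points of a translate of the integer lattice. -/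
lemma ncard_translate (hc : 0 < c) (hK : 0 ≤ K) (hσ : 0 ≤ σ) (s : ℝ × ℝ) {T : ℝ} (hT : 0 ≤ T) :
    |({z : ℤ × ℤ | G.N (s.1 + z.1, s.2 + z.2) ≤ T}.ncard : ℝ) - σ * T| ≤
      σ * K * (√(T / c) + 2) := by
  have hfin := G.finite_le hc s T
  set S := hfin.toFinset with hS
  have hcard : {z : ℤ × ℤ | G.N (s.1 + z.1, s.2 + z.2) ≤ T}.ncard = S.card :=
    Set.ncard_eq_toFinset_card _ hfin
  have hmem : ∀ z : ℤ × ℤ, z ∈ S ↔ G.N (s.1 + z.1, s.2 + z.2) ≤ T := fun z => by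
    rw [hS, Set.Finite.mem_toFinset]; rfl
  rw [hcard]
  set R := √(T / c) with hR
  have hR0 : 0 ≤ R := sqrt_nonneg _
  have hvol := volume_cells s S
  rw [abs_le]
  constructor
  · by_cases hD : T < K * (R + 1)
    · have : σ * T ≤ σ * (K * (R + 2)) := by
        apply mul_le_mul_of_nonneg_left _ hσ
        nlinarith
      have h0 : (0 : ℝ) ≤ S.card := Nat.cast_nonneg _
      linarith [mul_assoc σ K (R + 2)]
    · push Not at hD
      have hsub : {z : ℝ × ℝ | G.N z ≤ T - K * (R + 1)} ⊆ (⋃ z ∈ S,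
          Set.Ico (s.1 + (z.1 : ℝ)) (s.1 + z.1 + 1) ×ˢ
          Set.Ico (s.2 + (z.2 : ℝ)) (s.2 + z.2 + 1)) := by
        intro p hp
        rw [Set.mem_ofPred_eq] at hp
        have hpT : G.N p ≤ T := by nlinarith
        obtain ⟨h1, h2⟩ := G.abs_le_of_N_le hc hpT
        simp only [Set.mem_iUnion]
        refine ⟨(⌊p.1 - s.1⌋, ⌊p.2 - s.2⌋), ?_, (mem_cell_iff _ _ _).2 rfl⟩
        rw [hmem]
        have := G.lip R p (s.1 + ⌊p.1 - s.1⌋ - p.1, s.2 + ⌊p.2 - s.2⌋ - p.2) h1 h2 ?_ ?_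
        · simp only [add_sub_cancel] at this
          linarith
        · have := Int.floor_le (p.1 - s.1)
          have := Int.lt_floor_add_one (p.1 - s.1)
          rw [abs_le]; constructor <;> linarith
        · have := Int.floor_le (p.2 - s.2)
          have := Int.lt_floor_add_one (p.2 - s.2)
          rw [abs_le]; constructor <;> linarith
      have := MeasureTheory.measure_mono (μ := MeasureTheory.volume) hsub
      rw [hvol, G.area _ (by linarith)] at this
      have h3 : σ * (T - K * (R + 1)) ≤ S.card := by
        rw [← ENNReal.ofReal_natCast] at this
        exact (ENNReal.ofReal_le_ofReal_iff (Nat.cast_nonneg _)).1 this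
      nlinarith [mul_nonneg hσ hK]
  · have hsub : (⋃ z ∈ S, Set.Ico (s.1 + (z.1 : ℝ)) (s.1 + z.1 + 1) ×ˢ
          Set.Ico (s.2 + (z.2 : ℝ)) (s.2 + z.2 + 1)) ⊆
          {z : ℝ × ℝ | G.N z ≤ T + K * (R + 1)} := by
      intro p hp
      simp only [Set.mem_iUnion] at hp
      obtain ⟨z, hz, hp⟩ := hp
      rw [hmem] at hz
      obtain ⟨h1, h2⟩ := G.abs_le_of_N_le hc hz
      obtain ⟨⟨h3, h4⟩, h5, h6⟩ := hp
      have := G.lip R (s.1 + z.1, s.2 + z.2) (p.1 - (s.1 + z.1), p.2 - (s.2 + z.2)) h1 h2 ?_ ?_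
      · simp only [add_sub_cancel] at this
        rw [Set.mem_ofPred_eq]
        linarith
      · rw [abs_le]; constructor <;> simp only <;> linarith
      · rw [abs_le]; constructor <;> simp only <;> linarith
    have := MeasureTheory.measure_mono (μ := MeasureTheory.volume) hsub
    rw [hvol, G.area _ (by positivity)] at this
    have h3 : (S.card : ℝ) ≤ σ * (T + K * (R + 1)) := by
      rw [← ENNReal.ofReal_natCast] at this
      exact (ENNReal.ofReal_le_ofReal_iff (by positivity)).1 this
    nlinarith [mul_nonneg hσ hK]

end QuadGauge

namespace QuadGauge

variable {σ c K : ℝ} (G : QuadGauge σ c K)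

lemma finite_le_zero (hc : 0 < c) (T : ℝ) : {z : ℤ × ℤ | G.N (z.1, z.2) ≤ T}.Finite := by
  simpa using G.finite_le hc (0, 0) T

lemma ncard_residue (hc : 0 < c) (hK : 0 ≤ K) (hσ : 0 ≤ σ) (M : ℕ) [NeZero M]
    (r : ZMod M × ZMod M) {T : ℝ} (hT : 0 ≤ T) :
    |({z : ℤ × ℤ | ((z.1 : ZMod M), (z.2 : ZMod M)) = r ∧ G.N (z.1, z.2) ≤ T}.ncard : ℝ) -
      σ * T / M ^ 2| ≤ σ * K * (√(T / c) + 2) := by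
  have hM : (0 : ℝ) < M := by exact_mod_cast NeZero.pos M
  have hM1 : (1 : ℝ) ≤ M := by exact_mod_cast NeZero.pos M
  set s : ℝ × ℝ := ((r.1.val : ℝ) / M, (r.2.val : ℝ) / M) with hs
  have himg : {z : ℤ × ℤ | ((z.1 : ZMod M), (z.2 : ZMod M)) = r ∧ G.N (z.1, z.2) ≤ T} =
      (fun z : ℤ × ℤ => ((r.1.val : ℤ) + M * z.1, (r.2.val : ℤ) + M * z.2)) ''
        {z : ℤ × ℤ | G.N (s.1 + z.1, s.2 + z.2) ≤ T / M ^ 2} := by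
    have hN : ∀ z : ℤ × ℤ, G.N ((((r.1.val : ℤ) + M * z.1 : ℤ) : ℝ),
        (((r.2.val : ℤ) + M * z.2 : ℤ) : ℝ)) = M ^ 2 * G.N (s.1 + z.1, s.2 + z.2) := by
      intro z
      rw [← G.smul]
      congr 2 <;> simp only [hs] <;> push_cast <;> field_simp
    ext z
    simp only [Set.mem_ofPred_eq, Set.mem_image]
    constructor
    · rintro ⟨h, hz⟩
      have h1 : ((z.1 - r.1.val : ℤ) : ZMod M) = 0 := by simp [← h]
      have h2 : ((z.2 - r.2.val : ℤ) : ZMod M) = 0 := by simp [← h]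
      rw [ZMod.intCast_zmod_eq_zero_iff_dvd] at h1 h2
      obtain ⟨k1, hk1⟩ := h1
      obtain ⟨k2, hk2⟩ := h2
      have e : ((r.1.val : ℤ) + M * k1, (r.2.val : ℤ) + M * k2) = z := by
        ext <;> simp only <;> linarith
      refine ⟨(k1, k2), ?_, e⟩
      have := hN (k1, k2)
      rw [← e] at hz
      simp only at hz this
      rw [this] at hz
      rw [le_div_iff₀ (by positivity)]
      linarith
    · rintro ⟨k, hk, rfl⟩
      refine ⟨by simp, ?_⟩
      simp only
      rw [hN k]
      rw [le_div_iff₀ (by positivity)] at hk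
      linarith
  rw [himg, Set.ncard_image_of_injective]
  · have := G.ncard_translate hc hK hσ s (T := T / M ^ 2) (by positivity)
    rw [mul_div_assoc]
    refine this.trans ?_
    apply mul_le_mul_of_nonneg_left _ (by positivity)
    have : T / M ^ 2 ≤ T := div_le_self hT (one_le_pow₀ hM1)
    gcongr
  · intro z z' h
    simp only [Prod.mk.injEq, add_right_inj] at h
    have : (M : ℤ) ≠ 0 := by exact_mod_cast NeZero.ne M
    ext
    · exact mul_left_cancel₀ this h.1
    · exact mul_left_cancel₀ this h.2

lemma ncard_residues (hc : 0 < c) (hK : 0 ≤ K) (hσ : 0 ≤ σ) (M : ℕ) [NeZero M]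
    (U : Finset (ZMod M × ZMod M)) {T : ℝ} (hT : 0 ≤ T) :
    |({z : ℤ × ℤ | ((z.1 : ZMod M), (z.2 : ZMod M)) ∈ U ∧ G.N (z.1, z.2) ≤ T}.ncard : ℝ) -
      U.card / M ^ 2 * (σ * T)| ≤ M ^ 2 * (σ * K * (√(T / c) + 2)) := by
  have hfin := G.finite_le_zero hc T
  have h1 : {z : ℤ × ℤ | ((z.1 : ZMod M), (z.2 : ZMod M)) ∈ U ∧ G.N (z.1, z.2) ≤ T}.ncard =
      ∑ r ∈ U, {z : ℤ × ℤ | ((z.1 : ZMod M), (z.2 : ZMod M)) = r ∧ G.N (z.1, z.2) ≤ T}.ncard := by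
    classical
    have hA : {z : ℤ × ℤ | ((z.1 : ZMod M), (z.2 : ZMod M)) ∈ U ∧ G.N (z.1, z.2) ≤ T} =
        (hfin.toFinset.filter fun z => ((z.1 : ZMod M), (z.2 : ZMod M)) ∈ U : Finset (ℤ × ℤ)) := by
      ext z; simp [and_comm]
    rw [hA, Set.ncard_coe_finset, Finset.card_eq_sum_card_fiberwise
      (f := fun z : ℤ × ℤ => ((z.1 : ZMod M), (z.2 : ZMod M))) (t := U)
      (fun z hz => by simpa using (Finset.mem_filter.1 hz).2)]
    refine Finset.sum_congr rfl fun r hr => ?_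
    rw [← Set.ncard_coe_finset]
    congr 1
    ext z
    simp only [Finset.coe_filter, Finset.mem_filter, Set.Finite.mem_toFinset, Set.mem_ofPred_eq]
    constructor
    · rintro ⟨⟨h, _⟩, h'⟩; exact ⟨h', h⟩
    · rintro ⟨h', h⟩; exact ⟨⟨h, h' ▸ hr⟩, h'⟩
  have h2 : (U.card : ℝ) / M ^ 2 * (σ * T) = ∑ r ∈ U, σ * T / M ^ 2 := by
    rw [Finset.sum_const, nsmul_eq_mul]; ring
  have hcard : (U.card : ℝ) ≤ M ^ 2 := by
    have := Finset.card_le_univ U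
    rw [Fintype.card_prod, ZMod.card] at this
    rw [sq]
    exact_mod_cast this
  rw [h1, h2]
  push_cast
  rw [← Finset.sum_sub_distrib]
  calc _ ≤ ∑ r ∈ U, σ * K * (√(T / c) + 2) :=
        (Finset.abs_sum_le_sum_abs _ _).trans
          (Finset.sum_le_sum fun r _ => G.ncard_residue hc hK hσ M r hT)
    _ = U.card * (σ * K * (√(T / c) + 2)) := by rw [Finset.sum_const, nsmul_eq_mul]
    _ ≤ _ := by gcongr

end QuadGauge

/-- The residues mod `M` at which a linear form is invertible. -/
lemma card_isUnit_linearForm (M : ℕ) [NeZero M] (g h s t : ZMod M) (hst : IsUnit (g * s + h * t)) :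
    ∀ [DecidablePred fun r : ZMod M × ZMod M => IsUnit (g * r.1 + h * r.2)],
    (Finset.univ.filter fun r : ZMod M × ZMod M => IsUnit (g * r.1 + h * r.2)).card =
      M.totient * M := by
  intro _
  obtain ⟨d, hd⟩ := hst.exists_right_inv
  rw [← ZMod.card_units_eq_totient M]
  have hprod : Fintype.card (ZMod M)ˣ * M = Fintype.card ((ZMod M)ˣ × ZMod M) := by
    rw [Fintype.card_prod, ZMod.card]
  rw [hprod]
  symm
  refine Finset.card_bij (fun p _ => (d * (s * p.1 - h * p.2), d * (t * p.1 + g * p.2))) ?_ ?_ ?_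
  · intro p _
    have : g * (d * (s * p.1 - h * p.2)) + h * (d * (t * p.1 + g * p.2)) = p.1 := by
      linear_combination p.1.val * hd
    simp [this]
  · intro p _ p' _ e
    rw [Prod.mk.injEq] at e
    obtain ⟨e1, e2⟩ := e
    ext
    · linear_combination (p'.1.val - p.1.val) * hd + g * e1 + h * e2
    · linear_combination (p'.2 - p.2) * hd - t * e1 + s * e2
  · intro r hr
    obtain ⟨u, hu⟩ := (Finset.mem_filter.1 hr).2
    refine ⟨(u, s * r.2 - t * r.1), Finset.mem_univ _, ?_⟩
    ext <;> simp only [hu]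
    · linear_combination r.1 * hd
    · linear_combination r.2 * hd

/-- The Möbius function restricted to integers coprime to `M`. -/
noncomputable def moebiusCoprime (M k : ℕ) : ℝ :=
  if k.Coprime M then (ArithmeticFunction.moebius k : ℝ) else 0

lemma abs_moebiusCoprime_le_one (M k : ℕ) : |moebiusCoprime M k| ≤ 1 := by
  unfold moebiusCoprime
  split_ifs
  · exact_mod_cast ArithmeticFunction.abs_moebius_le_one
  · simp

lemma moebiusCoprime_zero (M : ℕ) : moebiusCoprime M 0 = 0 := by
  simp [moebiusCoprime]

lemma summable_moebiusCoprime (M : ℕ) : Summable fun k : ℕ => moebiusCoprime M k / (k : ℝ) ^ 2 := by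
  refine Summable.of_norm_bounded (Real.summable_one_div_nat_pow.2 one_lt_two) fun k => ?_
  rw [Real.norm_eq_abs, abs_div, abs_of_nonneg (sq_nonneg (k : ℝ))]
  have := abs_moebiusCoprime_le_one M k
  gcongr

lemma tsum_moebiusCoprime (M : ℕ) [NeZero M] :
    (∏ p ∈ M.primeFactors, (1 - ((p : ℝ) ^ 2)⁻¹)) * ∑' k : ℕ, moebiusCoprime M k / (k : ℝ) ^ 2 =
      6 / π ^ 2 := by
  have h2 : (1 : ℝ) < (2 : ℂ).re := by norm_num
  have h := DirichletCharacter.LSeries.mul_mu_eq_one (1 : DirichletCharacter ℂ M) h2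
  rw [← DirichletCharacter.LFunction_eq_LSeries _ h2] at h
  rw [show DirichletCharacter.LFunction (1 : DirichletCharacter ℂ M) 2 =
      DirichletCharacter.LFunctionTrivChar M 2 from rfl,
    DirichletCharacter.LFunctionTrivChar_eq_mul_riemannZeta (by norm_num), riemannZeta_two,
    LSeries] at h
  have hterm : ∀ k : ℕ, LSeries.term ((fun n : ℕ => (1 : DirichletCharacter ℂ M) n) *
      fun n : ℕ => ((ArithmeticFunction.moebius n : ℤ) : ℂ)) 2 k =
      ((moebiusCoprime M k / (k : ℝ) ^ 2 : ℝ) : ℂ) := by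
    intro k
    rcases eq_or_ne k 0 with rfl | hk
    · simp
    rw [LSeries.term_of_ne_zero hk, moebiusCoprime]
    simp only [Pi.mul_apply]
    by_cases hc : k.Coprime M
    · rw [if_pos hc, MulChar.one_apply ((ZMod.isUnit_iff_coprime k M).2 hc)]
      push_cast
      rw [one_mul]
      congr 1
      norm_cast
    · rw [if_neg hc, MulChar.map_nonunit _ (fun h => hc ((ZMod.isUnit_iff_coprime k M).1 h))]
      simp
  rw [tsum_congr hterm, ← Complex.ofReal_tsum] at h
  have hp : ∀ p : ℕ, (1 - (p : ℂ) ^ (-2 : ℂ)) = ((1 - ((p : ℝ) ^ 2)⁻¹ : ℝ) : ℂ) := by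
    intro p
    rw [Complex.cpow_neg]
    push_cast
    norm_cast
  rw [Finset.prod_congr rfl fun p _ => hp p] at h
  have h' : (∏ p ∈ M.primeFactors, (1 - ((p : ℝ) ^ 2)⁻¹)) * (π ^ 2 / 6) *
      ∑' k : ℕ, moebiusCoprime M k / (k : ℝ) ^ 2 = 1 := by
    exact_mod_cast h
  have := Real.pi_ne_zero
  field_simp at h' ⊢
  linarith

lemma totient_div_mul_tsum_moebiusCoprime (M : ℕ) [NeZero M] :
    (M.totient / M : ℝ) * ∑' k : ℕ, moebiusCoprime M k / (k : ℝ) ^ 2 =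
      6 / π ^ 2 * ∏ p ∈ M.primeFactors, (1 + (p : ℝ)⁻¹)⁻¹ := by
  have h1 : (M.totient : ℝ) = M * ∏ p ∈ M.primeFactors, (1 - (p : ℝ)⁻¹) := by
    have := Nat.totient_eq_mul_prod_factors M
    have h := congrArg (fun q : ℚ => (q : ℝ)) this
    push_cast at h
    exact h
  have hM : (M : ℝ) ≠ 0 := by exact_mod_cast NeZero.ne M
  rw [h1, mul_div_cancel_left₀ _ hM, ← tsum_moebiusCoprime M, mul_right_comm,
    ← Finset.prod_mul_distrib]
  congr 1
  refine Finset.prod_congr rfl fun p hp => ?_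
  have hp1 : (1 : ℝ) < p := by exact_mod_cast (Nat.prime_of_mem_primeFactors hp).one_lt
  field_simp
  ring

lemma sum_moebius_eq_ite {d R : ℕ} (hd : 0 < d) (hR : d ≤ R) :
    ∑ k ∈ (Finset.Icc 1 R).filter (· ∣ d), (ArithmeticFunction.moebius k : ℝ) =
      if d = 1 then 1 else 0 := by
  have h1 : (Finset.Icc 1 R).filter (· ∣ d) = d.divisors := by
    ext k
    simp only [Finset.mem_filter, Finset.mem_Icc, Nat.mem_divisors]
    constructor
    · rintro ⟨_, h⟩; exact ⟨h, hd.ne'⟩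
    · rintro ⟨h, _⟩
      exact ⟨⟨Nat.pos_of_dvd_of_pos h hd, (Nat.le_of_dvd hd h).trans hR⟩, h⟩
  have h2 := congrArg (fun f : ArithmeticFunction ℤ => f d) ArithmeticFunction.moebius_mul_coe_zeta
  simp only [ArithmeticFunction.coe_mul_zeta_apply, ArithmeticFunction.one_apply] at h2
  rw [h1]
  exact_mod_cast h2

namespace QuadGauge

variable {σ c K : ℝ} (G : QuadGauge σ c K) {M : ℕ} (g h : ZMod M)

/-- Lattice points at which a linear form is invertible mod `M`. -/
def formUnits (T : ℝ) : Set (ℤ × ℤ) :=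
  {z : ℤ × ℤ | IsUnit (g * z.1 + h * z.2) ∧ G.N (z.1, z.2) ≤ T}

/-- Primitive lattice points at which a linear form is invertible mod `M`. -/
def primitiveFormUnits (T : ℝ) : Set (ℤ × ℤ) :=
  {z : ℤ × ℤ | IsCoprime z.1 z.2 ∧ IsUnit (g * z.1 + h * z.2) ∧ G.N (z.1, z.2) ≤ T}

lemma formUnits_finite (hc : 0 < c) (T : ℝ) : (G.formUnits g h T).Finite :=
  (G.finite_le_zero hc T).subset fun _ hz => hz.2

lemma primitiveFormUnits_subset (T : ℝ) : G.primitiveFormUnits g h T ⊆ G.formUnits g h T :=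
  fun _ hz => hz.2

lemma N_int_ge (hc : 0 < c) {z : ℤ × ℤ} (hz : z ≠ 0) {k : ℕ} (h1 : (k : ℤ) ∣ z.1)
    (h2 : (k : ℤ) ∣ z.2) : c * k ^ 2 ≤ G.N (z.1, z.2) := by
  refine le_trans ?_ (G.lower _)
  apply mul_le_mul_of_nonneg_left _ hc.le
  have : (k : ℤ) ^ 2 ≤ z.1 ^ 2 + z.2 ^ 2 := by
    by_cases h : z.1 = 0
    · have h' : z.2 ≠ 0 := fun h' => hz (Prod.ext h h')
      have := Int.le_of_dvd (by positivity) (pow_dvd_pow_of_dvd h2 2)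
      nlinarith [sq_nonneg z.1]
    · have := Int.le_of_dvd (by positivity) (pow_dvd_pow_of_dvd h1 2)
      nlinarith [sq_nonneg z.2]
  simp only
  exact_mod_cast this

lemma formUnits_ne_zero (hM : 1 < M) {T : ℝ} {z : ℤ × ℤ} (hz : z ∈ G.formUnits g h T) :
    z ≠ 0 := by
  rintro rfl
  have : Fact (1 < M) := ⟨hM⟩
  simpa using hz.1

lemma formUnits_eq_empty (hc : 0 < c) (hM : 1 < M) {T : ℝ} (hT : T < c) :
    G.formUnits g h T = ∅ := by
  by_contra hne
  obtain ⟨z, hz⟩ := Set.nonempty_iff_ne_empty.2 hne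
  have := G.N_int_ge hc (G.formUnits_ne_zero g h hM hz) (k := 1) (by simp) (by simp)
  have := hz.2
  norm_num at *
  linarith

lemma ncard_formUnits (hc : 0 < c) (hK : 0 ≤ K) (hσ : 0 ≤ σ) (hM : 1 < M) {s t : ZMod M}
    (hst : IsUnit (g * s + h * t)) {T : ℝ} (hT : 0 ≤ T) :
    |((G.formUnits g h T).ncard : ℝ) - (M.totient / M : ℝ) * (σ * T)| ≤
      M ^ 2 * (3 * σ * K + σ * c) * (T / c) ^ (3 / 4 : ℝ) := by
  classical
  have : NeZero M := ⟨by lia⟩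
  have hM' : (1 : ℝ) < M := by exact_mod_cast hM
  rcases lt_or_ge T c with hTc | hTc
  · rw [G.formUnits_eq_empty g h hc hM hTc]
    have h1 : (M.totient / M : ℝ) ≤ 1 := by
      rw [div_le_one (by linarith)]
      exact_mod_cast Nat.totient_le M
    have h2 : T / c ≤ (T / c) ^ (3 / 4 : ℝ) := by
      have := Real.rpow_le_rpow_of_exponent_ge' (x := T / c) (y := 1) (z := 3 / 4) (by positivity)
        ((div_le_one hc).2 hTc.le) (by norm_num) (by norm_num)
      simpa using this
    simp only [Set.ncard_empty, Nat.cast_zero, zero_sub, abs_neg]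
    rw [abs_of_nonneg (by positivity)]
    calc _ ≤ 1 * (σ * T) := by gcongr
      _ = 1 * (σ * c) * (T / c) := by field_simp
      _ ≤ (M ^ 2) * (3 * σ * K + σ * c) * (T / c) ^ (3 / 4 : ℝ) := by
        gcongr
        · nlinarith
        · have : 0 ≤ 3 * σ * K := by positivity
          linarith
  · have hcard := card_isUnit_linearForm M g h s t hst
    have := G.ncard_residues hc hK hσ M
      (Finset.univ.filter fun r : ZMod M × ZMod M => IsUnit (g * r.1 + h * r.2)) hT
    rw [hcard] at this
    simp only [Finset.mem_filter, Finset.mem_univ, true_and] at this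
    have h1 : (1 : ℝ) ≤ T / c := (one_le_div hc).2 hTc
    have h2 : √(T / c) + 2 ≤ 3 * (T / c) ^ (3 / 4 : ℝ) := by
      have e1 : √(T / c) ≤ (T / c) ^ (3 / 4 : ℝ) := by
        rw [Real.sqrt_eq_rpow]
        exact Real.rpow_le_rpow_of_exponent_le h1 (by norm_num)
      have e2 := Real.one_le_rpow h1 (z := 3 / 4) (by norm_num)
      linarith
    calc _ = |(({z : ℤ × ℤ | IsUnit (g * (z.1 : ZMod M) + h * (z.2 : ZMod M)) ∧
          G.N (z.1, z.2) ≤ T}.ncard : ℝ) - ((M.totient * M : ℕ) : ℝ) / M ^ 2 * (σ * T))| := by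
          congr 2
          push_cast
          field_simp
      _ ≤ _ := this
      _ ≤ M ^ 2 * (σ * K * (3 * (T / c) ^ (3 / 4 : ℝ))) := by gcongr
      _ ≤ _ := by
        have : 0 ≤ σ * c * (T / c) ^ (3 / 4 : ℝ) := by positivity
        nlinarith [sq_nonneg (M : ℝ), mul_nonneg (sq_nonneg (M : ℝ)) this]

lemma ncard_dvd {T : ℝ} {k : ℕ} (hk : 0 < k) :
    ({z ∈ G.formUnits g h T | (k : ℤ) ∣ z.1 ∧ (k : ℤ) ∣ z.2}.ncard : ℝ) =
      if k.Coprime M then ((G.formUnits g h (T / k ^ 2)).ncard : ℝ) else 0 := by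
  have hk' : (0 : ℝ) < k := by exact_mod_cast hk
  split_ifs with hkM
  · have hu := (ZMod.isUnit_iff_coprime k M).2 hkM
    have : {z ∈ G.formUnits g h T | (k : ℤ) ∣ z.1 ∧ (k : ℤ) ∣ z.2} =
        (fun z : ℤ × ℤ => ((k : ℤ) * z.1, (k : ℤ) * z.2)) '' G.formUnits g h (T / k ^ 2) := by
      have hiff : ∀ z : ℤ × ℤ, ((k : ℤ) * z.1, (k : ℤ) * z.2) ∈ G.formUnits g h T ↔
          z ∈ G.formUnits g h (T / k ^ 2) := by
        intro z
        simp only [formUnits, Set.mem_ofPred_eq]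
        push_cast
        rw [G.smul k (z.1, z.2), le_div_iff₀ (by positivity), mul_comm (G.N _)]
        have : g * ((k : ZMod M) * z.1) + h * (k * z.2) = k * (g * z.1 + h * z.2) := by ring
        rw [this, IsUnit.mul_iff, and_iff_right hu]
      ext z
      simp only [Set.mem_image]
      constructor
      · rintro ⟨hz, ⟨x, hx⟩, y, hy⟩
        refine ⟨(x, y), ?_, by ext <;> simp [hx, hy]⟩
        rw [← hiff]
        simpa [← hx, ← hy] using hz
      · rintro ⟨x, hx, rfl⟩
        exact ⟨(hiff x).2 hx, by simp, by simp⟩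
    rw [this, Set.ncard_image_of_injective]
    intro z z' e
    simp only [Prod.mk.injEq] at e
    have hk0 : (k : ℤ) ≠ 0 := by exact_mod_cast hk.ne'
    exact Prod.ext (mul_left_cancel₀ hk0 e.1) (mul_left_cancel₀ hk0 e.2)
  · have : {z ∈ G.formUnits g h T | (k : ℤ) ∣ z.1 ∧ (k : ℤ) ∣ z.2} = ∅ := by
      ext z
      simp only [Set.mem_ofPred_eq, Set.mem_empty_iff_false, iff_false]
      rintro ⟨hz, ⟨x, hx⟩, y, hy⟩
      apply hkM
      rw [← ZMod.isUnit_iff_coprime]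
      have := hz.1
      rw [hx, hy] at this
      push_cast at this
      rw [show g * ((k : ZMod M) * x) + h * (k * y) = k * (g * x + h * y) by ring] at this
      exact (IsUnit.mul_iff.1 this).1
    rw [this]; simp

lemma ncard_primitive_eq_sum (hc : 0 < c) (hM : 1 < M) {T : ℝ} {R : ℕ} (hR : T ≤ c * R ^ 2) :
    ((G.primitiveFormUnits g h T).ncard : ℝ) =
      ∑ k ∈ Finset.Icc 1 R, moebiusCoprime M k * (G.formUnits g h (T / k ^ 2)).ncard := by
  classical
  have hfin := G.formUnits_finite g h hc T
  set S := hfin.toFinset with hS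
  have hmem : ∀ z, z ∈ S ↔ z ∈ G.formUnits g h T := fun z => by simp [hS]
  have h1 : G.primitiveFormUnits g h T = (S.filter fun z => Int.gcd z.1 z.2 = 1 : Finset _) := by
    ext z
    rw [Finset.coe_filter, Set.mem_ofPred_eq, hmem, ← Int.isCoprime_iff_gcd_eq_one, and_comm]
    rfl
  rw [h1, Set.ncard_coe_finset, Finset.card_filter]
  push_cast
  have h2 : ∀ z ∈ S, (if Int.gcd z.1 z.2 = 1 then (1 : ℝ) else 0) =
      ∑ k ∈ Finset.Icc 1 R, if ((k : ℤ) ∣ z.1 ∧ (k : ℤ) ∣ z.2) then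
        (ArithmeticFunction.moebius k : ℝ) else 0 := by
    intro z hz
    rw [hmem] at hz
    have hz0 := G.formUnits_ne_zero g h hM hz
    have hd : 0 < Int.gcd z.1 z.2 := by
      rw [Int.gcd_pos_iff]
      by_contra hcon
      push Not at hcon
      exact hz0 (Prod.ext hcon.1 hcon.2)
    have hdR : Int.gcd z.1 z.2 ≤ R := by
      have e := (G.N_int_ge hc hz0 (Int.gcd_dvd_left z.1 z.2) (Int.gcd_dvd_right z.1 z.2)).trans
        (hz.2.trans hR)
      have e' := le_of_mul_le_mul_left e hc
      exact_mod_cast le_of_sq_le_sq e' (Nat.cast_nonneg _)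
    rw [← sum_moebius_eq_ite hd hdR, Finset.sum_filter]
    refine Finset.sum_congr rfl fun k _ => ?_
    congr 1
    rw [← Int.dvd_coe_gcd_iff, Int.natCast_dvd_natCast]
  rw [Finset.sum_congr rfl h2, Finset.sum_comm]
  refine Finset.sum_congr rfl fun k hk => ?_
  have h3 := G.ncard_dvd g h (T := T) (Finset.mem_Icc.1 hk).1
  rw [← Finset.sum_filter, Finset.sum_const, nsmul_eq_mul]
  have h4 : {z ∈ G.formUnits g h T | (k : ℤ) ∣ z.1 ∧ (k : ℤ) ∣ z.2} =
      (S.filter fun z => (k : ℤ) ∣ z.1 ∧ (k : ℤ) ∣ z.2 : Finset _) := by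
    ext z
    rw [Finset.coe_filter, Set.mem_ofPred_eq, Set.mem_ofPred_eq, hmem]
  rw [h4, Set.ncard_coe_finset] at h3
  rw [h3, moebiusCoprime]
  split_ifs <;> ring

lemma ncard_term_le (hc : 0 < c) (hK : 0 ≤ K) (hσ : 0 ≤ σ) (hM : 1 < M) {s t : ZMod M}
    (hst : IsUnit (g * s + h * t)) {T : ℝ} (hT : 0 ≤ T) (k : ℕ) :
    |moebiusCoprime M k * (G.formUnits g h (T / k ^ 2)).ncard -
        moebiusCoprime M k * ((M.totient / M : ℝ) * (σ * (T / k ^ 2)))| ≤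
      M ^ 2 * (3 * σ * K + σ * c) * (T / c) ^ (3 / 4 : ℝ) * (1 / (k : ℝ) ^ (3 / 2 : ℝ)) := by
  have h1 := G.ncard_formUnits g h hc hK hσ hM hst (T := T / k ^ 2) (by positivity)
  rw [← mul_sub, abs_mul]
  calc _ ≤ 1 * (M ^ 2 * (3 * σ * K + σ * c) * (T / k ^ 2 / c) ^ (3 / 4 : ℝ)) := by
        gcongr
        exact abs_moebiusCoprime_le_one M k
    _ = _ := by
      rw [one_mul, div_right_comm, Real.div_rpow (by positivity) (by positivity),
        ← Real.rpow_natCast (k : ℝ) 2, ← Real.rpow_mul (by positivity)]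
      norm_num
      ring

/-- Counting primitive points at which a linear form is invertible mod `M`. -/
lemma ncard_primitive (hc : 0 < c) (hK : 0 ≤ K) (hσ : 0 ≤ σ) (hM : 1 < M) {s t : ZMod M}
    (hst : IsUnit (g * s + h * t)) {T : ℝ} (hT : 0 ≤ T) :
    |((G.primitiveFormUnits g h T).ncard : ℝ) -
        6 / π ^ 2 * (∏ p ∈ M.primeFactors, (1 + (p : ℝ)⁻¹)⁻¹) * (σ * T)| ≤
      M ^ 2 * (3 * σ * K + σ * c) * (T / c) ^ (3 / 4 : ℝ) *
        ∑' k : ℕ, 1 / (k : ℝ) ^ (3 / 2 : ℝ) := by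
  have : NeZero M := ⟨by lia⟩
  obtain ⟨R, hR⟩ : ∃ R : ℕ, T / c < R := exists_nat_gt _
  have hR1 : 1 ≤ R := by
    have : (0 : ℝ) < R := lt_of_le_of_lt (by positivity) hR
    exact_mod_cast this
  have hRT : ∀ k : ℕ, R ≤ k → T < c * k ^ 2 := by
    intro k hk
    have hk' : (R : ℝ) ≤ k := by exact_mod_cast hk
    have hR1' : (1 : ℝ) ≤ R := by exact_mod_cast hR1
    rw [div_lt_iff₀ hc] at hR
    have : (R : ℝ) ≤ k ^ 2 := by nlinarith
    nlinarith
  have hsum : HasSum (fun k : ℕ => moebiusCoprime M k * (G.formUnits g h (T / k ^ 2)).ncard)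
      ((G.primitiveFormUnits g h T).ncard : ℝ) := by
    rw [G.ncard_primitive_eq_sum g h hc hM (hRT R le_rfl).le]
    apply hasSum_sum_of_ne_finset_zero
    intro k hk
    rcases Nat.eq_zero_or_pos k with rfl | hk0
    · rw [moebiusCoprime_zero, zero_mul]
    · have hk' : R ≤ k := by
        rw [Finset.mem_Icc] at hk
        lia
      rw [G.formUnits_eq_empty g h hc hM]
      · simp
      · rw [div_lt_iff₀ (by positivity)]
        exact hRT k hk'
  have hmain : HasSum (fun k : ℕ => moebiusCoprime M k * ((M.totient / M : ℝ) * (σ * (T / k ^ 2))))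
      (6 / π ^ 2 * (∏ p ∈ M.primeFactors, (1 + (p : ℝ)⁻¹)⁻¹) * (σ * T)) := by
    rw [← totient_div_mul_tsum_moebiusCoprime M]
    rw [show ∀ x : ℝ, (M.totient / M : ℝ) * x * (σ * T) = M.totient / M * (σ * T) * x by
      intro x; ring]
    have e : (fun k : ℕ => moebiusCoprime M k * ((M.totient / M : ℝ) * (σ * (T / k ^ 2)))) =
        fun k : ℕ => (M.totient / M * (σ * T) : ℝ) * (moebiusCoprime M k / (k : ℝ) ^ 2) := by
      funext k; ring
    rw [e]
    exact (summable_moebiusCoprime M).hasSum.mul_left _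
  have hz : Summable fun k : ℕ => 1 / (k : ℝ) ^ (3 / 2 : ℝ) :=
    Real.summable_one_div_nat_rpow.2 (by norm_num)
  have hbound := hz.hasSum.mul_left (M ^ 2 * (3 * σ * K + σ * c) * (T / c) ^ (3 / 4 : ℝ))
  refine abs_le.2 ⟨?_, ?_⟩
  · rw [← neg_le_neg_iff, neg_neg, neg_sub]
    refine hasSum_le (fun k => ?_) (hmain.sub hsum) hbound
    rw [← neg_sub]
    exact (neg_le_abs _).trans (G.ncard_term_le g h hc hK hσ hM hst hT k)
  · refine hasSum_le (fun k => ?_) (hsum.sub hmain) hbound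
    exact (le_abs_self _).trans (G.ncard_term_le g h hc hK hσ hM hst hT k)

/-- A crude upper bound for the number of primitive points. -/
lemma ncard_primitive_le (hc : 0 < c) (hK : 0 ≤ K) (hσ : 0 ≤ σ) (hM : 1 < M) {T : ℝ} (hT : 0 ≤ T) :
    ((G.primitiveFormUnits g h T).ncard : ℝ) ≤ (σ + 3 * σ * K / c) * T := by
  rcases lt_or_ge T c with hTc | hTc
  · have : G.primitiveFormUnits g h T = ∅ := by
      apply Set.subset_empty_iff.1
      rw [← G.formUnits_eq_empty g h hc hM hTc]
      exact G.primitiveFormUnits_subset g h T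
    rw [this, Set.ncard_empty, Nat.cast_zero]
    positivity
  · have h1 : (G.primitiveFormUnits g h T).ncard ≤
        {z : ℤ × ℤ | G.N ((0 : ℝ × ℝ).1 + z.1, (0 : ℝ × ℝ).2 + z.2) ≤ T}.ncard := by
      apply Set.ncard_le_ncard _ (G.finite_le hc 0 T)
      intro z hz
      simpa using hz.2.2
    have h2 := (abs_le.1 (G.ncard_translate hc hK hσ 0 hT)).2
    have h3 : (1 : ℝ) ≤ T / c := (one_le_div hc).2 hTc
    have h4 : √(T / c) ≤ T / c := by
      rw [Real.sqrt_le_left (by positivity)]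
      nlinarith
    have h5 : σ * K * (√(T / c) + 2) ≤ σ * K * (3 * (T / c)) := by gcongr; linarith
    have h6 : ((G.primitiveFormUnits g h T).ncard : ℝ) ≤
        {z : ℤ × ℤ | G.N ((0 : ℝ × ℝ).1 + z.1, (0 : ℝ × ℝ).2 + z.2) ≤ T}.ncard := by
      exact_mod_cast h1
    calc _ ≤ σ * T + σ * K * (3 * (T / c)) := by linarith
      _ = _ := by ring

end QuadGauge

lemma abs_evenForm_add_sub_le {A B C D R s t e f : ℝ} (hA : |A| ≤ 2 * D) (hB : |B| ≤ 5 * D)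
    (hC : |C| ≤ 2 * D) (hs : |s| ≤ R) (ht : |t| ≤ R) (he : |e| ≤ 1) (hf : |f| ≤ 1) :
    |evenForm A B C (s + e) (t + f) - evenForm A B C s t| ≤ 28 * D * (R + 1) := by
  have hR : 0 ≤ R := (abs_nonneg _).trans hs
  have hD : 0 ≤ D := by linarith [abs_nonneg A]
  have key : ∀ p q e f : ℝ, |p| ≤ R → |q| ≤ R → |e| ≤ 1 → |f| ≤ 1 →
      |p * f + q * e + e * f| ≤ 2 * R + 1 := by
    intro p q e f hp hq he hf
    have h1 : |p * f| ≤ R * 1 := by rw [abs_mul]; gcongr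
    have h2 : |q * e| ≤ R * 1 := by rw [abs_mul]; gcongr
    have h3 : |e * f| ≤ 1 * 1 := by rw [abs_mul]; gcongr
    have h4 := abs_add_le (p * f + q * e) (e * f)
    have h5 := abs_add_le (p * f) (q * e)
    linarith
  have e0 : evenForm A B C (s + e) (t + f) - evenForm A B C s t =
      A * (s * e + s * e + e * e) + 2 * (B * (s * f + t * e + e * f)) +
        C * (t * f + t * f + f * f) := by
    unfold evenForm; ring
  rw [e0]
  have h1 : |A * (s * e + s * e + e * e)| ≤ 2 * D * (2 * R + 1) := by
    rw [abs_mul]; gcongr; exact key _ _ _ _ hs hs he he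
  have h2 : |B * (s * f + t * e + e * f)| ≤ 5 * D * (2 * R + 1) := by
    rw [abs_mul]; gcongr; exact key _ _ _ _ hs ht he hf
  have h3 : |C * (t * f + t * f + f * f)| ≤ 2 * D * (2 * R + 1) := by
    rw [abs_mul]; gcongr; exact key _ _ _ _ ht ht hf hf
  have h4 := abs_add_le (A * (s * e + s * e + e * e) + 2 * (B * (s * f + t * e + e * f)))
    (C * (t * f + t * f + f * f))
  have h5 := abs_add_le (A * (s * e + s * e + e * e)) (2 * (B * (s * f + t * e + e * f)))
  rw [abs_mul 2, abs_two] at h5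
  have : 14 * D * (2 * R + 1) ≤ 28 * D * (R + 1) := by nlinarith
  linarith

/-- Coefficient bounds for a form dominated by a reduced positive definite form. -/
lemma abs_coeff_le_of_reduced {A B C uA uB uC D W : ℝ} (hW : 0 ≤ W) (hu : 0 < uA)
    (h1 : 2 * |uB| ≤ uA) (h2 : uA ≤ uC) (hdet : uA * uC - uB ^ 2 = D) (hA1 : 1 ≤ uA)
    (h : ∀ s t : ℝ, |evenForm A B C s t| ≤ W * |evenForm uA uB uC s t|) :
    |A| ≤ 2 * (D * W) ∧ |B| ≤ 5 * (D * W) ∧ |C| ≤ 2 * (D * W) := by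
  have hB : uB ^ 2 ≤ uA * uC / 4 := by
    rw [← sq_abs]
    nlinarith [abs_nonneg uB]
  have hAC : uA * uC ≤ 2 * D := by nlinarith
  have hC2 : uC ≤ 2 * D := by nlinarith
  have hA2 : uA ≤ 2 * D := h2.trans hC2
  have e1 := h 1 0
  have e2 := h 0 1
  have e3 := h 1 1
  simp only [evenForm] at e1 e2 e3
  norm_num at e1 e2 e3
  rw [abs_of_pos hu] at e1
  rw [abs_of_pos (hu.trans_le h2)] at e2
  have hA : |A| ≤ 2 * (D * W) := by nlinarith
  have hC : |C| ≤ 2 * (D * W) := by nlinarith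
  refine ⟨hA, ?_, hC⟩
  have h6 : |uA + 2 * uB + uC| ≤ 6 * D := by
    rw [abs_le]
    constructor <;> nlinarith [neg_abs_le uB, le_abs_self uB]
  have h7 : |A + 2 * B + C| ≤ 6 * (D * W) := by nlinarith
  rw [abs_le] at *
  constructor <;> linarith [hA.1, hA.2, hC.1, hC.2, h7.1, h7.2]

namespace ConicParam

variable {a b w : ℕ} (P : ConicParam a b w)

lemma abs_x_le (ha : 0 < a) (s t : ℝ) : |P.x s t| ≤ √w * |P.u s t| := by
  have h := P.conic s t
  have ha' : (1 : ℝ) ≤ a := by exact_mod_cast ha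
  rw [← Real.sqrt_sq_eq_abs, ← Real.sqrt_sq_eq_abs, ← Real.sqrt_mul (Nat.cast_nonneg _)]
  apply Real.sqrt_le_sqrt
  simp only [x, u]
  rw [← h]
  have hb : (0 : ℝ) ≤ b * evenForm (P.yA : ℝ) P.yB P.yC s t ^ 2 := by positivity
  nlinarith [sq_nonneg (evenForm (P.xA : ℝ) P.xB P.xC s t)]

lemma abs_y_le (hb : 0 < b) (s t : ℝ) : |P.y s t| ≤ √w * |P.u s t| := by
  have h := P.conic s t
  have ha' : (1 : ℝ) ≤ b := by exact_mod_cast hb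
  rw [← Real.sqrt_sq_eq_abs, ← Real.sqrt_sq_eq_abs, ← Real.sqrt_mul (Nat.cast_nonneg _)]
  apply Real.sqrt_le_sqrt
  simp only [y, u]
  rw [← h]
  have hb : (0 : ℝ) ≤ a * evenForm (P.xA : ℝ) P.xB P.xC s t ^ 2 := by positivity
  nlinarith [sq_nonneg (evenForm (P.yA : ℝ) P.yB P.yC s t)]

lemma sqrt_mul_u_le_gauge (z : ℝ × ℝ) : √w * |P.u z.1 z.2| ≤ √(a + b) * P.gauge z := by
  have h := P.conic z.1 z.2
  have hg := P.gauge_nonneg z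
  rw [← Real.sqrt_sq_eq_abs, ← Real.sqrt_mul (Nat.cast_nonneg _), ← Real.sqrt_sq hg,
    ← Real.sqrt_mul (by positivity)]
  apply Real.sqrt_le_sqrt
  simp only [u]
  rw [← h]
  have h1 : |P.x z.1 z.2| ≤ P.gauge z := le_max_left _ _
  have h2 : |P.y z.1 z.2| ≤ P.gauge z := le_max_right _ _
  have h1' : P.x z.1 z.2 ^ 2 ≤ P.gauge z ^ 2 := by rw [← sq_abs]; gcongr
  have h2' : P.y z.1 z.2 ^ 2 ≤ P.gauge z ^ 2 := by rw [← sq_abs]; gcongr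
  simp only [x, y] at h1' h2'
  have : (0 : ℝ) ≤ a := Nat.cast_nonneg _
  have : (0 : ℝ) ≤ b := Nat.cast_nonneg _
  nlinarith

/-- The normalized gauge of a parametrization whose third form is reduced. -/
noncomputable def quadGauge (ha : 0 < a) (hb : 0 < b) (hw : 0 < w) (h1 : 2 * |P.uB| ≤ P.uA)
    (h2 : P.uA ≤ P.uC) : QuadGauge (sigmaInf a b) (1 / (2 * √(a + b))) (28 * (a * b)) where
  N z := P.gauge z / √w
  smul k z := by rw [P.gauge_smul, mul_div_assoc]
  area T hT := by
    have hw' : (0 : ℝ) < √w := Real.sqrt_pos.2 (by exact_mod_cast hw)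
    simp_rw [div_le_iff₀ hw']
    rw [P.volume_gauge_le ha hb hw (by positivity)]
    congr 1
    field_simp
  lower z := by
    have hw' : (0 : ℝ) < √w := Real.sqrt_pos.2 (by exact_mod_cast hw)
    have hab : (0 : ℝ) < √(a + b) := Real.sqrt_pos.2 (by positivity)
    have h := P.sqrt_mul_u_le_gauge z
    have hu1 : (1 : ℝ) ≤ P.uA := by exact_mod_cast P.uA_pos
    have h1' : 2 * |(P.uB : ℝ)| ≤ P.uA := by exact_mod_cast h1
    have h2' : (P.uA : ℝ) ≤ P.uC := by exact_mod_cast h2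
    have hu : (z.1 ^ 2 + z.2 ^ 2) / 2 ≤ |P.u z.1 z.2| := by
      refine le_trans ?_ (le_abs_self _)
      simp only [u, evenForm]
      have e1 : |2 * P.uB * (z.1 * z.2)| ≤ P.uA * |z.1 * z.2| := by
        rw [abs_mul, abs_mul, abs_two]; gcongr
      have e2 : |z.1 * z.2| ≤ (z.1 ^ 2 + z.2 ^ 2) / 2 := by
        rw [abs_le]; constructor <;> nlinarith [sq_nonneg (z.1 - z.2), sq_nonneg (z.1 + z.2)]
      have e3 := neg_abs_le (2 * P.uB * (z.1 * z.2))
      have e4 : (P.uA : ℝ) * z.2 ^ 2 ≤ P.uC * z.2 ^ 2 := by gcongr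
      have e5 : (P.uA : ℝ) * |z.1 * z.2| ≤ P.uA * ((z.1 ^ 2 + z.2 ^ 2) / 2) := by gcongr
      have e6 : (z.1 ^ 2 + z.2 ^ 2) / 2 ≤ (P.uA : ℝ) * ((z.1 ^ 2 + z.2 ^ 2) / 2) := by
        have : 0 ≤ (z.1 ^ 2 + z.2 ^ 2) / 2 := by positivity
        nlinarith
      nlinarith
    rw [le_div_iff₀ hw', one_div, inv_mul_eq_div, div_mul_eq_mul_div, div_le_iff₀ (by positivity)]
    nlinarith
  lip R z e hz1 hz2 he1 he2 := by
    have hw' : (0 : ℝ) < √w := Real.sqrt_pos.2 (by exact_mod_cast hw)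
    have hu0 : (0 : ℝ) < P.uA := by exact_mod_cast P.uA_pos
    have hu1 : (1 : ℝ) ≤ P.uA := by exact_mod_cast P.uA_pos
    have h1' : 2 * |(P.uB : ℝ)| ≤ P.uA := by exact_mod_cast h1
    have h2' : (P.uA : ℝ) ≤ P.uC := by exact_mod_cast h2
    have hd : (P.uA : ℝ) * P.uC - P.uB ^ 2 = a * b := by exact_mod_cast P.disc_u
    obtain ⟨c1, c2, c3⟩ := abs_coeff_le_of_reduced hw'.le hu0 h1' h2' hd hu1 (P.abs_x_le ha)
    obtain ⟨d1, d2, d3⟩ := abs_coeff_le_of_reduced hw'.le hu0 h1' h2' hd hu1 (P.abs_y_le hb)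
    have hx := abs_evenForm_add_sub_le c1 c2 c3 hz1 hz2 he1 he2
    have hy := abs_evenForm_add_sub_le d1 d2 d3 hz1 hz2 he1 he2
    rw [div_le_iff₀ hw', add_mul, div_mul_cancel₀ _ hw'.ne']
    have g1 : |P.x z.1 z.2| ≤ P.gauge z := le_max_left _ _
    have g2 : |P.y z.1 z.2| ≤ P.gauge z := le_max_right _ _
    simp only [x, y] at g1 g2
    simp only [gauge, x, y]
    apply max_le
    · have := abs_sub_abs_le_abs_sub (evenForm (P.xA : ℝ) P.xB P.xC (z.1 + e.1) (z.2 + e.2))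
        (evenForm (P.xA : ℝ) P.xB P.xC z.1 z.2)
      simp only [gauge, x, y] at g1
      linarith
    · have := abs_sub_abs_le_abs_sub (evenForm (P.yA : ℝ) P.yB P.yC (z.1 + e.1) (z.2 + e.2))
        (evenForm (P.yA : ℝ) P.yB P.yC z.1 z.2)
      simp only [gauge, x, y] at g2
      linarith

end ConicParam

/-- The polarization of `evenForm`. -/
def polarForm {R : Type*} [CommRing R] (A B C s t s' t' : R) : R :=
  A * s * s' + B * (s * t' + t * s') + C * t * t'

lemma evenForm_comp {R : Type*} [CommRing R] (A B C p q r s m n : R) :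
    evenForm A B C (p * m + q * n) (r * m + s * n) =
      evenForm (evenForm A B C p r) (polarForm A B C p r q s) (evenForm A B C q s) m n := by
  simp only [evenForm, polarForm]; ring

lemma exists_reduced_form (N : ℕ) : ∀ A B C : ℤ, 0 < A → A ≤ N → 0 < A * C - B ^ 2 →
    ∃ p q r s : ℤ, p * s - q * r = 1 ∧
      2 * |polarForm A B C p r q s| ≤ evenForm A B C p r ∧
      evenForm A B C p r ≤ evenForm A B C q s ∧ 0 < evenForm A B C p r := by
  induction N with
  | zero => intro A B C h1 h2; simp at h2; lia
  | succ N ih =>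
    intro A B C hA hAN hD
    set k : ℤ := -((2 * B + A) / (2 * A)) with hk
    have hB' : 2 * |B + k * A| ≤ A := by
      have e1 := Int.emod_add_mul_ediv (2 * B + A) (2 * A)
      have e2 := Int.emod_nonneg (2 * B + A) (show 2 * A ≠ 0 by lia)
      have e3 := Int.emod_lt_of_pos (2 * B + A) (show 0 < 2 * A by lia)
      rw [← abs_two, ← abs_mul, abs_le]
      constructor <;> nlinarith
    by_cases hC : A ≤ evenForm A B C k 1
    · refine ⟨1, k, 0, 1, by ring, ?_, ?_, ?_⟩
      · have : polarForm A B C 1 0 k 1 = B + k * A := by simp only [polarForm]; ring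
        rw [this]
        have : evenForm A B C 1 0 = A := by simp only [evenForm]; ring
        rw [this]; exact hB'
      · have : evenForm A B C 1 0 = A := by simp only [evenForm]; ring
        rw [this]; exact hC
      · have : evenForm A B C 1 0 = A := by simp only [evenForm]; ring
        rw [this]; exact hA
    · push Not at hC
      have hdet : evenForm A B C k 1 * A - (-(B + k * A)) ^ 2 = A * C - B ^ 2 := by
        simp only [evenForm]; ring
      have hpos : 0 < evenForm A B C k 1 := by nlinarith [sq_nonneg (-(B + k * A))]
      obtain ⟨p, q, r, s, h1, h2, h3, h4⟩ := ih (evenForm A B C k 1) (-(B + k * A)) A hpos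
        (by push_cast at hAN; lia) (by rw [hdet]; exact hD)
      refine ⟨k * p - r, k * q - s, p, q, by linear_combination h1, ?_⟩
      have e1 : ∀ x y, evenForm A B C (k * x - y) x =
          evenForm (evenForm A B C k 1) (-(B + k * A)) A x y := by
        intro x y; simp only [evenForm]; ring
      have e2 : polarForm A B C (k * p - r) p (k * q - s) q =
          polarForm (evenForm A B C k 1) (-(B + k * A)) A p r q s := by
        simp only [evenForm, polarForm]; ring
      rw [e1, e1, e2]
      exact ⟨h2, h3, h4⟩

namespace ConicParam

variable {a b w : ℕ} (P : ConicParam a b w)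

/-- Unimodular substitution in a parametrization. -/
def act (p q r s : ℤ) (h : p * s - q * r = 1) (hu : 0 < evenForm P.uA P.uB P.uC p r) :
    ConicParam a b w where
  xA := evenForm P.xA P.xB P.xC p r
  xB := polarForm P.xA P.xB P.xC p r q s
  xC := evenForm P.xA P.xB P.xC q s
  yA := evenForm P.yA P.yB P.yC p r
  yB := polarForm P.yA P.yB P.yC p r q s
  yC := evenForm P.yA P.yB P.yC q s
  uA := evenForm P.uA P.uB P.uC p r
  uB := polarForm P.uA P.uB P.uC p r q s
  uC := evenForm P.uA P.uB P.uC q s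
  disc_x := by
    simp only [evenForm, polarForm]
    linear_combination (p * s - q * r) ^ 2 * P.disc_x + (b * w) * ((p * s - q * r) + 1) * h
  disc_y := by
    simp only [evenForm, polarForm]
    linear_combination (p * s - q * r) ^ 2 * P.disc_y + (a * w) * ((p * s - q * r) + 1) * h
  disc_u := by
    simp only [evenForm, polarForm]
    linear_combination (p * s - q * r) ^ 2 * P.disc_u + (a * b) * ((p * s - q * r) + 1) * h
  polar_xy := by
    simp only [evenForm, polarForm]
    linear_combination (p * s - q * r) ^ 2 * P.polar_xy
  polar_xu := by
    simp only [evenForm, polarForm]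
    linear_combination (p * s - q * r) ^ 2 * P.polar_xu
  polar_yu := by
    simp only [evenForm, polarForm]
    linear_combination (p * s - q * r) ^ 2 * P.polar_yu
  uA_pos := hu
  conic m n := by
    have := P.conic (p * m + q * n) (r * m + s * n)
    simp only [evenForm_comp] at this
    have e : ∀ A B C x y : ℤ, ((evenForm A B C x y : ℤ) : ℝ) = evenForm (A : ℝ) B C x y := by
      intro A B C x y; simp [evenForm]
    have e' : ∀ A B C x y z t : ℤ, ((polarForm A B C x y z t : ℤ) : ℝ) =
        polarForm (A : ℝ) B C x y z t := by
      intro A B C x y z t; simp [polarForm]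
    simpa only [e, e'] using this

lemma gauge_act (p q r s : ℤ) (h : p * s - q * r = 1)
    (hu : 0 < evenForm P.uA P.uB P.uC p r) (z : ℝ × ℝ) :
    (P.act p q r s h hu).gauge z = P.gauge (p * z.1 + q * z.2, r * z.1 + s * z.2) := by
  simp only [gauge, x, y, evenForm_comp, act]
  simp [evenForm, polarForm]

/-- Primitive integral points of bounded gauge at which a linear form is invertible. -/
def points {M : ℕ} (g h : ZMod M) (B : ℝ) : Set (ℤ × ℤ) :=
  {z : ℤ × ℤ | IsCoprime z.1 z.2 ∧ IsUnit (g * z.1 + h * z.2) ∧ P.gauge (z.1, z.2) ≤ B}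

lemma ncard_points_act {M : ℕ} (g h : ZMod M) (B : ℝ) (p q r s : ℤ) (hd : p * s - q * r = 1)
    (hu : 0 < evenForm P.uA P.uB P.uC p r) :
    ((P.act p q r s hd hu).points (g * (p : ZMod M) + h * (r : ZMod M))
      (g * (q : ZMod M) + h * (s : ZMod M)) B).ncard =
      (P.points g h B).ncard := by
  refine Set.ncard_congr (fun z _ => (p * z.1 + q * z.2, r * z.1 + s * z.2)) ?_ ?_ ?_
  · rintro z ⟨⟨x, y, hxy⟩, h2, h3⟩
    refine ⟨⟨x * s - y * r, y * p - x * q, ?_⟩, ?_, ?_⟩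
    · linear_combination hxy + (x * z.1 + y * z.2) * hd
    · convert h2 using 1
      push_cast
      ring
    · rw [gauge_act] at h3
      simpa using h3
  · rintro z z' _ _ e
    simp only [Prod.mk.injEq] at e
    obtain ⟨e1, e2⟩ := e
    ext
    · linear_combination s * e1 - q * e2 + (z'.1 - z.1) * hd
    · linear_combination p * e2 - r * e1 + (z'.2 - z.2) * hd
  · rintro ⟨z₁, z₂⟩ ⟨⟨x, y, hxy⟩, h2, h3⟩
    obtain ⟨m, n, rfl, rfl⟩ : ∃ m n : ℤ, z₁ = p * m + q * n ∧ z₂ = r * m + s * n :=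
      ⟨s * z₁ - q * z₂, p * z₂ - r * z₁, by linear_combination -z₁ * hd,
        by linear_combination -z₂ * hd⟩
    refine ⟨(m, n), ⟨⟨x * p + y * r, x * q + y * s, ?_⟩, ?_, ?_⟩, rfl⟩
    · linear_combination hxy
    · convert h2 using 1
      push_cast
      ring
    · rw [gauge_act]
      push_cast at h3 ⊢
      exact h3

lemma exists_points_reduced (ha : 0 < a) (hb : 0 < b) {M : ℕ} (g h s t : ZMod M)
    (hst : IsUnit (g * s + h * t)) :
    ∃ (P' : ConicParam a b w) (g' h' s' t' : ZMod M), IsUnit (g' * s' + h' * t') ∧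
      2 * |P'.uB| ≤ P'.uA ∧ P'.uA ≤ P'.uC ∧
      ∀ B, (P'.points g' h' B).ncard = (P.points g h B).ncard := by
  obtain ⟨p, q, r, s₁, h1, h2, h3, h4⟩ := exists_reduced_form P.uA.toNat P.uA P.uB P.uC P.uA_pos
    (Int.self_le_toNat _) (by rw [P.disc_u]; positivity)
  refine ⟨P.act p q r s₁ h1 h4, g * p + h * r, g * q + h * s₁, s₁ * s - q * t, p * t - r * s,
    ?_, h2, h3, fun B => P.ncard_points_act g h B p q r s₁ h1 h4⟩
  convert hst using 1
  have h1' : (p : ZMod M) * s₁ - q * r = 1 := by exact_mod_cast congrArg (Int.cast (R := ZMod M)) h1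
  linear_combination (g * s + h * t) * h1'

end ConicParam

/-- Uniform asymptotics for the number of primitive points of bounded gauge. -/
theorem exists_ncard_points_bound (a b : ℕ) (ha : 0 < a) (hb : 0 < b) :
    ∃ K : ℝ, 0 < K ∧ ∀ (w : ℕ) (_ : 0 < w) (P : ConicParam a b w) (M : ℕ) (_ : 1 < M)
      (g h s t : ZMod M) (_ : IsUnit (g * s + h * t)) (B : ℝ) (_ : 0 ≤ B),
      |((P.points g h B).ncard : ℝ) - 6 / π ^ 2 * (∏ p ∈ M.primeFactors, (1 + (p : ℝ)⁻¹)⁻¹) *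
        (sigmaInf a b * (B / √w))| ≤ K * M ^ 2 * B ^ (3 / 4 : ℝ) ∧
      ((P.points g h B).ncard : ℝ) ≤ K * (B / √w) := by
  have ha' : (0 : ℝ) < a := by exact_mod_cast ha
  have hb' : (0 : ℝ) < b := by exact_mod_cast hb
  have hσ := sigmaInf_nonneg a b
  set c : ℝ := 1 / (2 * √(a + b)) with hc
  have hc0 : 0 < c := by positivity
  set Z : ℝ := ∑' k : ℕ, 1 / (k : ℝ) ^ (3 / 2 : ℝ)
  have hZ : 0 ≤ Z := tsum_nonneg fun k => by positivity
  set K1 : ℝ := (3 * sigmaInf a b * (28 * (a * b)) + sigmaInf a b * c) *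
    (c ^ (3 / 4 : ℝ))⁻¹ * Z
  set K2 : ℝ := sigmaInf a b + 3 * sigmaInf a b * (28 * (a * b)) / c
  have hK1 : 0 ≤ K1 := by positivity
  have hK2 : 0 ≤ K2 := by positivity
  refine ⟨K1 + K2 + 1, by positivity, fun w hw P M hM g h s t hst B hB => ?_⟩
  obtain ⟨P', g', h', s', t', hst', hr1, hr2, hcard⟩ := P.exists_points_reduced ha hb g h s t hst
  have hw' : (0 : ℝ) < √w := Real.sqrt_pos.2 (by exact_mod_cast hw)
  have hw1 : (1 : ℝ) ≤ √w := by
    rw [Real.one_le_sqrt]; exact_mod_cast hw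
  set G := P'.quadGauge ha hb hw hr1 hr2
  have hset : P'.points g' h' B = G.primitiveFormUnits g' h' (B / √w) := by
    ext z
    simp only [ConicParam.points, QuadGauge.primitiveFormUnits, Set.mem_ofPred_eq, G,
      ConicParam.quadGauge]
    rw [div_le_div_iff_of_pos_right hw']
  rw [← hcard, hset]
  have hT : 0 ≤ B / √w := by positivity
  have h1 := G.ncard_primitive g' h' hc0 (by positivity) hσ hM hst' hT
  have h2 := G.ncard_primitive_le g' h' hc0 (by positivity) hσ hM hT
  constructor
  · refine h1.trans ?_
    have e : (B / √w / c) ^ (3 / 4 : ℝ) ≤ (c ^ (3 / 4 : ℝ))⁻¹ * B ^ (3 / 4 : ℝ) := by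
      rw [Real.div_rpow (by positivity) hc0.le, div_eq_inv_mul]
      gcongr
      exact div_le_self hB hw1
    calc _ ≤ M ^ 2 * (3 * sigmaInf a b * (28 * (a * b)) + sigmaInf a b * c) *
          ((c ^ (3 / 4 : ℝ))⁻¹ * B ^ (3 / 4 : ℝ)) * Z := by gcongr
      _ = K1 * M ^ 2 * B ^ (3 / 4 : ℝ) := by ring
      _ ≤ _ := by gcongr; linarith
  · calc _ ≤ K2 * (B / √w) := h2
      _ ≤ (K1 + K2 + 1) * (B / √w) := mul_le_mul_of_nonneg_right (by linarith) hT

lemma abs_fin_sub_le {X : ℕ} (i j : Fin (X + 1)) : |((j : ℕ) : ℤ) - ((i : ℕ) : ℤ)| ≤ X := by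
  have h1 : ((i : ℕ) : ℤ) ≤ X := by exact_mod_cast Nat.lt_succ_iff.1 i.2
  have h2 : ((j : ℕ) : ℤ) ≤ X := by exact_mod_cast Nat.lt_succ_iff.1 j.2
  have h3 := Int.natCast_nonneg (i : ℕ)
  have h4 := Int.natCast_nonneg (j : ℕ)
  rw [abs_le]; constructor <;> linarith

/-- Square roots defining a sublattice on which `a x² + b y² - w u²` vanishes modulo `a b w`. -/
structure RootTriple (a b w : ℕ) where
  (ra rb rw : ℤ)
  dvd_a : (a : ℤ) ∣ b * ra ^ 2 - w
  dvd_b : (b : ℤ) ∣ a * rb ^ 2 - w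
  dvd_w : (w : ℤ) ∣ a * rw ^ 2 + b

namespace RootTriple

variable {a b w : ℕ} (R : RootTriple a b w)

/-- Membership in the sublattice. -/
def Mem (x y u : ℤ) : Prop := (a : ℤ) ∣ y - R.ra * u ∧ (b : ℤ) ∣ x - R.rb * u ∧ (w : ℤ) ∣ x - R.rw * y

lemma dvd_pairing (hab : a.Coprime b) (haw : a.Coprime w) (hbw : b.Coprime w) {x y u x' y' u' : ℤ}
    (h : R.Mem x y u) (h' : R.Mem x' y' u') :
    ((a * b * w : ℕ) : ℤ) ∣ a * x * x' + b * y * y' - w * u * u' := by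
  obtain ⟨⟨i, hi⟩, ⟨j, hj⟩, ⟨k, hk⟩⟩ := h
  obtain ⟨⟨i', hi'⟩, ⟨j', hj'⟩, ⟨k', hk'⟩⟩ := h'
  obtain ⟨p, hp⟩ := R.dvd_a
  obtain ⟨q, hq⟩ := R.dvd_b
  obtain ⟨s, hs⟩ := R.dvd_w
  push_cast
  have c1 : IsCoprime (a : ℤ) b := Nat.isCoprime_iff_coprime.2 hab
  have c2 : IsCoprime (a : ℤ) w := Nat.isCoprime_iff_coprime.2 haw
  have c3 : IsCoprime (b : ℤ) w := Nat.isCoprime_iff_coprime.2 hbw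
  refine IsCoprime.mul_dvd (c2.mul_left c3) (IsCoprime.mul_dvd c1 ?_ ?_) ?_
  · exact ⟨x * x' + b * i * y' + b * R.ra * u * i' + p * u * u', by
      linear_combination b * y' * hi + b * R.ra * u * hi' + u * u' * hp⟩
  · exact ⟨y * y' + a * j * x' + a * R.rb * u * j' + q * u * u', by
      linear_combination a * x' * hj + a * R.rb * u * hj' + u * u' * hq⟩
  · exact ⟨- u * u' + a * k * x' + a * R.rw * y * k' + s * y * y', by
      linear_combination a * x' * hk + a * R.rw * y * hk' + y * y' * hs⟩

lemma exists_small (ha : 0 < a) (hb : 0 < b) (hw : 0 < w) {X Y U : ℕ}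
    (h : a * b * w < (X + 1) * (Y + 1) * (U + 1)) :
    ∃ x y u : ℤ, (x ≠ 0 ∨ y ≠ 0 ∨ u ≠ 0) ∧ R.Mem x y u ∧ |x| ≤ X ∧ |y| ≤ Y ∧ |u| ≤ U := by
  have : NeZero a := ⟨ha.ne'⟩
  have : NeZero b := ⟨hb.ne'⟩
  have : NeZero w := ⟨hw.ne'⟩
  let f : Fin (X + 1) × Fin (Y + 1) × Fin (U + 1) → ZMod a × ZMod b × ZMod w := fun z =>
    ((((z.2.1 : ℕ) : ℤ) - R.ra * ((z.2.2 : ℕ) : ℤ) : ℤ),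
      (((z.1 : ℕ) : ℤ) - R.rb * ((z.2.2 : ℕ) : ℤ) : ℤ),
      (((z.1 : ℕ) : ℤ) - R.rw * ((z.2.1 : ℕ) : ℤ) : ℤ))
  obtain ⟨z, z', hne, hf⟩ := Fintype.exists_ne_map_eq_of_card_lt f (by
    simp only [Fintype.card_prod, ZMod.card, Fintype.card_fin]
    rw [← mul_assoc, ← mul_assoc]; exact h)
  obtain ⟨x, y, u⟩ := z
  obtain ⟨x', y', u'⟩ := z'
  simp only [f, Prod.mk.injEq, ZMod.intCast_eq_intCast_iff_dvd_sub] at hf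
  obtain ⟨h1, h2, h3⟩ := hf
  refine ⟨(x' : ℕ) - (x : ℕ), (y' : ℕ) - (y : ℕ), (u' : ℕ) - (u : ℕ), ?_, ⟨?_, ?_, ?_⟩, ?_, ?_, ?_⟩
  · by_contra hcon
    push Not at hcon
    apply hne
    simp only [Prod.mk.injEq, Fin.ext_iff]
    lia
  · convert h1 using 1; ring
  · convert h2 using 1; ring
  · convert h3 using 1; ring
  · exact abs_fin_sub_le x x'
  · exact abs_fin_sub_le y y'
  · exact abs_fin_sub_le u u'

/-- A local-to-global statement: the conic has a point. -/
lemma exists_isotropic (R : RootTriple a b w) (ha : 0 < a) (hb : 0 < b) (hw : 0 < w) (hab : a.Coprime b)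
    (haw : a.Coprime w) (hbw : b.Coprime w) :
    ∃ x y u : ℤ, (x ≠ 0 ∨ y ≠ 0 ∨ u ≠ 0) ∧ (a : ℤ) * x ^ 2 + b * y ^ 2 = w * u ^ 2 := by
  by_cases hsq : IsSquare (a * w)
  · obtain ⟨m, hm⟩ := hsq
    refine ⟨m, 0, a, Or.inr (Or.inr (by exact_mod_cast ha.ne')), ?_⟩
    have : (a : ℤ) * w = m * m := by exact_mod_cast hm
    linear_combination -a * this
  have hroot : ∀ n : ℕ, 0 < n → (Nat.sqrt (n - 1)) ^ 2 < n ∧ n ≤ (Nat.sqrt (n - 1) + 1) ^ 2 := by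
    intro n hn
    have h1 := Nat.sqrt_le' (n - 1)
    have h2 := Nat.lt_succ_sqrt' (n - 1)
    simp only [Nat.succ_eq_add_one] at h2
    constructor <;> lia
  obtain ⟨hX1, hX2⟩ := hroot (b * w) (by positivity)
  obtain ⟨hY1, hY2⟩ := hroot (a * w) (by positivity)
  obtain ⟨hU1, hU2⟩ := hroot (a * b) (by positivity)
  set X := Nat.sqrt (b * w - 1)
  set Y := Nat.sqrt (a * w - 1)
  set U := Nat.sqrt (a * b - 1)
  have hY3 : a * w < (Y + 1) ^ 2 := by
    refine lt_of_le_of_ne hY2 fun h => hsq ⟨Y + 1, by rw [h, sq]⟩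
  have hbig : a * b * w < (X + 1) * (Y + 1) * (U + 1) := by
    refine lt_of_pow_lt_pow_left₀ 2 (by positivity) ?_
    calc (a * b * w) ^ 2 = (b * w) * (a * w) * (a * b) := by ring
      _ < (X + 1) ^ 2 * (Y + 1) ^ 2 * (U + 1) ^ 2 := by
        have hab0 : 0 < a * b := by positivity
        have hbw0 : 0 < b * w := by positivity
        calc _ < (b * w) * (Y + 1) ^ 2 * (a * b) := by gcongr
          _ ≤ _ := by gcongr
      _ = _ := by ring
  obtain ⟨x, y, u, hne, hmem, hx, hy, hu⟩ := R.exists_small ha hb hw hbig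
  obtain ⟨k, hk⟩ := R.dvd_pairing hab haw hbw hmem hmem
  have hx2 : x ^ 2 < b * w := by
    have : x ^ 2 ≤ (X : ℤ) ^ 2 := by rw [← sq_abs]; gcongr
    have : (X : ℤ) ^ 2 < b * w := by exact_mod_cast hX1
    lia
  have hy2 : y ^ 2 < a * w := by
    have : y ^ 2 ≤ (Y : ℤ) ^ 2 := by rw [← sq_abs]; gcongr
    have : (Y : ℤ) ^ 2 < a * w := by exact_mod_cast hY1
    lia
  have hu2 : u ^ 2 < a * b := by
    have : u ^ 2 ≤ (U : ℤ) ^ 2 := by rw [← sq_abs]; gcongr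
    have : (U : ℤ) ^ 2 < a * b := by exact_mod_cast hU1
    lia
  have ha' : (0 : ℤ) < a := by exact_mod_cast ha
  have hb' : (0 : ℤ) < b := by exact_mod_cast hb
  have hw' : (0 : ℤ) < w := by exact_mod_cast hw
  push_cast at hk
  set n : ℤ := a * b * w with hn
  have hn0 : 0 < n := by positivity
  have e1 : a * x ^ 2 < n := by rw [hn, mul_assoc]; exact mul_lt_mul_of_pos_left hx2 ha'
  have e2 : b * y ^ 2 < n := by
    rw [hn, mul_assoc, mul_left_comm]; exact mul_lt_mul_of_pos_left hy2 hb'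
  have e3 : w * u ^ 2 < n := by
    rw [hn, mul_comm]; exact mul_lt_mul_of_pos_right hu2 hw'
  have e4 : 0 ≤ a * x ^ 2 := by positivity
  have e5 : 0 ≤ b * y ^ 2 := by positivity
  have e6 : 0 ≤ w * u ^ 2 := by positivity
  have hk' : a * x ^ 2 + b * y ^ 2 - w * u ^ 2 = n * k := by linear_combination hk
  have hk1 : k < 2 := lt_of_mul_lt_mul_left (by linarith : n * k < n * 2) hn0.le
  have hk2 : -1 < k := lt_of_mul_lt_mul_left (by linarith : n * (-1) < n * k) hn0.le
  obtain rfl | rfl : k = 0 ∨ k = 1 := by lia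
  · exact ⟨x, y, u, hne, by linear_combination hk⟩
  · refine ⟨x * u + b * y, y * u - a * x, u ^ 2 + a * b, Or.inr (Or.inr (by positivity)), ?_⟩
    rw [hn] at hk
    linear_combination (u ^ 2 + a * b) * hk

end RootTriple

/-- The symmetric bilinear form on `ℤ³` with the given Gram entries. -/
def bil (p q r s t m : ℤ) (v w : ℤ × ℤ × ℤ) : ℤ :=
  p * v.1 * w.1 + s * v.2.1 * w.2.1 + m * v.2.2 * w.2.2 + q * (v.1 * w.2.1 + v.2.1 * w.1) +
    r * (v.1 * w.2.2 + v.2.2 * w.1) + t * (v.2.1 * w.2.2 + v.2.2 * w.2.1)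

/-- The dual of the cross product with respect to `bil`, for Gram determinant `-1`. -/
def dualCross (p q r s t m : ℤ) (v w : ℤ × ℤ × ℤ) : ℤ × ℤ × ℤ :=
  let c1 := v.2.1 * w.2.2 - v.2.2 * w.2.1
  let c2 := v.2.2 * w.1 - v.1 * w.2.2
  let c3 := v.1 * w.2.1 - v.2.1 * w.1
  (-((s * m - t ^ 2) * c1 + (r * t - q * m) * c2 + (q * t - r * s) * c3),
    -((r * t - q * m) * c1 + (p * m - r ^ 2) * c2 + (q * r - p * t) * c3),
    -((q * t - r * s) * c1 + (q * r - p * t) * c2 + (p * s - q ^ 2) * c3))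

section
variable {p q r s t m : ℤ}

lemma bil_add (u v w : ℤ × ℤ × ℤ) :
    bil p q r s t m u (v + w) = bil p q r s t m u v + bil p q r s t m u w := by
  simp only [bil, Prod.fst_add, Prod.snd_add]; ring

lemma bil_smul (k : ℤ) (u v : ℤ × ℤ × ℤ) :
    bil p q r s t m u (k • v) = k * bil p q r s t m u v := by
  simp only [bil, Prod.smul_fst, Prod.smul_snd, smul_eq_mul]; ring

lemma bil_comm (u v : ℤ × ℤ × ℤ) : bil p q r s t m u v = bil p q r s t m v u := by
  simp only [bil]; ring

lemma bil_dualCross_left (v w : ℤ × ℤ × ℤ) : bil p q r s t m v (dualCross p q r s t m v w) = 0 := by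
  obtain ⟨v1, v2, v3⟩ := v
  obtain ⟨w1, w2, w3⟩ := w
  simp only [bil, dualCross]
  ring

lemma bil_dualCross_right (v w : ℤ × ℤ × ℤ) :
    bil p q r s t m w (dualCross p q r s t m v w) = 0 := by
  obtain ⟨v1, v2, v3⟩ := v
  obtain ⟨w1, w2, w3⟩ := w
  simp only [bil, dualCross]
  ring

lemma bil_dualCross_self
    (hdet : p * (s * m - t ^ 2) - q * (q * m - r * t) + r * (q * t - r * s) = -1)
    (v w : ℤ × ℤ × ℤ) :
    bil p q r s t m (dualCross p q r s t m v w) (dualCross p q r s t m v w) =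
      bil p q r s t m v w ^ 2 - bil p q r s t m v v * bil p q r s t m w w := by
  obtain ⟨v1, v2, v3⟩ := v
  obtain ⟨w1, w2, w3⟩ := w
  have : bil p q r s t m (dualCross p q r s t m (v1, v2, v3) (w1, w2, w3))
      (dualCross p q r s t m (v1, v2, v3) (w1, w2, w3)) =
      (p * (s * m - t ^ 2) - q * (q * m - r * t) + r * (q * t - r * s)) *
      (bil p q r s t m (v1, v2, v3) (v1, v2, v3) * bil p q r s t m (w1, w2, w3) (w1, w2, w3) -
        bil p q r s t m (v1, v2, v3) (w1, w2, w3) ^ 2) := by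
    simp only [bil, dualCross]; ring
  rw [this, hdet]; ring

/-- An isotropic unimodular ternary form of determinant `-1` is `x² + y² - z²`. -/
lemma exists_diagonal_basis
    (hdet : p * (s * m - t ^ 2) - q * (q * m - r * t) + r * (q * t - r * s) = -1)
    {e : ℤ × ℤ × ℤ} (he : e ≠ 0) (hiso : bil p q r s t m e e = 0) :
    ∃ f g h : ℤ × ℤ × ℤ, bil p q r s t m f f = 1 ∧ bil p q r s t m g g = 1 ∧
      bil p q r s t m h h = -1 ∧ bil p q r s t m f g = 0 ∧ bil p q r s t m f h = 0 ∧
      bil p q r s t m g h = 0 := by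
  obtain ⟨e, e', hee, hiso⟩ : ∃ e e' : ℤ × ℤ × ℤ, e.1 * e'.1 + e.2.1 * e'.2.1 + e.2.2 * e'.2.2 = 1 ∧
      bil p q r s t m e e = 0 := by
    obtain ⟨e1, e2, e3⟩ := e
    set d : ℤ := ((Int.gcd e1 (Int.gcd e2 e3) : ℕ) : ℤ) with hd
    have hd0 : d ≠ 0 := by
      intro h
      apply he
      rw [hd] at h
      have h' : Int.gcd e1 (Int.gcd e2 e3) = 0 := by exact_mod_cast h
      rw [Int.gcd_eq_zero_iff] at h'
      obtain ⟨h1, h2⟩ := h'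
      have h2' : Int.gcd e2 e3 = 0 := by exact_mod_cast h2
      rw [Int.gcd_eq_zero_iff] at h2'
      simp [h1, h2'.1, h2'.2]
    obtain ⟨k1, hk1⟩ : d ∣ e1 := Int.gcd_dvd_left ..
    have hd23 : d ∣ (Int.gcd e2 e3 : ℤ) := Int.gcd_dvd_right ..
    obtain ⟨k2, hk2⟩ : d ∣ e2 := hd23.trans (Int.gcd_dvd_left ..)
    obtain ⟨k3, hk3⟩ : d ∣ e3 := hd23.trans (Int.gcd_dvd_right ..)
    have hb1 := Int.gcd_eq_gcd_ab e1 (Int.gcd e2 e3)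
    have hb2 := Int.gcd_eq_gcd_ab e2 e3
    refine ⟨(k1, k2, k3), (Int.gcdA e1 (Int.gcd e2 e3),
      Int.gcdB e1 (Int.gcd e2 e3) * Int.gcdA e2 e3,
      Int.gcdB e1 (Int.gcd e2 e3) * Int.gcdB e2 e3), ?_, ?_⟩
    · apply mul_left_cancel₀ hd0
      rw [← hd] at hb1
      simp only
      generalize Int.gcdA e1 (Int.gcd e2 e3) = A at *
      generalize Int.gcdB e1 (Int.gcd e2 e3) = B at *
      generalize Int.gcdA e2 e3 = A' at *
      generalize Int.gcdB e2 e3 = B' at *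
      linear_combination -A * hk1 - B * A' * hk2 - B * B' * hk3 - hb1 - B * hb2
    · have : d ^ 2 * bil p q r s t m (k1, k2, k3) (k1, k2, k3) = 0 := by
        rw [← hiso, hk1, hk2, hk3]; simp only [bil]; ring
      rcases mul_eq_zero.1 this with h | h
      · exact absurd (pow_eq_zero_iff two_ne_zero |>.1 h) hd0
      · exact h
  obtain ⟨f0, hf0⟩ : ∃ f, bil p q r s t m e f = 1 := by
    refine ⟨(-((s * m - t ^ 2) * e'.1 + (r * t - q * m) * e'.2.1 + (q * t - r * s) * e'.2.2),
      -((r * t - q * m) * e'.1 + (p * m - r ^ 2) * e'.2.1 + (q * r - p * t) * e'.2.2),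
      -((q * t - r * s) * e'.1 + (q * r - p * t) * e'.2.1 + (p * s - q ^ 2) * e'.2.2)), ?_⟩
    simp only [bil]
    linear_combination hee - (e.1 * e'.1 + e.2.1 * e'.2.1 + e.2.2 * e'.2.2) * hdet
  obtain ⟨f1, hf1, hodd⟩ : ∃ f, bil p q r s t m e f = 1 ∧ Odd (bil p q r s t m f f) := by
    rcases Int.even_or_odd (bil p q r s t m f0 f0) with h | h
    · refine ⟨f0 + dualCross p q r s t m e f0, ?_, ?_⟩
      · rw [bil_add, hf0, bil_dualCross_left]; rfl
      · rw [bil_add, bil_comm _ f0, bil_comm _ (dualCross _ _ _ _ _ _ _ _), bil_add, bil_add,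
          bil_comm (dualCross _ _ _ _ _ _ _ _) f0, bil_dualCross_right,
          bil_dualCross_self hdet, hf0, hiso]
        simpa using h.add_one
    · exact ⟨f0, hf0, h⟩
  obtain ⟨j, hj⟩ := hodd
  set f := f1 + (-j) • e with hf
  have hef : bil p q r s t m e f = 1 := by rw [hf, bil_add, bil_smul, hf1, hiso]; ring
  have hff : bil p q r s t m f f = 1 := by
    have h1 : bil p q r s t m f1 f = bil p q r s t m f1 f1 - j := by
      rw [hf, bil_add, bil_smul, bil_comm f1 e, hf1]; ring
    conv_lhs => rw [hf, bil_comm, bil_add, bil_smul, ← hf, bil_comm f f1, bil_comm f e]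
    rw [h1, hef, hj]; ring
  clear_value f
  refine ⟨f, dualCross p q r s t m e f, f + (-1 : ℤ) • e, hff, ?_, ?_, ?_, ?_, ?_⟩
  · rw [bil_dualCross_self hdet, hef, hiso]; ring
  · rw [bil_add, bil_smul, bil_comm _ f, bil_comm _ e, bil_add, bil_add, bil_smul, bil_smul,
      hff, hef, hiso, bil_comm, hef]; ring
  · exact bil_dualCross_right _ _
  · rw [bil_add, bil_smul, hff, bil_comm, hef]; ring
  · rw [bil_add, bil_smul, bil_comm, bil_dualCross_right, bil_comm,
      bil_dualCross_left]; ring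

end

/-- If `A B = n` for square integer matrices and a nonzero integer `n`, then `B A = n`. -/
lemma Matrix.mul_eq_smul_one_comm {ι : Type*} [Fintype ι] [DecidableEq ι] {A B : Matrix ι ι ℤ}
    {n : ℤ} (hn : n ≠ 0) (h : A * B = n • (1 : Matrix ι ι ℤ)) :
    B * A = n • (1 : Matrix ι ι ℤ) := by
  have hdet : B.det ≠ 0 := by
    intro h0
    have := congrArg Matrix.det h
    rw [Matrix.det_mul, h0, mul_zero, Matrix.det_smul, Matrix.det_one, mul_one] at this
    exact pow_ne_zero _ hn this.symm
  have h1 : (B * A - n • (1 : Matrix ι ι ℤ)) * B = 0 := by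
    rw [Matrix.sub_mul, Matrix.mul_assoc, h, Matrix.mul_smul, Matrix.smul_mul, Matrix.mul_one,
      Matrix.one_mul, sub_self]
  have h2 : B.det • (B * A - n • (1 : Matrix ι ι ℤ)) = 0 := by
    have h3 : (B * A - n • (1 : Matrix ι ι ℤ)) * B * B.adjugate = 0 := by rw [h1, Matrix.zero_mul]
    rwa [Matrix.mul_assoc, Matrix.mul_adjugate, Matrix.mul_smul, Matrix.mul_one] at h3
  exact sub_eq_zero.1 ((smul_eq_zero.1 h2).resolve_left hdet)

/-- A basis of the lattice of a root triple that diagonalises `a x² + b y² - w u²` as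
`a b w (X² + Y² - Z²)`. -/
structure RootTriple.Frame {a b w : ℕ} (R : RootTriple a b w) where
  (x1 x2 x3 y1 y2 y3 u1 u2 u3 : ℤ)
  mem1 : R.Mem x1 y1 u1
  mem2 : R.Mem x2 y2 u2
  mem3 : R.Mem x3 y3 u3
  col11 : a * x1 ^ 2 + b * y1 ^ 2 - w * u1 ^ 2 = ((a * b * w : ℕ) : ℤ)
  col22 : a * x2 ^ 2 + b * y2 ^ 2 - w * u2 ^ 2 = ((a * b * w : ℕ) : ℤ)
  col33 : a * x3 ^ 2 + b * y3 ^ 2 - w * u3 ^ 2 = -((a * b * w : ℕ) : ℤ)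
  col12 : a * x1 * x2 + b * y1 * y2 - w * u1 * u2 = 0
  col13 : a * x1 * x3 + b * y1 * y3 - w * u1 * u3 = 0
  col23 : a * x2 * x3 + b * y2 * y3 - w * u2 * u3 = 0
  u3_pos : 0 < u3

namespace RootTriple

variable {a b w : ℕ} {R : RootTriple a b w}

lemma Frame.rows (Φ : R.Frame) (ha : 0 < a) (hb : 0 < b) (hw : 0 < w) :
    Φ.x1 ^ 2 + Φ.x2 ^ 2 - Φ.x3 ^ 2 = b * w ∧ Φ.y1 ^ 2 + Φ.y2 ^ 2 - Φ.y3 ^ 2 = a * w ∧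
    Φ.u1 ^ 2 + Φ.u2 ^ 2 - Φ.u3 ^ 2 = -(a * b) ∧
    Φ.x1 * Φ.y1 + Φ.x2 * Φ.y2 - Φ.x3 * Φ.y3 = 0 ∧
    Φ.x1 * Φ.u1 + Φ.x2 * Φ.u2 - Φ.x3 * Φ.u3 = 0 ∧
    Φ.y1 * Φ.u1 + Φ.y2 * Φ.u2 - Φ.y3 * Φ.u3 = 0 := by
  obtain ⟨x1, x2, x3, y1, y2, y3, u1, u2, u3, -, -, -, h11, h22, h33, h12, h13, h23, -⟩ := Φ
  simp only
  have ha' : (a : ℤ) ≠ 0 := by exact_mod_cast ha.ne'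
  have hb' : (b : ℤ) ≠ 0 := by exact_mod_cast hb.ne'
  have hw' : (w : ℤ) ≠ 0 := by exact_mod_cast hw.ne'
  have key := Matrix.mul_eq_smul_one_comm (n := a * b * w)
    (A := !![(a : ℤ) * x1, b * y1, -w * u1; a * x2, b * y2, -w * u2; -a * x3, -b * y3, w * u3])
    (B := !![x1, x2, x3; y1, y2, y3; u1, u2, u3]) (by positivity) (by
      push_cast at h11 h22 h33
      ext i j
      fin_cases i <;> fin_cases j <;>
        simp [Matrix.mul_apply, Fin.sum_univ_three] <;> linarith)
  have e := fun i j => congrFun (congrFun key i) j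
  have e00 := e 0 0
  have e11 := e 1 1
  have e22 := e 2 2
  have e10 := e 1 0
  have e20 := e 2 0
  have e21 := e 2 1
  simp [Matrix.mul_apply, Fin.sum_univ_three] at e00 e11 e22 e10 e20 e21
  refine ⟨?_, ?_, ?_, ?_, ?_, ?_⟩
  · apply mul_left_cancel₀ ha'; linear_combination e00
  · apply mul_left_cancel₀ hb'; linear_combination e11
  · apply mul_left_cancel₀ hw'; linear_combination -e22
  · apply mul_left_cancel₀ ha'; linear_combination e10
  · apply mul_left_cancel₀ ha'; linear_combination e20
  · apply mul_left_cancel₀ hb'; linear_combination e21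

/-- The three spanning columns. -/
def column (R : RootTriple a b w) (α β : ℤ) (v : ℤ × ℤ × ℤ) : ℤ × ℤ × ℤ :=
  (v.1 * (α + β * R.ra) + v.2.1 * (β * a) + v.2.2 * (b * w), v.1 * R.ra + v.2.1 * a, v.1)

lemma mem_column {α β : ℤ} (h1 : (b : ℤ) ∣ α - R.rb) (h2 : (w : ℤ) ∣ α) (h3 : (b : ℤ) ∣ β)
    (h4 : (w : ℤ) ∣ β - R.rw) (v : ℤ × ℤ × ℤ) :
    R.Mem (R.column α β v).1 (R.column α β v).2.1 (R.column α β v).2.2 := by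
  obtain ⟨i, hi⟩ := h1
  obtain ⟨j, hj⟩ := h2
  obtain ⟨k, hk⟩ := h3
  obtain ⟨l, hl⟩ := h4
  refine ⟨⟨v.2.1, ?_⟩, ⟨v.1 * i + v.1 * k * R.ra + v.2.1 * k * a + v.2.2 * w, ?_⟩,
    ⟨v.1 * j + v.1 * R.ra * l + v.2.1 * a * l + v.2.2 * b, ?_⟩⟩ <;> simp only [column]
  · ring
  · linear_combination v.1 * hi + (v.1 * R.ra + v.2.1 * a) * hk
  · linear_combination v.1 * hj + (v.1 * R.ra + v.2.1 * a) * hl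

lemma exists_frame (R : RootTriple a b w) (ha : 0 < a) (hb : 0 < b) (hw : 0 < w)
    (hab : a.Coprime b) (haw : a.Coprime w) (hbw : b.Coprime w) : Nonempty R.Frame := by
  have ha' : (a : ℤ) ≠ 0 := by exact_mod_cast ha.ne'
  have hb' : (b : ℤ) ≠ 0 := by exact_mod_cast hb.ne'
  have hw' : (w : ℤ) ≠ 0 := by exact_mod_cast hw.ne'
  obtain ⟨i, j, hij⟩ : IsCoprime (b : ℤ) w := Nat.isCoprime_iff_coprime.2 hbw
  obtain ⟨α, h1, h2⟩ : ∃ α : ℤ, (b : ℤ) ∣ α - R.rb ∧ (w : ℤ) ∣ α :=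
    ⟨R.rb * (j * w), ⟨-R.rb * i, by linear_combination R.rb * hij⟩, ⟨R.rb * j, by ring⟩⟩
  obtain ⟨β, h3, h4⟩ : ∃ β : ℤ, (b : ℤ) ∣ β ∧ (w : ℤ) ∣ β - R.rw :=
    ⟨R.rw * (i * b), ⟨R.rw * i, by ring⟩, ⟨-R.rw * j, by linear_combination R.rw * hij⟩⟩
  have hmem := fun v => R.mem_column h1 h2 h3 h4 v
  set c1 := R.column α β (1, 0, 0) with hc1
  set c2 := R.column α β (0, 1, 0) with hc2
  set c3 := R.column α β (0, 0, 1) with hc3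
  set n : ℤ := ((a * b * w : ℕ) : ℤ) with hn
  have hn' : n = a * b * w := by push_cast [hn]; ring
  have hn0 : n ≠ 0 := by rw [hn']; positivity
  obtain ⟨p, hp⟩ := R.dvd_pairing hab haw hbw (hmem (1, 0, 0)) (hmem (1, 0, 0))
  obtain ⟨q, hq⟩ := R.dvd_pairing hab haw hbw (hmem (1, 0, 0)) (hmem (0, 1, 0))
  obtain ⟨r, hr⟩ := R.dvd_pairing hab haw hbw (hmem (1, 0, 0)) (hmem (0, 0, 1))
  obtain ⟨s, hs⟩ := R.dvd_pairing hab haw hbw (hmem (0, 1, 0)) (hmem (0, 1, 0))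
  obtain ⟨t, ht⟩ := R.dvd_pairing hab haw hbw (hmem (0, 1, 0)) (hmem (0, 0, 1))
  obtain ⟨m, hm⟩ := R.dvd_pairing hab haw hbw (hmem (0, 0, 1)) (hmem (0, 0, 1))
  rw [← hn] at hp hq hr hs ht hm
  simp only [column] at hp hq hr hs ht hm
  have hpair : ∀ v v' : ℤ × ℤ × ℤ,
      a * (R.column α β v).1 * (R.column α β v').1 + b * (R.column α β v).2.1 * (R.column α β v').2.1
      - w * (R.column α β v).2.2 * (R.column α β v').2.2 = n * bil p q r s t m v v' := by
    rintro ⟨v1, v2, v3⟩ ⟨v1', v2', v3'⟩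
    simp only [column, bil]
    linear_combination v1 * v1' * hp + (v1 * v2' + v2 * v1') * hq + (v1 * v3' + v3 * v1') * hr +
      v2 * v2' * hs + (v2 * v3' + v3 * v2') * ht + v3 * v3' * hm
  have hdet : p * (s * m - t ^ 2) - q * (q * m - r * t) + r * (q * t - r * s) = -1 := by
    apply mul_left_cancel₀ (pow_ne_zero 3 hn0)
    have : n ^ 3 * (p * (s * m - t ^ 2) - q * (q * m - r * t) + r * (q * t - r * s)) =
        (n * p) * ((n * s) * (n * m) - (n * t) ^ 2) - (n * q) * ((n * q) * (n * m) - (n * r) * (n * t))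
          + (n * r) * ((n * q) * (n * t) - (n * r) * (n * s)) := by ring
    rw [this, ← hp, ← hq, ← hr, ← hs, ← ht, ← hm, hn']
    ring
  obtain ⟨x, y, u, hne, hxyu⟩ := R.exists_isotropic ha hb hw hab haw hbw
  obtain ⟨e, he, hiso⟩ : ∃ e : ℤ × ℤ × ℤ, e ≠ 0 ∧ bil p q r s t m e e = 0 := by
    refine ⟨(n * u, b * w * (y - R.ra * u), a * (x - α * u) - a * β * y), ?_, ?_⟩
    · intro h0
      simp only [Prod.mk_eq_zero, mul_eq_zero, hn0, hb', hw', false_or] at h0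
      obtain ⟨rfl, hy, hx⟩ := h0
      simp only [mul_zero, sub_zero] at hy hx
      subst hy
      simp [ha.ne'] at hx
      simp [hx] at hne
    · apply mul_left_cancel₀ hn0
      rw [← hpair]
      simp only [column]
      rw [hn']
      linear_combination (a * b * w) ^ 2 * hxyu
  obtain ⟨f, g, h, hff, hgg, hhh, hfg, hfh, hgh⟩ := exists_diagonal_basis hdet he hiso
  have Q1 := hpair f f
  have Q2 := hpair g g
  have Q3 := hpair h h
  have Q4 := hpair f g
  have Q5 := hpair f h
  have Q6 := hpair g h
  rw [hff] at Q1
  rw [hgg] at Q2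
  rw [hhh] at Q3
  rw [hfg] at Q4
  rw [hfh] at Q5
  rw [hgh] at Q6
  have m1 := hmem f
  have m2 := hmem g
  have m3 := hmem h
  generalize R.column α β f = F1 at *
  generalize R.column α β g = F2 at *
  generalize R.column α β h = F3 at *
  have hu0 : F3.2.2 ≠ 0 := by
    intro h0
    rw [h0] at Q3
    have hnp : 0 < n := by rw [hn]; positivity
    have e1 := mul_nonneg (Int.natCast_nonneg a) (mul_self_nonneg F3.1)
    have e2 := mul_nonneg (Int.natCast_nonneg b) (mul_self_nonneg F3.2.1)
    rw [mul_zero, mul_assoc, mul_assoc] at Q3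
    linarith
  rcases lt_or_gt_of_ne hu0 with hneg | hpos
  · refine ⟨⟨F1.1, F2.1, -F3.1, F1.2.1, F2.2.1, -F3.2.1, F1.2.2, F2.2.2, -F3.2.2, m1, m2, ?_, ?_,
      ?_, ?_, ?_, ?_, ?_, ?_⟩⟩
    · obtain ⟨⟨i, hi⟩, ⟨j, hj⟩, ⟨k, hk⟩⟩ := m3
      exact ⟨⟨-i, by linear_combination -hi⟩, ⟨-j, by linear_combination -hj⟩,
        ⟨-k, by linear_combination -hk⟩⟩
    · linear_combination Q1
    · linear_combination Q2
    · linear_combination Q3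
    · linear_combination Q4
    · linear_combination -Q5
    · linear_combination -Q6
    · lia
  · refine ⟨⟨F1.1, F2.1, F3.1, F1.2.1, F2.2.1, F3.2.1, F1.2.2, F2.2.2, F3.2.2, m1, m2, m3, ?_,
      ?_, ?_, ?_, ?_, ?_, hpos⟩⟩
    · linear_combination Q1
    · linear_combination Q2
    · linear_combination Q3
    · linear_combination Q4
    · linear_combination Q5
    · linear_combination Q6

/-- Coordinates with respect to a frame. -/
lemma Frame.exists_coords (Φ : R.Frame) (ha : 0 < a) (hb : 0 < b) (hw : 0 < w) (hab : a.Coprime b)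
    (haw : a.Coprime w) (hbw : b.Coprime w) {x y u : ℤ} (h : R.Mem x y u) :
    ∃ i j k : ℤ, x = Φ.x1 * i + Φ.x2 * j + Φ.x3 * k ∧ y = Φ.y1 * i + Φ.y2 * j + Φ.y3 * k ∧
      u = Φ.u1 * i + Φ.u2 * j + Φ.u3 * k := by
  obtain ⟨i, hi⟩ := R.dvd_pairing hab haw hbw Φ.mem1 h
  obtain ⟨j, hj⟩ := R.dvd_pairing hab haw hbw Φ.mem2 h
  obtain ⟨k, hk⟩ := R.dvd_pairing hab haw hbw Φ.mem3 h
  obtain ⟨r1, r2, r3, r4, r5, r6⟩ := Φ.rows ha hb hw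
  have hn : ((a * b * w : ℕ) : ℤ) ≠ 0 := by positivity
  push_cast at hn hi hj hk
  refine ⟨i, j, -k, ?_, ?_, ?_⟩ <;> apply mul_left_cancel₀ hn
  · linear_combination Φ.x1 * hi + Φ.x2 * hj - Φ.x3 * hk - a * x * r1 - b * y * r4 + w * u * r5
  · linear_combination Φ.y1 * hi + Φ.y2 * hj - Φ.y3 * hk - a * x * r4 - b * y * r2 + w * u * r6
  · linear_combination Φ.u1 * hi + Φ.u2 * hj - Φ.u3 * hk - a * x * r5 - b * y * r6 + w * u * r3

/-- The parametrization of the conic attached to a frame. -/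
def Frame.conic (Φ : R.Frame) (ha : 0 < a) (hb : 0 < b) (hw : 0 < w) : ConicParam a b w where
  xA := Φ.x1 + Φ.x3
  xB := Φ.x2
  xC := Φ.x3 - Φ.x1
  yA := Φ.y1 + Φ.y3
  yB := Φ.y2
  yC := Φ.y3 - Φ.y1
  uA := Φ.u1 + Φ.u3
  uB := Φ.u2
  uC := Φ.u3 - Φ.u1
  disc_x := by linear_combination (Φ.rows ha hb hw).1
  disc_y := by linear_combination (Φ.rows ha hb hw).2.1
  disc_u := by linear_combination -(Φ.rows ha hb hw).2.2.1
  polar_xy := by linear_combination -2 * (Φ.rows ha hb hw).2.2.2.1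
  polar_xu := by linear_combination -2 * (Φ.rows ha hb hw).2.2.2.2.1
  polar_yu := by linear_combination -2 * (Φ.rows ha hb hw).2.2.2.2.2
  uA_pos := by
    have h := (Φ.rows ha hb hw).2.2.1
    have h0 : (0 : ℤ) < a * b := by positivity
    have := Φ.u3_pos
    have : |Φ.u1| < |Φ.u3| := by
      rw [← sq_lt_sq]; nlinarith [sq_nonneg Φ.u2]
    rw [abs_of_pos Φ.u3_pos, abs_lt] at this
    linarith
  conic := fun s t => by
    have c11 : (a * Φ.x1 ^ 2 + b * Φ.y1 ^ 2 - w * Φ.u1 ^ 2 : ℝ) = ((a * b * w : ℕ) : ℝ) := by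
      exact_mod_cast Φ.col11
    have c22 : (a * Φ.x2 ^ 2 + b * Φ.y2 ^ 2 - w * Φ.u2 ^ 2 : ℝ) = ((a * b * w : ℕ) : ℝ) := by
      exact_mod_cast Φ.col22
    have c33 : (a * Φ.x3 ^ 2 + b * Φ.y3 ^ 2 - w * Φ.u3 ^ 2 : ℝ) = -((a * b * w : ℕ) : ℝ) := by
      exact_mod_cast Φ.col33
    have c12 : (a * Φ.x1 * Φ.x2 + b * Φ.y1 * Φ.y2 - w * Φ.u1 * Φ.u2 : ℝ) = 0 := by
      exact_mod_cast Φ.col12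
    have c13 : (a * Φ.x1 * Φ.x3 + b * Φ.y1 * Φ.y3 - w * Φ.u1 * Φ.u3 : ℝ) = 0 := by
      exact_mod_cast Φ.col13
    have c23 : (a * Φ.x2 * Φ.x3 + b * Φ.y2 * Φ.y3 - w * Φ.u2 * Φ.u3 : ℝ) = 0 := by
      exact_mod_cast Φ.col23
    simp only [evenForm]
    push_cast
    linear_combination (s ^ 2 - t ^ 2) ^ 2 * c11 + 4 * s ^ 2 * t ^ 2 * c22
      + (s ^ 2 + t ^ 2) ^ 2 * c33 + 2 * (s ^ 2 - t ^ 2) * (2 * s * t) * c12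
      + 2 * (s ^ 2 - t ^ 2) * (s ^ 2 + t ^ 2) * c13 + 2 * (2 * s * t) * (s ^ 2 + t ^ 2) * c23

/-- Interchanging the first two basis vectors of a frame. -/
def Frame.swap (Φ : R.Frame) : R.Frame where
  x1 := Φ.x2
  x2 := Φ.x1
  x3 := Φ.x3
  y1 := Φ.y2
  y2 := Φ.y1
  y3 := Φ.y3
  u1 := Φ.u2
  u2 := Φ.u1
  u3 := Φ.u3
  mem1 := Φ.mem2
  mem2 := Φ.mem1
  mem3 := Φ.mem3
  col11 := Φ.col22
  col22 := Φ.col11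
  col33 := Φ.col33
  col12 := by linear_combination Φ.col12
  col13 := Φ.col23
  col23 := Φ.col13
  u3_pos := Φ.u3_pos

end RootTriple

lemma Set.ncard_eq_two_mul_ncard_image {G β : Type*} [AddGroup G] [IsAddTorsionFree G] (f : G → β)
    {A : Set G} (hfin : (f '' A).Finite) (h0 : (0 : G) ∉ A) (hneg : ∀ z ∈ A, -z ∈ A)
    (hf : ∀ z ∈ A, f (-z) = f z) (hinj : ∀ z ∈ A, ∀ z' ∈ A, f z' = f z → z' = z ∨ z' = -z) :
    A.ncard = 2 * (f '' A).ncard := by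
  classical
  have hA : A.Finite := by
    refine Set.Finite.of_finite_fibers f hfin ?_
    rintro _ ⟨z, hz, rfl⟩
    refine (Set.toFinite {z, -z}).subset ?_
    rintro z' ⟨hz', he⟩
    exact hinj z hz z' hz' he
  obtain ⟨S, rfl⟩ := hA.exists_finset_coe
  rw [← Finset.coe_image, Set.ncard_coe_finset, Set.ncard_coe_finset,
    Finset.card_eq_sum_card_image f S, mul_comm, ← smul_eq_mul, ← Finset.sum_const]
  refine Finset.sum_congr rfl ?_
  intro y hy
  obtain ⟨z, hz, rfl⟩ := Finset.mem_image.1 hy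
  have hz0 : z ≠ 0 := fun h => h0 (h ▸ hz)
  have : S.filter (fun z' => f z' = f z) = {z, -z} := by
    ext z'
    simp only [Finset.mem_filter, Finset.mem_insert, Finset.mem_singleton]
    constructor
    · rintro ⟨h1, h2⟩
      exact hinj z hz z' h1 h2
    · rintro (rfl | rfl)
      · exact ⟨hz, rfl⟩
      · exact ⟨hneg z hz, hf z hz⟩
  rw [this, Finset.card_pair]
  exact fun h => hz0 (self_eq_neg.1 h)

lemma exists_int_forall_primeFactors (M : ℕ) (f : ℕ → ℤ) :
    ∃ g : ℤ, ∀ p ∈ M.primeFactors, (p : ℤ) ∣ g - f p := by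
  obtain ⟨k, hk⟩ := Nat.chineseRemainderOfFinset (fun p => (f p % p).toNat) id M.primeFactors
    (fun p hp => (Nat.prime_of_mem_primeFactors hp).ne_zero) (by
      intro p hp q hq hpq
      exact (Nat.coprime_primes (Nat.prime_of_mem_primeFactors hp)
        (Nat.prime_of_mem_primeFactors hq)).2 hpq)
  refine ⟨k, fun p hp => ?_⟩
  have hp0 : (p : ℤ) ≠ 0 := by exact_mod_cast (Nat.prime_of_mem_primeFactors hp).ne_zero
  have h1 := (Nat.modEq_iff_dvd.1 (hk p hp).symm)
  simp only [id] at h1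
  rw [Int.toNat_of_nonneg (Int.emod_nonneg _ hp0)] at h1
  have h2 : (p : ℤ) ∣ f p % p - f p := Int.modEq_iff_dvd.1 (Int.mod_modEq (f p) p).symm
  have := dvd_add h1 h2
  simpa using this

lemma ZMod.isUnit_intCast_iff {M : ℕ} (hM : M ≠ 0) (k : ℤ) :
    IsUnit (k : ZMod M) ↔ ∀ p ∈ M.primeFactors, ¬ (p : ℤ) ∣ k := by
  rw [ZMod.coe_int_isUnit_iff_isCoprime, Int.isCoprime_iff_gcd_eq_one]
  constructor
  · intro h p hp hpk
    have hd : (p : ℤ) ∣ M := by exact_mod_cast Nat.dvd_of_mem_primeFactors hp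
    have := Int.dvd_coe_gcd hd hpk
    rw [h] at this
    have h1 : p ∣ 1 := by exact_mod_cast this
    exact (Nat.prime_of_mem_primeFactors hp).one_lt.ne' (Nat.dvd_one.1 h1)
  · intro h
    by_contra hne
    obtain ⟨p, hp, hpd⟩ := Nat.exists_prime_and_dvd hne
    have h1 : (p : ℤ) ∣ ((Int.gcd M k : ℕ) : ℤ) := by exact_mod_cast hpd
    refine h p (Nat.mem_primeFactors.2 ⟨hp, ?_, hM⟩) (h1.trans (Int.gcd_dvd_right ..))
    exact_mod_cast h1.trans (Int.gcd_dvd_left ..)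

lemma exists_linearForm_isUnit_iff {M : ℕ} (hM : M ≠ 0) (g h : ℕ → ℤ)
    (hgh : ∀ p ∈ M.primeFactors, ¬ (p : ℤ) ∣ g p ∨ ¬ (p : ℤ) ∣ h p) :
    ∃ g' h' s t : ZMod M, IsUnit (g' * s + h' * t) ∧ ∀ m n : ℤ,
      (IsUnit (g' * m + h' * n) ↔ ∀ p ∈ M.primeFactors, ¬ (p : ℤ) ∣ g p * m + h p * n) := by
  classical
  obtain ⟨G, hG⟩ := exists_int_forall_primeFactors M g
  obtain ⟨H, hH⟩ := exists_int_forall_primeFactors M h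
  obtain ⟨s, hs⟩ := exists_int_forall_primeFactors M fun p => if (p : ℤ) ∣ g p then 0 else 1
  obtain ⟨t, ht⟩ := exists_int_forall_primeFactors M fun p => if (p : ℤ) ∣ g p then 1 else 0
  have key : ∀ m n : ℤ, (IsUnit ((G : ZMod M) * m + H * n) ↔
      ∀ p ∈ M.primeFactors, ¬ (p : ℤ) ∣ g p * m + h p * n) := by
    intro m n
    have : (G : ZMod M) * m + H * n = ((G * m + H * n : ℤ) : ZMod M) := by push_cast; ring
    rw [this, ZMod.isUnit_intCast_iff hM]
    refine forall₂_congr fun p hp => not_congr ?_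
    refine dvd_iff_dvd_of_dvd_sub ?_
    have : G * m + H * n - (g p * m + h p * n) = (G - g p) * m + (H - h p) * n := by ring
    rw [this]
    exact dvd_add ((hG p hp).mul_right _) ((hH p hp).mul_right _)
  refine ⟨G, H, s, t, (key s t).2 fun p hp hd => ?_, key⟩
  have h1 := hs p hp
  have h2 := ht p hp
  split_ifs at h1 h2 with hg
  · rcases hgh p hp with h' | h'
    · exact h' hg
    · apply h'
      have : h p = (g p * s + h p * t) - g p * s - h p * (t - 1) := by ring
      rw [this]
      exact dvd_sub (dvd_sub hd (hg.mul_right _)) (h2.mul_left _)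
  · apply hg
    have : g p = (g p * s + h p * t) - g p * (s - 1) - h p * (t - 0) := by ring
    rw [this]
    exact dvd_sub (dvd_sub hd (h1.mul_left _)) (h2.mul_left _)

/-- A binary quadratic form of rank one modulo `p` vanishes where a linear form does. -/
lemma exists_linear_dvd_iff {p : ℕ} (hp : p.Prime) {A B C : ℤ} (hdisc : (p : ℤ) ∣ B ^ 2 - A * C)
    (hne : ¬ ((p : ℤ) ∣ A ∧ (p : ℤ) ∣ B ∧ (p : ℤ) ∣ C)) :
    ∃ g h : ℤ, (¬ (p : ℤ) ∣ g ∨ ¬ (p : ℤ) ∣ h) ∧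
      ∀ m n : ℤ, (p : ℤ) ∣ evenForm A B C m n ↔ (p : ℤ) ∣ g * m + h * n := by
  have hp' : Prime (p : ℤ) := Nat.prime_iff_prime_int.1 hp
  by_cases hA : (p : ℤ) ∣ A
  · have hB : (p : ℤ) ∣ B := by
      refine hp'.dvd_of_dvd_pow (n := 2) ?_
      have := dvd_add hdisc (hA.mul_right C)
      simpa using this
    have hC : ¬ (p : ℤ) ∣ C := fun h => hne ⟨hA, hB, h⟩
    refine ⟨0, 1, Or.inr hp'.not_dvd_one, fun m n => ?_⟩
    have h1 : (p : ℤ) ∣ evenForm A B C m n ↔ (p : ℤ) ∣ C * n ^ 2 := by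
      refine dvd_iff_dvd_of_dvd_sub ?_
      have : evenForm A B C m n - C * n ^ 2 = A * m ^ 2 + B * (2 * m * n) := by
        simp only [evenForm]; ring
      rw [this]
      exact dvd_add (hA.mul_right _) (hB.mul_right _)
    rw [h1, hp'.dvd_mul, hp'.dvd_pow_iff_dvd two_ne_zero]
    simp [hC]
  · refine ⟨A, B, Or.inl hA, fun m n => ?_⟩
    have h1 : (p : ℤ) ∣ A * evenForm A B C m n ↔ (p : ℤ) ∣ (A * m + B * n) ^ 2 := by
      refine dvd_iff_dvd_of_dvd_sub ?_
      have : A * evenForm A B C m n - (A * m + B * n) ^ 2 = (B ^ 2 - A * C) * (-n ^ 2) := by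
        simp only [evenForm]; ring
      rw [this]
      exact hdisc.mul_right _
    rw [hp'.dvd_mul, hp'.dvd_pow_iff_dvd two_ne_zero] at h1
    simpa [hA] using h1

namespace RootTriple

variable {a b w : ℕ} {R : RootTriple a b w}

/-- The primitive pairs `(x, y)` of height at most `B` lying on the conic `a x² + b y² = w u²`
and belonging to the lattice of `R`. -/
def pairs (R : RootTriple a b w) (B : ℝ) : Set (ℤ × ℤ) :=
  {z | IsCoprime z.1 z.2 ∧ |(z.1 : ℝ)| ≤ B ∧ |(z.2 : ℝ)| ≤ B ∧
    ∃ u : ℤ, 0 < u ∧ a * z.1 ^ 2 + b * z.2 ^ 2 = w * u ^ 2 ∧ R.Mem z.1 z.2 u}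

lemma Mem.add {x y u x' y' u' : ℤ} (h : R.Mem x y u) (h' : R.Mem x' y' u') :
    R.Mem (x + x') (y + y') (u + u') := by
  obtain ⟨⟨i, hi⟩, ⟨j, hj⟩, ⟨k, hk⟩⟩ := h
  obtain ⟨⟨i', hi'⟩, ⟨j', hj'⟩, ⟨k', hk'⟩⟩ := h'
  exact ⟨⟨i + i', by linear_combination hi + hi'⟩, ⟨j + j', by linear_combination hj + hj'⟩,
    ⟨k + k', by linear_combination hk + hk'⟩⟩

lemma Mem.mul {x y u : ℤ} (h : R.Mem x y u) (c : ℤ) : R.Mem (x * c) (y * c) (u * c) := by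
  obtain ⟨⟨i, hi⟩, ⟨j, hj⟩, ⟨k, hk⟩⟩ := h
  exact ⟨⟨i * c, by linear_combination c * hi⟩, ⟨j * c, by linear_combination c * hj⟩,
    ⟨k * c, by linear_combination c * hk⟩⟩

lemma finite_pairs (R : RootTriple a b w) (B : ℝ) : (R.pairs B).Finite := by
  refine (Set.Finite.prod (Set.finite_Icc (-⌈B⌉) ⌈B⌉) (Set.finite_Icc (-⌈B⌉) ⌈B⌉)).subset ?_
  rintro ⟨x, y⟩ ⟨-, hx, hy, -⟩
  have aux : ∀ x : ℤ, |(x : ℝ)| ≤ B → x ∈ Set.Icc (-⌈B⌉) ⌈B⌉ := by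
    intro x hx
    rw [Set.mem_Icc, ← abs_le]
    exact_mod_cast hx.trans (Int.le_ceil B)
  exact ⟨aux x hx, aux y hy⟩

namespace Frame

variable (Φ : R.Frame)

/-- The three forms of the parametrization, in terms of the frame. -/
def X (z : ℤ × ℤ) : ℤ := Φ.x1 * (z.1 ^ 2 - z.2 ^ 2) + Φ.x2 * (2 * z.1 * z.2) + Φ.x3 * (z.1 ^ 2 + z.2 ^ 2)
/-- See `X`. -/
def Y (z : ℤ × ℤ) : ℤ := Φ.y1 * (z.1 ^ 2 - z.2 ^ 2) + Φ.y2 * (2 * z.1 * z.2) + Φ.y3 * (z.1 ^ 2 + z.2 ^ 2)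
/-- See `X`. -/
def U (z : ℤ × ℤ) : ℤ := Φ.u1 * (z.1 ^ 2 - z.2 ^ 2) + Φ.u2 * (2 * z.1 * z.2) + Φ.u3 * (z.1 ^ 2 + z.2 ^ 2)

/-- The parameters of primitive points. -/
def param (B : ℝ) : Set (ℤ × ℤ) :=
  {z | IsCoprime z.1 z.2 ∧ Odd (z.1 + z.2) ∧ IsCoprime (Φ.X z) (Φ.Y z) ∧ |(Φ.X z : ℝ)| ≤ B ∧
    |(Φ.Y z : ℝ)| ≤ B}

lemma conic_eq (z : ℤ × ℤ) : a * Φ.X z ^ 2 + b * Φ.Y z ^ 2 = w * Φ.U z ^ 2 := by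
  simp only [X, Y, U]
  obtain ⟨s, t⟩ := z
  linear_combination (s ^ 2 - t ^ 2) ^ 2 * Φ.col11 + 4 * s ^ 2 * t ^ 2 * Φ.col22
      + (s ^ 2 + t ^ 2) ^ 2 * Φ.col33 + 2 * (s ^ 2 - t ^ 2) * (2 * s * t) * Φ.col12
      + 2 * (s ^ 2 - t ^ 2) * (s ^ 2 + t ^ 2) * Φ.col13 + 2 * (2 * s * t) * (s ^ 2 + t ^ 2) * Φ.col23

lemma mem_param (z : ℤ × ℤ) : R.Mem (Φ.X z) (Φ.Y z) (Φ.U z) :=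
  ((Φ.mem1.mul _).add (Φ.mem2.mul _)).add (Φ.mem3.mul _)

lemma U_pos (ha : 0 < a) (hb : 0 < b) (hw : 0 < w) {z : ℤ × ℤ} (hz : z ≠ 0) : 0 < Φ.U z := by
  obtain ⟨s, t⟩ := z
  have hA := (Φ.conic ha hb hw).uA_pos
  have hD := (Φ.conic ha hb hw).disc_u
  simp only [conic] at hA hD
  refine pos_of_mul_pos_right ?_ hA.le
  have e : (Φ.u1 + Φ.u3) * Φ.U (s, t) = ((Φ.u1 + Φ.u3) * s + Φ.u2 * t) ^ 2 + a * b * t ^ 2 := by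
    simp only [U]; linear_combination t ^ 2 * hD
  rw [e]
  rcases eq_or_ne t 0 with rfl | ht
  · have hs : s ≠ 0 := by rintro rfl; exact hz rfl
    simp only [mul_zero, add_zero, zero_pow two_ne_zero]
    have := hA.ne'
    positivity
  · positivity

lemma smul_coord {i j k x y u : ℤ} (hx : x = Φ.x1 * i + Φ.x2 * j + Φ.x3 * k)
    (hy : y = Φ.y1 * i + Φ.y2 * j + Φ.y3 * k) (hu : u = Φ.u1 * i + Φ.u2 * j + Φ.u3 * k) :
    ((a * b * w : ℕ) : ℤ) * i = a * Φ.x1 * x + b * Φ.y1 * y - w * Φ.u1 * u ∧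
    ((a * b * w : ℕ) : ℤ) * j = a * Φ.x2 * x + b * Φ.y2 * y - w * Φ.u2 * u ∧
    ((a * b * w : ℕ) : ℤ) * k = -(a * Φ.x3 * x + b * Φ.y3 * y - w * Φ.u3 * u) := by
  subst hx hy hu
  refine ⟨?_, ?_, ?_⟩
  · linear_combination -i * Φ.col11 - j * Φ.col12 - k * Φ.col13
  · linear_combination -i * Φ.col12 - j * Φ.col22 - k * Φ.col23
  · linear_combination i * Φ.col13 + j * Φ.col23 + k * Φ.col33

lemma coord_inj (ha : 0 < a) (hb : 0 < b) (hw : 0 < w) {i j k i' j' k' x y u : ℤ}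
    (hx : x = Φ.x1 * i + Φ.x2 * j + Φ.x3 * k)
    (hy : y = Φ.y1 * i + Φ.y2 * j + Φ.y3 * k) (hu : u = Φ.u1 * i + Φ.u2 * j + Φ.u3 * k)
    (hx' : x = Φ.x1 * i' + Φ.x2 * j' + Φ.x3 * k')
    (hy' : y = Φ.y1 * i' + Φ.y2 * j' + Φ.y3 * k')
    (hu' : u = Φ.u1 * i' + Φ.u2 * j' + Φ.u3 * k') : i = i' ∧ j = j' ∧ k = k' := by
  have hn : ((a * b * w : ℕ) : ℤ) ≠ 0 := by positivity
  obtain ⟨h1, h2, h3⟩ := Φ.smul_coord hx hy hu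
  obtain ⟨h1', h2', h3'⟩ := Φ.smul_coord hx' hy' hu'
  exact ⟨mul_left_cancel₀ hn (h1.trans h1'.symm), mul_left_cancel₀ hn (h2.trans h2'.symm),
    mul_left_cancel₀ hn (h3.trans h3'.symm)⟩

lemma ne_zero_of_mem_param {B : ℝ} {z : ℤ × ℤ} (hz : z ∈ Φ.param B) : z ≠ 0 := by
  rintro rfl
  simpa using hz.2.1

lemma U_eq_of_eq (ha : 0 < a) (hb : 0 < b) (hw : 0 < w) (Ψ : R.Frame) {z z' : ℤ × ℤ} (hz : z ≠ 0)
    (hz' : z' ≠ 0) (hX : Φ.X z = Ψ.X z') (hY : Φ.Y z = Ψ.Y z') : Φ.U z = Ψ.U z' := by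
  have h1 := Φ.conic_eq z
  rw [hX, hY, Ψ.conic_eq z'] at h1
  have hw' : (w : ℤ) ≠ 0 := by positivity
  have h2 := mul_left_cancel₀ hw' h1
  exact ((sq_eq_sq₀ (Φ.U_pos ha hb hw hz).le (Ψ.U_pos ha hb hw hz').le).1 h2.symm)

lemma image_subset (ha : 0 < a) (hb : 0 < b) (hw : 0 < w) (B : ℝ) :
    (fun z => (Φ.X z, Φ.Y z)) '' Φ.param B ⊆ R.pairs B := by
  rintro _ ⟨z, hz, rfl⟩
  exact ⟨hz.2.2.1, hz.2.2.2.1, hz.2.2.2.2, Φ.U z, Φ.U_pos ha hb hw (Φ.ne_zero_of_mem_param hz),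
    Φ.conic_eq z, Φ.mem_param z⟩

lemma ncard_param (ha : 0 < a) (hb : 0 < b) (hw : 0 < w) (B : ℝ) :
    (Φ.param B).ncard = 2 * ((fun z => (Φ.X z, Φ.Y z)) '' Φ.param B).ncard := by
  have hX : ∀ z, Φ.X (-z) = Φ.X z := fun z => by simp only [X, Prod.fst_neg, Prod.snd_neg]; ring
  have hY : ∀ z, Φ.Y (-z) = Φ.Y z := fun z => by simp only [Y, Prod.fst_neg, Prod.snd_neg]; ring
  refine Set.ncard_eq_two_mul_ncard_image _ ((R.finite_pairs B).subset (Φ.image_subset ha hb hw B))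
    (fun h => Φ.ne_zero_of_mem_param h rfl) ?_ ?_ ?_
  · rintro z ⟨h1, h2, h3, h4, h5⟩
    refine ⟨h1.neg_neg, ?_, by rwa [hX, hY], by rwa [hX], by rwa [hY]⟩
    have : (-z).1 + (-z).2 = -(z.1 + z.2) := by simp; ring
    rw [this]; exact h2.neg
  · intro z _
    simp only [hX, hY]
  · intro z hz z' hz' he
    simp only [Prod.mk.injEq] at he
    obtain ⟨e1, e2⟩ := he
    have e3 := Φ.U_eq_of_eq ha hb hw Φ (Φ.ne_zero_of_mem_param hz') (Φ.ne_zero_of_mem_param hz) e1 e2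
    obtain ⟨s, t⟩ := z
    obtain ⟨s', t'⟩ := z'
    simp only [X, Y, U] at e1 e2 e3
    obtain ⟨c1, c2, c3⟩ := Φ.coord_inj ha hb hw rfl rfl rfl e1 e2 e3
    have d1 : s' ^ 2 = s ^ 2 := by linarith
    have d2 : t' ^ 2 = t ^ 2 := by linarith
    have d3 : s' * t' = s * t := by linarith
    rcases sq_eq_sq_iff_eq_or_eq_neg.1 d1 with rfl | rfl
    · rcases eq_or_ne s' 0 with rfl | h0
      · rcases sq_eq_sq_iff_eq_or_eq_neg.1 d2 with rfl | rfl <;> simp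
      · left; rw [mul_left_cancel₀ h0 d3]
    · rcases eq_or_ne s 0 with rfl | h0
      · rcases sq_eq_sq_iff_eq_or_eq_neg.1 d2 with rfl | rfl <;> simp
      · right
        have : t' = -t := mul_left_cancel₀ h0 (by linarith)
        simp [this]

lemma mem_image_of_odd (ha : 0 < a) (hb : 0 < b) (hw : 0 < w) {B : ℝ} {i j k x y u : ℤ}
    (hx : x = Φ.x1 * i + Φ.x2 * j + Φ.x3 * k)
    (hy : y = Φ.y1 * i + Φ.y2 * j + Φ.y3 * k) (hu : u = Φ.u1 * i + Φ.u2 * j + Φ.u3 * k)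
    (hpos : 0 < u) (hcop : IsCoprime x y) (hxB : |(x : ℝ)| ≤ B) (hyB : |(y : ℝ)| ≤ B)
    (ht : PythagoreanTriple i j k) (hij : Int.gcd i j = 1) (hi : i % 2 = 1) :
    (x, y) ∈ (fun z => (Φ.X z, Φ.Y z)) '' Φ.param B := by
  rcases lt_trichotomy k 0 with hk | rfl | hk
  · exfalso
    have ht' : PythagoreanTriple (-i) (-j) (-k) := by
      unfold PythagoreanTriple at ht ⊢; linear_combination ht
    obtain ⟨m, n, h1, h2, h3, h4, -⟩ := PythagoreanTriple.coprime_classification' ht'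
      (by simpa using hij) (by lia) (by lia)
    have h0 : ((m, n) : ℤ × ℤ) ≠ 0 := by
      rintro h
      simp only [Prod.mk_eq_zero] at h
      simp [h.1, h.2] at h4
    have := Φ.U_pos ha hb hw h0
    simp only [U, ← h1, ← h2, ← h3] at this
    linarith
  · unfold PythagoreanTriple at ht
    have : i = 0 := by nlinarith [sq_nonneg i, sq_nonneg j]
    lia
  · obtain ⟨m, n, h1, h2, h3, h4, h5, -⟩ := PythagoreanTriple.coprime_classification' ht hij hi hk
    have hX : Φ.X (m, n) = x := by simp only [X, ← h1, ← h2, ← h3, hx]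
    have hY : Φ.Y (m, n) = y := by simp only [Y, ← h1, ← h2, ← h3, hy]
    refine ⟨(m, n), ⟨Int.isCoprime_iff_gcd_eq_one.2 h4, ?_, by rwa [hX, hY], by rwa [hX],
      by rwa [hY]⟩, by simp only [hX, hY]⟩
    rw [Int.odd_iff]; simp only; lia

lemma ncard_param_add (ha : 0 < a) (hb : 0 < b) (hw : 0 < w) (hab : a.Coprime b)
    (haw : a.Coprime w) (hbw : b.Coprime w) (B : ℝ) :
    (Φ.param B).ncard + (Φ.swap.param B).ncard = 2 * (R.pairs B).ncard := by
  have hunion : R.pairs B = ((fun z => (Φ.X z, Φ.Y z)) '' Φ.param B) ∪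
      ((fun z => (Φ.swap.X z, Φ.swap.Y z)) '' Φ.swap.param B) := by
    refine Set.Subset.antisymm ?_
      (Set.union_subset (Φ.image_subset ha hb hw B) (Φ.swap.image_subset ha hb hw B))
    rintro ⟨x, y⟩ ⟨h1, h2, h3, u, h4, h5, h6⟩
    obtain ⟨i, j, k, hx, hy, hu⟩ := Φ.exists_coords ha hb hw hab haw hbw h6
    simp only at h1 h2 h3 h5 hx hy hu
    have ht : PythagoreanTriple i j k := by
      have hn : ((a * b * w : ℕ) : ℤ) ≠ 0 := by positivity
      apply mul_left_cancel₀ hn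
      rw [hx, hy, hu] at h5
      linear_combination h5 - i ^ 2 * Φ.col11 - j ^ 2 * Φ.col22 - k ^ 2 * Φ.col33 -
        2 * i * j * Φ.col12 - 2 * i * k * Φ.col13 - 2 * j * k * Φ.col23
    have hij : Int.gcd i j = 1 := by
      by_contra hne
      obtain ⟨p, hp, hpd⟩ := Nat.exists_prime_and_dvd hne
      have hp' : Prime (p : ℤ) := Nat.prime_iff_prime_int.1 hp
      have hpd' : (p : ℤ) ∣ ((Int.gcd i j : ℕ) : ℤ) := by exact_mod_cast hpd
      have hi := hpd'.trans (Int.gcd_dvd_left ..)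
      have hj := hpd'.trans (Int.gcd_dvd_right ..)
      have hk : (p : ℤ) ∣ k := by
        have : (p : ℤ) ∣ k * k := by
          rw [← ht]; exact dvd_add (hi.mul_right _) (hj.mul_right _)
        exact (hp'.dvd_or_dvd this).elim id id
      apply hp'.not_isUnit
      refine h1.isUnit_of_dvd' ?_ ?_
      · rw [hx]; exact dvd_add (dvd_add (hi.mul_left _) (hj.mul_left _)) (hk.mul_left _)
      · rw [hy]; exact dvd_add (dvd_add (hi.mul_left _) (hj.mul_left _)) (hk.mul_left _)
    rcases ht.even_odd_of_coprime hij with ⟨-, hj⟩ | ⟨hi, -⟩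
    · right
      refine Φ.swap.mem_image_of_odd ha hb hw (i := j) (j := i) (k := k) (u := u) ?_ ?_ ?_ h4 h1 h2 h3
        ht.symm (by rwa [Int.gcd_comm]) hj
      · simp only [swap]; linarith
      · simp only [swap]; linarith
      · simp only [swap]; linarith
    · left
      exact Φ.mem_image_of_odd ha hb hw hx hy hu h4 h1 h2 h3 ht hij hi
  have hdisj : Disjoint ((fun z => (Φ.X z, Φ.Y z)) '' Φ.param B)
      ((fun z => (Φ.swap.X z, Φ.swap.Y z)) '' Φ.swap.param B) := by
    rw [Set.disjoint_left]
    rintro _ ⟨z, hz, rfl⟩ ⟨z', hz', he⟩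
    simp only [Prod.mk.injEq] at he
    have hU := Φ.swap.U_eq_of_eq ha hb hw Φ (Φ.swap.ne_zero_of_mem_param hz')
      (Φ.ne_zero_of_mem_param hz) he.1 he.2
    have hodd := hz.2.1
    obtain ⟨s, t⟩ := z
    obtain ⟨s', t'⟩ := z'
    obtain ⟨e1, e2⟩ := he
    simp only [X, Y, U, swap] at e1 e2 hU
    obtain ⟨c1, -, -⟩ := Φ.coord_inj ha hb hw (i := s ^ 2 - t ^ 2)
      (j := 2 * s * t) (k := s ^ 2 + t ^ 2) (i' := 2 * s' * t') (j' := s' ^ 2 - t' ^ 2)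
      (k' := s' ^ 2 + t' ^ 2) rfl rfl rfl (by linarith) (by linarith) (by linarith)
    simp only at hodd
    have : Odd (s ^ 2 - t ^ 2) := by
      rw [sq_sub_sq]
      refine hodd.mul ?_
      have : s - t = s + t - 2 * t := by ring
      rw [this]
      exact hodd.sub_even (even_two_mul t)
    rw [c1, mul_assoc] at this
    exact (Int.not_even_iff_odd.2 this) (even_two_mul _)
  have hfin := R.finite_pairs B
  have hf1 := hfin.subset (Φ.image_subset ha hb hw B)
  have hf2 := hfin.subset (Φ.swap.image_subset ha hb hw B)
  rw [hunion, Set.ncard_union_eq hdisj hf1 hf2, Φ.ncard_param ha hb hw,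
    Φ.swap.ncard_param ha hb hw]
  ring

end Frame

end RootTriple

namespace RootTriple

variable {a b w : ℕ} {R : RootTriple a b w}

lemma not_dvd_ra (R : RootTriple a b w) (haw : a.Coprime w) {p : ℕ} (hp : p.Prime) (hpa : p ∣ a) :
    ¬ (p : ℤ) ∣ R.ra := by
  intro h
  have h1 : (p : ℤ) ∣ w := by
    have h2 : (p : ℤ) ∣ b * R.ra ^ 2 - w := dvd_trans (by exact_mod_cast hpa) R.dvd_a
    have h3 := dvd_sub ((h.pow two_ne_zero).mul_left (b : ℤ)) h2
    simpa using h3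
  exact Nat.not_coprime_of_dvd_of_dvd hp.one_lt hpa (by exact_mod_cast h1) haw

lemma not_dvd_rb (R : RootTriple a b w) (hbw : b.Coprime w) {p : ℕ} (hp : p.Prime) (hpb : p ∣ b) :
    ¬ (p : ℤ) ∣ R.rb := by
  intro h
  have h1 : (p : ℤ) ∣ w := by
    have h2 : (p : ℤ) ∣ a * R.rb ^ 2 - w := dvd_trans (by exact_mod_cast hpb) R.dvd_b
    have h3 := dvd_sub ((h.pow two_ne_zero).mul_left (a : ℤ)) h2
    simpa using h3
  exact Nat.not_coprime_of_dvd_of_dvd hp.one_lt hpb (by exact_mod_cast h1) hbw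

lemma exists_mem_of_dvd (R : RootTriple a b w) (hbw : b.Coprime w) {y u : ℤ}
    (h : (a : ℤ) ∣ y - R.ra * u) : ∃ x, R.Mem x y u := by
  obtain ⟨i, j, hij⟩ : IsCoprime (b : ℤ) w := Nat.isCoprime_iff_coprime.2 hbw
  refine ⟨R.rb * u * (j * w) + R.rw * y * (i * b), h, ⟨i * (R.rw * y - R.rb * u), ?_⟩,
    ⟨j * (R.rb * u - R.rw * y), ?_⟩⟩
  · linear_combination R.rb * u * hij
  · linear_combination R.rw * y * hij

namespace Frame

variable (Φ : R.Frame)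

lemma dvd_X_of_dvd_Y (haw : a.Coprime w) (hsa : Squarefree a) {p : ℕ} (hp : p.Prime)
    (hpa : p ∣ a ∨ p ∣ w) {z : ℤ × ℤ} (hY : (p : ℤ) ∣ Φ.Y z) : (p : ℤ) ∣ Φ.X z := by
  have hp' : Prime (p : ℤ) := Nat.prime_iff_prime_int.1 hp
  obtain ⟨m1, m2, m3⟩ := Φ.mem_param z
  rcases hpa with hpa | hpw
  · have hU : (p : ℤ) ∣ Φ.U z := by
      have h1 : (p : ℤ) ∣ Φ.Y z - R.ra * Φ.U z := dvd_trans (by exact_mod_cast hpa) m1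
      have h2 : (p : ℤ) ∣ R.ra * Φ.U z := by simpa using dvd_sub hY h1
      exact (hp'.dvd_or_dvd h2).resolve_left (R.not_dvd_ra haw hp hpa)
    obtain ⟨c, hc⟩ := hpa
    have hpc : ¬ p ∣ c := fun ⟨d, hd⟩ => hp.not_isUnit (hsa p ⟨d, by rw [hc, hd, mul_assoc]⟩)
    obtain ⟨s, hs⟩ := hY
    obtain ⟨t, ht⟩ := hU
    have h3 := Φ.conic_eq z
    have h4 : (p : ℤ) ∣ c * Φ.X z ^ 2 := by
      refine ⟨w * t ^ 2 - b * s ^ 2, mul_left_cancel₀ hp'.ne_zero ?_⟩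
      have hc' : (a : ℤ) = p * c := by exact_mod_cast hc
      rw [hc', hs, ht] at h3
      linear_combination h3
    refine hp'.dvd_of_dvd_pow ((hp'.dvd_or_dvd h4).resolve_left ?_)
    exact_mod_cast hpc
  · have h1 : (p : ℤ) ∣ Φ.X z - R.rw * Φ.Y z := dvd_trans (by exact_mod_cast hpw) m3
    simpa using dvd_add h1 (hY.mul_left R.rw)

lemma dvd_Y_of_dvd_X (hbw : b.Coprime w) (hsb : Squarefree b) {p : ℕ} (hp : p.Prime)
    (hpb : p ∣ b) {z : ℤ × ℤ} (hX : (p : ℤ) ∣ Φ.X z) : (p : ℤ) ∣ Φ.Y z := by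
  have hp' : Prime (p : ℤ) := Nat.prime_iff_prime_int.1 hp
  obtain ⟨m1, m2, m3⟩ := Φ.mem_param z
  have hU : (p : ℤ) ∣ Φ.U z := by
    have h1 : (p : ℤ) ∣ Φ.X z - R.rb * Φ.U z := dvd_trans (by exact_mod_cast hpb) m2
    have h2 : (p : ℤ) ∣ R.rb * Φ.U z := by simpa using dvd_sub hX h1
    exact (hp'.dvd_or_dvd h2).resolve_left (R.not_dvd_rb hbw hp hpb)
  obtain ⟨c, hc⟩ := hpb
  have hpc : ¬ p ∣ c := fun ⟨d, hd⟩ => hp.not_isUnit (hsb p ⟨d, by rw [hc, hd, mul_assoc]⟩)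
  obtain ⟨s, hs⟩ := hX
  obtain ⟨t, ht⟩ := hU
  have h3 := Φ.conic_eq z
  have h4 : (p : ℤ) ∣ c * Φ.Y z ^ 2 := by
    refine ⟨w * t ^ 2 - a * s ^ 2, mul_left_cancel₀ hp'.ne_zero ?_⟩
    have hc' : (b : ℤ) = p * c := by exact_mod_cast hc
    rw [hc', hs, ht] at h3
    linear_combination h3
  refine hp'.dvd_of_dvd_pow ((hp'.dvd_or_dvd h4).resolve_left ?_)
  exact_mod_cast hpc

lemma dvd_of_dvd_X_of_dvd_Y {p : ℕ} (hp : p.Prime) {z : ℤ × ℤ} (hz : IsCoprime z.1 z.2)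
    (hodd : Odd (z.1 + z.2)) (hX : (p : ℤ) ∣ Φ.X z) (hY : (p : ℤ) ∣ Φ.Y z) :
    p ∣ a ∨ p ∣ b ∨ p ∣ w := by
  have hp' : Prime (p : ℤ) := Nat.prime_iff_prime_int.1 hp
  by_contra hcon
  push Not at hcon
  obtain ⟨ha, hb, hw⟩ := hcon
  have hn : ¬ (p : ℤ) ∣ ((a * b * w : ℕ) : ℤ) := by
    rw [Int.natCast_dvd_natCast, hp.dvd_mul, hp.dvd_mul]
    tauto
  have hU : (p : ℤ) ∣ Φ.U z := by
    have h1 : (p : ℤ) ∣ w * Φ.U z ^ 2 := by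
      rw [← Φ.conic_eq]
      exact dvd_add ((hX.pow two_ne_zero).mul_left _) ((hY.pow two_ne_zero).mul_left _)
    refine hp'.dvd_of_dvd_pow ((hp'.dvd_or_dvd h1).resolve_left ?_)
    exact_mod_cast hw
  obtain ⟨h1, h2, h3⟩ := Φ.smul_coord (x := Φ.X z) (y := Φ.Y z) (u := Φ.U z) rfl rfl rfl
  have hpi : (p : ℤ) ∣ z.1 ^ 2 - z.2 ^ 2 := by
    refine (hp'.dvd_or_dvd (?_ : (p : ℤ) ∣ _ * _)).resolve_left hn
    rw [h1]; exact dvd_sub (dvd_add (hX.mul_left _) (hY.mul_left _)) (hU.mul_left _)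
  have hpk : (p : ℤ) ∣ z.1 ^ 2 + z.2 ^ 2 := by
    refine (hp'.dvd_or_dvd (?_ : (p : ℤ) ∣ _ * _)).resolve_left hn
    rw [h3]
    exact (dvd_sub (dvd_add (hX.mul_left _) (hY.mul_left _)) (hU.mul_left _)).neg_right
  have hp2 : ¬ (p : ℤ) ∣ 2 := by
    intro h
    have h2 : p = 2 := (Nat.prime_dvd_prime_iff_eq hp Nat.prime_two).1 (by exact_mod_cast h)
    subst h2
    rw [sq_sub_sq] at hpi
    rcases hp'.dvd_or_dvd hpi with h | h
    · exact Int.not_even_iff_odd.2 hodd (even_iff_two_dvd.2 h)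
    · have : z.1 + z.2 = z.1 - z.2 + 2 * z.2 := by ring
      refine Int.not_even_iff_odd.2 hodd (even_iff_two_dvd.2 ?_)
      rw [this]; exact dvd_add h (dvd_mul_right _ _)
  have hd1 : (p : ℤ) ∣ 2 * z.1 ^ 2 := by
    have := dvd_add hpi hpk; rwa [show z.1 ^ 2 - z.2 ^ 2 + (z.1 ^ 2 + z.2 ^ 2) = 2 * z.1 ^ 2 by ring] at this
  have hd2 : (p : ℤ) ∣ 2 * z.2 ^ 2 := by
    have := dvd_sub hpk hpi; rwa [show z.1 ^ 2 + z.2 ^ 2 - (z.1 ^ 2 - z.2 ^ 2) = 2 * z.2 ^ 2 by ring] at this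
  exact hp'.not_isUnit (hz.isUnit_of_dvd'
    (hp'.dvd_of_dvd_pow ((hp'.dvd_or_dvd hd1).resolve_left hp2))
    (hp'.dvd_of_dvd_pow ((hp'.dvd_or_dvd hd2).resolve_left hp2)))

lemma isCoprime_iff (hsa : Squarefree a) (hsb : Squarefree b)
    (haw : a.Coprime w) (hbw : b.Coprime w) {z : ℤ × ℤ} (hz : IsCoprime z.1 z.2)
    (hodd : Odd (z.1 + z.2)) : IsCoprime (Φ.X z) (Φ.Y z) ↔
      (∀ p : ℕ, p.Prime → (p ∣ a ∨ p ∣ w) → ¬ (p : ℤ) ∣ Φ.Y z) ∧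
      (∀ p : ℕ, p.Prime → p ∣ b → ¬ (p : ℤ) ∣ Φ.X z) := by
  constructor
  · intro h
    refine ⟨fun p hp hpa hY => ?_, fun p hp hpb hX => ?_⟩
    · exact (Nat.prime_iff_prime_int.1 hp).not_isUnit
        (h.isUnit_of_dvd' (Φ.dvd_X_of_dvd_Y haw hsa hp hpa hY) hY)
    · exact (Nat.prime_iff_prime_int.1 hp).not_isUnit
        (h.isUnit_of_dvd' hX (Φ.dvd_Y_of_dvd_X hbw hsb hp hpb hX))
  · rintro ⟨h1, h2⟩
    rw [Int.isCoprime_iff_gcd_eq_one]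
    by_contra hne
    obtain ⟨p, hp, hpd⟩ := Nat.exists_prime_and_dvd hne
    have hpd' : (p : ℤ) ∣ ((Int.gcd (Φ.X z) (Φ.Y z) : ℕ) : ℤ) := by exact_mod_cast hpd
    have hX := hpd'.trans (Int.gcd_dvd_left ..)
    have hY := hpd'.trans (Int.gcd_dvd_right ..)
    rcases Φ.dvd_of_dvd_X_of_dvd_Y hp hz hodd hX hY with h | h | h
    · exact h1 p hp (Or.inl h) hY
    · exact h2 p hp h hX
    · exact h1 p hp (Or.inr h) hY

lemma exists_linear_Y (ha : 0 < a) (hb : 0 < b) (hw : 0 < w) (hab : a.Coprime b)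
    (haw : a.Coprime w) (hbw : b.Coprime w) {p : ℕ} (hp : p.Prime) (hp2 : p ≠ 2)
    (hpa : p ∣ a ∨ p ∣ w) :
    ∃ g h : ℤ, (¬ (p : ℤ) ∣ g ∨ ¬ (p : ℤ) ∣ h) ∧
      ∀ z : ℤ × ℤ, (p : ℤ) ∣ Φ.Y z ↔ (p : ℤ) ∣ g * z.1 + h * z.2 := by
  have hp' : Prime (p : ℤ) := Nat.prime_iff_prime_int.1 hp
  have hp2' : ¬ (p : ℤ) ∣ 2 := fun h =>
    hp2 ((Nat.prime_dvd_prime_iff_eq hp Nat.prime_two).1 (by exact_mod_cast h))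
  have hform : ∀ z : ℤ × ℤ, Φ.Y z = evenForm (Φ.y1 + Φ.y3) Φ.y2 (Φ.y3 - Φ.y1) z.1 z.2 := by
    intro z; simp only [Y, evenForm]; ring
  simp only [hform]
  have hdvd : p ∣ a * w := hpa.elim (fun h => h.mul_right w) (fun h => h.mul_left a)
  have hdisc : (p : ℤ) ∣ Φ.y2 ^ 2 - (Φ.y1 + Φ.y3) * (Φ.y3 - Φ.y1) := by
    have := (Φ.conic ha hb hw).disc_y
    simp only [conic] at this
    rw [this]; exact_mod_cast hdvd
  obtain ⟨g, h, hgh, hall⟩ := exists_linear_dvd_iff hp hdisc (by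
    rintro ⟨h1, h2, h3⟩
    have e1 : (p : ℤ) ∣ Φ.y1 := by
      refine (hp'.dvd_or_dvd ?_).resolve_left hp2'
      have := dvd_sub h1 h3
      rwa [show Φ.y1 + Φ.y3 - (Φ.y3 - Φ.y1) = 2 * Φ.y1 by ring] at this
    have e3 : (p : ℤ) ∣ Φ.y3 := by
      have := dvd_sub h1 e1
      simpa using this
    have hall : ∀ x y u, R.Mem x y u → (p : ℤ) ∣ y := by
      intro x y u hm
      obtain ⟨i, j, k, -, hy, -⟩ := Φ.exists_coords ha hb hw hab haw hbw hm
      rw [hy]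
      exact dvd_add (dvd_add (e1.mul_right _) (h2.mul_right _)) (e3.mul_right _)
    rcases hpa with hpa | hpw
    · obtain ⟨x, hx⟩ := R.exists_mem_of_dvd hbw (y := R.ra) (u := 1) (by simp)
      exact R.not_dvd_ra haw hp hpa (hall _ _ _ hx)
    · obtain ⟨x, hx⟩ := R.exists_mem_of_dvd hbw (y := a) (u := 0) (by simp)
      have := hall _ _ _ hx
      exact Nat.not_coprime_of_dvd_of_dvd hp.one_lt (by exact_mod_cast this) hpw haw)
  exact ⟨g, h, hgh, fun z => hall z.1 z.2⟩

lemma exists_linear_X (ha : 0 < a) (hb : 0 < b) (hw : 0 < w) (hab : a.Coprime b)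
    (haw : a.Coprime w) (hbw : b.Coprime w) {p : ℕ} (hp : p.Prime) (hp2 : p ≠ 2) (hpb : p ∣ b) :
    ∃ g h : ℤ, (¬ (p : ℤ) ∣ g ∨ ¬ (p : ℤ) ∣ h) ∧
      ∀ z : ℤ × ℤ, (p : ℤ) ∣ Φ.X z ↔ (p : ℤ) ∣ g * z.1 + h * z.2 := by
  have hp' : Prime (p : ℤ) := Nat.prime_iff_prime_int.1 hp
  have hp2' : ¬ (p : ℤ) ∣ 2 := fun h =>
    hp2 ((Nat.prime_dvd_prime_iff_eq hp Nat.prime_two).1 (by exact_mod_cast h))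
  have hform : ∀ z : ℤ × ℤ, Φ.X z = evenForm (Φ.x1 + Φ.x3) Φ.x2 (Φ.x3 - Φ.x1) z.1 z.2 := by
    intro z; simp only [X, evenForm]; ring
  simp only [hform]
  have hdisc : (p : ℤ) ∣ Φ.x2 ^ 2 - (Φ.x1 + Φ.x3) * (Φ.x3 - Φ.x1) := by
    have := (Φ.conic ha hb hw).disc_x
    simp only [conic] at this
    rw [this]; exact_mod_cast hpb.mul_right w
  obtain ⟨g, h, hgh, hall⟩ := exists_linear_dvd_iff hp hdisc (by
    rintro ⟨h1, h2, h3⟩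
    have e1 : (p : ℤ) ∣ Φ.x1 := by
      refine (hp'.dvd_or_dvd ?_).resolve_left hp2'
      have := dvd_sub h1 h3
      rwa [show Φ.x1 + Φ.x3 - (Φ.x3 - Φ.x1) = 2 * Φ.x1 by ring] at this
    have e3 : (p : ℤ) ∣ Φ.x3 := by
      have := dvd_sub h1 e1
      simpa using this
    obtain ⟨x, hx⟩ := R.exists_mem_of_dvd hbw (y := R.ra) (u := 1) (by simp)
    obtain ⟨i, j, k, hxx, -, -⟩ := Φ.exists_coords ha hb hw hab haw hbw hx
    have h4 : (p : ℤ) ∣ x := by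
      rw [hxx]
      exact dvd_add (dvd_add (e1.mul_right _) (h2.mul_right _)) (e3.mul_right _)
    apply R.not_dvd_rb hbw hp hpb
    have h5 : (p : ℤ) ∣ x - R.rb * 1 := dvd_trans (by exact_mod_cast hpb) hx.2.1
    have := dvd_sub h4 h5
    simpa using this)
  exact ⟨g, h, hgh, fun z => hall z.1 z.2⟩

lemma exists_param_eq_points (ha : 0 < a) (hb : 0 < b) (hw : 0 < w) (hab : a.Coprime b)
    (haw : a.Coprime w) (hbw : b.Coprime w) (hsa : Squarefree a) (hsb : Squarefree b)
    (hodd : Odd (a * b * w)) {M : ℕ} (hM : ∀ p : ℕ, p.Prime → (p ∣ M ↔ p = 2 ∨ p ∣ a * b * w))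
    (hM0 : M ≠ 0) :
    ∃ g h s t : ZMod M, IsUnit (g * s + h * t) ∧
      ∀ B : ℝ, Φ.param B = (Φ.conic ha hb hw).points g h B := by
  have hne2 : ∀ p, p ∣ a * b * w → p ≠ 2 := by
    rintro p hp rfl
    exact Nat.not_even_iff_odd.2 hodd (even_iff_two_dvd.2 hp)
  have hchoice : ∀ p ∈ M.primeFactors, ∃ g h : ℤ, (¬ (p : ℤ) ∣ g ∨ ¬ (p : ℤ) ∣ h) ∧
      ∀ z : ℤ × ℤ, ((p : ℤ) ∣ g * z.1 + h * z.2 ↔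
        (p = 2 ∧ (p : ℤ) ∣ z.1 + z.2) ∨ ((p ∣ a ∨ p ∣ w) ∧ (p : ℤ) ∣ Φ.Y z) ∨
          (p ∣ b ∧ (p : ℤ) ∣ Φ.X z)) := by
    intro p hp
    obtain ⟨hpp, hpM, -⟩ := Nat.mem_primeFactors.1 hp
    by_cases h2 : p = 2
    · subst h2
      refine ⟨1, 1, Or.inl (by norm_num), fun z => ?_⟩
      have h1 : ¬ 2 ∣ a * b * w := fun h => hne2 2 h rfl
      rw [hpp.dvd_mul, hpp.dvd_mul] at h1
      push Not at h1
      simp [h1]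
    have hdvd := ((hM p hpp).1 hpM).resolve_left h2
    by_cases hpb : p ∣ b
    · obtain ⟨g, h, hgh, hall⟩ := Φ.exists_linear_X ha hb hw hab haw hbw hpp h2 hpb
      refine ⟨g, h, hgh, fun z => ?_⟩
      have h1 : ¬ p ∣ a := fun h => Nat.not_coprime_of_dvd_of_dvd hpp.one_lt h hpb hab
      have h3 : ¬ p ∣ w := fun h => Nat.not_coprime_of_dvd_of_dvd hpp.one_lt hpb h hbw
      rw [← hall]
      simp [h1, h3, h2, hpb]
    · have hpa : p ∣ a ∨ p ∣ w := by
        rw [hpp.dvd_mul, hpp.dvd_mul] at hdvd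
        tauto
      obtain ⟨g, h, hgh, hall⟩ := Φ.exists_linear_Y ha hb hw hab haw hbw hpp h2 hpa
      refine ⟨g, h, hgh, fun z => ?_⟩
      rw [← hall]
      simp [hpa, h2, hpb]
  choose! g h hgh hall using hchoice
  obtain ⟨g', h', s, t, hst, hiff⟩ := exists_linearForm_isUnit_iff hM0 g h hgh
  refine ⟨g', h', s, t, hst, fun B => ?_⟩
  ext z
  have hgauge : (Φ.conic ha hb hw).gauge (z.1, z.2) ≤ B ↔ |(Φ.X z : ℝ)| ≤ B ∧ |(Φ.Y z : ℝ)| ≤ B := by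
    have h1 : (Φ.conic ha hb hw).x z.1 z.2 = (Φ.X z : ℝ) := by
      simp only [ConicParam.x, conic, evenForm, X]; push_cast; ring
    have h2 : (Φ.conic ha hb hw).y z.1 z.2 = (Φ.Y z : ℝ) := by
      simp only [ConicParam.y, conic, evenForm, Y]; push_cast; ring
    simp only [ConicParam.gauge, h1, h2, max_le_iff]
  simp only [param, ConicParam.points, Set.mem_ofPred_eq, hgauge, hiff]
  refine and_congr_right fun hz => ?_
  rw [← and_assoc, ← and_assoc, ← and_assoc]
  rw [and_assoc, and_assoc (c := |(Φ.Y z : ℝ)| ≤ B)]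
  refine and_congr_left fun _ => ?_
  constructor
  · rintro ⟨ho, hc⟩ p hp hd
    obtain ⟨hpp, hpM, -⟩ := Nat.mem_primeFactors.1 hp
    obtain ⟨h1, h2⟩ := (Φ.isCoprime_iff hsa hsb haw hbw hz ho).1 hc
    rcases (hall p hp z).1 hd with ⟨rfl, h⟩ | ⟨h, h'⟩ | ⟨h, h'⟩
    · exact Int.not_even_iff_odd.2 ho (even_iff_two_dvd.2 h)
    · exact h1 p hpp h h'
    · exact h2 p hpp h h'
  · intro H
    have hmem : ∀ p : ℕ, p.Prime → (p = 2 ∨ p ∣ a * b * w) → p ∈ M.primeFactors :=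
      fun p hp h => Nat.mem_primeFactors.2 ⟨hp, (hM p hp).2 h, hM0⟩
    have ho : Odd (z.1 + z.2) := by
      rw [← Int.not_even_iff_odd, even_iff_two_dvd]
      intro h
      have h2 := hmem 2 Nat.prime_two (Or.inl rfl)
      exact H 2 h2 ((hall 2 h2 z).2 (Or.inl ⟨rfl, h⟩))
    refine ⟨ho, (Φ.isCoprime_iff hsa hsb haw hbw hz ho).2 ⟨fun p hp h hd => ?_, fun p hp h hd => ?_⟩⟩
    · have h2 := hmem p hp (Or.inr (h.elim (fun h => (h.mul_right b).mul_right w)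
        (fun h => h.mul_left (a * b))))
      exact H p h2 ((hall p h2 z).2 (Or.inr (Or.inl ⟨h, hd⟩)))
    · have h2 := hmem p hp (Or.inr ((h.mul_left a).mul_right w))
      exact H p h2 ((hall p h2 z).2 (Or.inr (Or.inr ⟨h, hd⟩)))

end Frame

end RootTriple

lemma prod_primeFactors_two_mul {n : ℕ} (hn : Odd n) :
    ∏ p ∈ (2 * n).primeFactors, (1 + (p : ℝ)⁻¹)⁻¹ = 2 / 3 * gammaF n := by
  have h2 : 2 ∉ n.primeFactors := fun h =>
    Nat.not_even_iff_odd.2 hn (even_iff_two_dvd.2 (Nat.dvd_of_mem_primeFactors h))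
  have hn0 : n ≠ 0 := by rintro rfl; simp at hn
  rw [Nat.primeFactors_mul two_ne_zero hn0, Nat.prime_two.primeFactors, ← Finset.insert_eq,
    Finset.prod_insert h2, gammaF, Finset.filter_true_of_mem (by rintro p hp rfl; exact h2 hp)]
  norm_num

lemma exists_ncard_pairs_bound (a b : ℕ) (ha : 0 < a) (hb : 0 < b) :
    ∃ K : ℝ, 0 < K ∧ ∀ v : ℕ, Odd (a * b * v) → Squarefree (a * b * v) →
      ∀ R : RootTriple a b (v ^ 3), ∀ B : ℝ, 0 ≤ B →
      |((R.pairs B).ncard : ℝ) - 4 / π ^ 2 * gammaF (a * b * v) *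
        (sigmaInf a b * (B / √((v ^ 3 : ℕ) : ℝ)))| ≤ K * (v : ℝ) ^ 2 * B ^ (3 / 4 : ℝ) ∧
      ((R.pairs B).ncard : ℝ) ≤ K * (B / √((v ^ 3 : ℕ) : ℝ)) := by
  obtain ⟨K, hK, hbound⟩ := exists_ncard_points_bound a b ha hb
  refine ⟨K * (4 * a ^ 2 * b ^ 2), by positivity, fun v hodd hsq R B hB => ?_⟩
  have hv0 : v ≠ 0 := by rintro rfl; simp at hodd
  have hv : 0 < v := Nat.pos_of_ne_zero hv0
  have hab : a.Coprime b := Nat.coprime_of_squarefree_mul (hsq.of_mul_left)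
  have habv : (a * b).Coprime v := Nat.coprime_of_squarefree_mul hsq
  have haw : a.Coprime (v ^ 3) := (habv.coprime_mul_right).pow_right 3
  have hbw : b.Coprime (v ^ 3) := (habv.coprime_mul_left).pow_right 3
  have hw : 0 < v ^ 3 := by positivity
  have hsa : Squarefree a := hsq.of_mul_left.of_mul_left
  have hsb : Squarefree b := hsq.of_mul_left.of_mul_right
  have hoddw : Odd (a * b * v ^ 3) := by
    rw [Nat.odd_mul] at hodd ⊢
    exact ⟨hodd.1, hodd.2.pow⟩
  set M := 2 * (a * b * v) with hMdef
  have hM0 : M ≠ 0 := by positivity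
  have hM1 : 1 < M := by
    have : 0 < a * b * v := by positivity
    lia
  have hM : ∀ p : ℕ, p.Prime → (p ∣ M ↔ p = 2 ∨ p ∣ a * b * v ^ 3) := by
    intro p hp
    rw [hMdef, hp.dvd_mul, Nat.prime_dvd_prime_iff_eq hp Nat.prime_two, hp.dvd_mul (m := a * b),
      hp.dvd_mul (m := a * b), hp.prime.dvd_pow_iff_dvd three_ne_zero]
  obtain ⟨Φ⟩ := R.exists_frame ha hb hw hab haw hbw
  have key : ∀ Ψ : R.Frame, |((Ψ.param B).ncard : ℝ) - 4 / π ^ 2 * gammaF (a * b * v) *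
        (sigmaInf a b * (B / √((v ^ 3 : ℕ) : ℝ)))| ≤ K * M ^ 2 * B ^ (3 / 4 : ℝ) ∧
      ((Ψ.param B).ncard : ℝ) ≤ K * (B / √((v ^ 3 : ℕ) : ℝ)) := by
    intro Ψ
    obtain ⟨g, h, s, t, hst, heq⟩ := Ψ.exists_param_eq_points ha hb hw hab haw hbw hsa hsb hoddw hM hM0
    obtain ⟨h1, h2⟩ := hbound (v ^ 3) hw (Ψ.conic ha hb hw) M hM1 g h s t hst B hB
    rw [heq]
    refine ⟨?_, h2⟩
    convert h1 using 3
    rw [hMdef, prod_primeFactors_two_mul hodd]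
    ring
  obtain ⟨h1, h2⟩ := key Φ
  obtain ⟨h3, h4⟩ := key Φ.swap
  have hsum : ((Φ.param B).ncard : ℝ) + ((Φ.swap.param B).ncard : ℝ) = 2 * ((R.pairs B).ncard : ℝ) := by
    exact_mod_cast Φ.ncard_param_add ha hb hw hab haw hbw B
  have hMM : K * (M : ℝ) ^ 2 * B ^ (3 / 4 : ℝ) =
      K * (4 * a ^ 2 * b ^ 2) * (v : ℝ) ^ 2 * B ^ (3 / 4 : ℝ) := by
    rw [hMdef]; push_cast; ring
  rw [hMM] at h1 h3
  constructor
  · rw [abs_le] at *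
    constructor <;> linarith [h1.1, h1.2, h3.1, h3.2]
  · have h5 : ((R.pairs B).ncard : ℝ) ≤ K * (B / √((v ^ 3 : ℕ) : ℝ)) := by linarith
    refine h5.trans ?_
    have ha1 : (1 : ℝ) ≤ a := by exact_mod_cast ha
    have hb1 : (1 : ℝ) ≤ b := by exact_mod_cast hb
    have : (1 : ℝ) ≤ 4 * a ^ 2 * b ^ 2 := by nlinarith [one_le_pow₀ ha1 (n := 2), one_le_pow₀ hb1 (n := 2)]
    have h6 : 0 ≤ K * (B / √((v ^ 3 : ℕ) : ℝ)) := by positivity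
    nlinarith

/-- The number of solutions of `c r² = d` modulo `n`. -/
noncomputable def rootCount (c d : ℤ) (n : ℕ) : ℕ := Nat.card {r : ZMod n // (c : ZMod n) * r ^ 2 = d}

lemma rootCount_one (c d : ℤ) : rootCount c d 1 = 1 := by
  unfold rootCount
  rw [Nat.card_eq_one_iff_unique]
  exact ⟨inferInstance, ⟨⟨0, Subsingleton.elim _ _⟩⟩⟩

lemma rootCount_mul (c d : ℤ) {m n : ℕ} (h : m.Coprime n) :
    rootCount c d (m * n) = rootCount c d m * rootCount c d n := by
  unfold rootCount
  rw [← Nat.card_prod]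
  refine Nat.card_congr (Equiv.trans (Equiv.subtypeEquiv (ZMod.chineseRemainder h).toEquiv ?_)
    (Equiv.subtypeProdEquivProd (p := fun r : ZMod m => (c : ZMod m) * r ^ 2 = d)
      (q := fun r : ZMod n => (c : ZMod n) * r ^ 2 = d)))
  intro r
  rw [← (ZMod.chineseRemainder h).injective.eq_iff]
  simp [Prod.ext_iff]

lemma rootCount_prod (c d : ℤ) (k : ℕ) (S : Finset ℕ) (hS : ∀ p ∈ S, p.Prime) :
    rootCount c d (∏ p ∈ S, p ^ k) = ∏ p ∈ S, rootCount c d (p ^ k) := by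
  classical
  induction S using Finset.induction_on with
  | empty => simp [rootCount_one]
  | insert p S hp ih =>
    rw [Finset.prod_insert hp, Finset.prod_insert hp, rootCount_mul,
      ih fun q hq => hS q (Finset.mem_insert_of_mem hq)]
    refine Nat.Coprime.prod_right fun q hq => Nat.Coprime.pow _ _ ?_
    refine (Nat.coprime_primes (hS p (Finset.mem_insert_self ..))
      (hS q (Finset.mem_insert_of_mem hq))).2 ?_
    rintro rfl
    exact hp hq

lemma exists_pow_dvd_mul_sq_sub {p : ℕ} (hp : p.Prime) (hp2 : p ≠ 2) {c d : ℤ}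
    (hc : ¬ (p : ℤ) ∣ c) (hd : ¬ (p : ℤ) ∣ d) (h : ∃ r : ℤ, (p : ℤ) ∣ c * r ^ 2 - d) (k : ℕ) :
    ∃ r : ℤ, (p : ℤ) ^ (k + 1) ∣ c * r ^ 2 - d := by
  have hp' : Prime (p : ℤ) := Nat.prime_iff_prime_int.1 hp
  induction k with
  | zero => simpa using h
  | succ k ih =>
    obtain ⟨r, e, he⟩ := ih
    have hr : ¬ (p : ℤ) ∣ r := by
      intro hr
      apply hd
      have h1 : (p : ℤ) ∣ c * r ^ 2 - d := by
        rw [he, pow_succ', mul_assoc]; exact dvd_mul_right _ _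
      have := dvd_sub ((hr.pow two_ne_zero).mul_left c) h1
      simpa using this
    have h2 : ¬ (p : ℤ) ∣ 2 := fun h =>
      hp2 ((Nat.prime_dvd_prime_iff_eq hp Nat.prime_two).1 (by exact_mod_cast h))
    have hcop : IsCoprime (p : ℤ) (2 * c * r) := by
      rw [hp'.coprime_iff_not_dvd, hp'.dvd_mul, hp'.dvd_mul]
      tauto
    obtain ⟨x, y, hxy⟩ := hcop
    refine ⟨r - e * y * p ^ (k + 1), e * x + c * e ^ 2 * y ^ 2 * p ^ k, ?_⟩
    linear_combination he - e * (p : ℤ) ^ (k + 1) * hxy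

lemma rootCount_prime_pow {p : ℕ} (hp : p.Prime) (hp2 : p ≠ 2) {c d : ℤ}
    (hc : ¬ (p : ℤ) ∣ c) (hd : ¬ (p : ℤ) ∣ d) {k : ℕ} (hk : k ≠ 0) :
    (rootCount c d (p ^ k) : ℤ) = 1 + jacobiSym (c * d) p := by
  have hp' : Prime (p : ℤ) := Nat.prime_iff_prime_int.1 hp
  have : Fact p.Prime := ⟨hp⟩
  have : NeZero p := ⟨hp.ne_zero⟩
  obtain ⟨k, rfl⟩ := Nat.exists_eq_succ_of_ne_zero hk
  have hcp : (c : ZMod p) ≠ 0 := by rwa [Ne, ZMod.intCast_zmod_eq_zero_iff_dvd]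
  have hdp : (d : ZMod p) ≠ 0 := by rwa [Ne, ZMod.intCast_zmod_eq_zero_iff_dvd]
  have hcd : ((c * d : ℤ) : ZMod p) ≠ 0 := by push_cast; exact mul_ne_zero hcp hdp
  have hzero : ∀ r : ℤ, ((c : ZMod (p ^ (k + 1))) * (r : ZMod (p ^ (k + 1))) ^ 2 = d ↔
      (p : ℤ) ^ (k + 1) ∣ c * r ^ 2 - d) := by
    intro r
    rw [← sub_eq_zero]
    have : (c : ZMod (p ^ (k + 1))) * (r : ZMod (p ^ (k + 1))) ^ 2 - d =
      ((c * r ^ 2 - d : ℤ) : ZMod (p ^ (k + 1))) := by push_cast; ring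
    rw [this, ZMod.intCast_zmod_eq_zero_iff_dvd]
    push_cast; rfl
  rw [← jacobiSym.legendreSym.to_jacobiSym]
  rcases legendreSym.eq_one_or_neg_one p hcd with h1 | h1
  · rw [h1]
    have hex : ∃ r : ℤ, (p : ℤ) ∣ c * r ^ 2 - d := by
      obtain ⟨s, hs⟩ := (legendreSym.eq_one_iff p hcd).1 h1
      obtain ⟨r, hr⟩ := ZMod.intCast_surjective (s / c : ZMod p)
      refine ⟨r, ?_⟩
      rw [← ZMod.intCast_zmod_eq_zero_iff_dvd]
      push_cast at hs ⊢
      rw [hr]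
      field_simp
      linear_combination -hs
    obtain ⟨r, hr⟩ := exists_pow_dvd_mul_sq_sub hp hp2 hc hd hex k
    have hpr : ¬ (p : ℤ) ∣ r := by
      intro hr'
      apply hd
      have h3 : (p : ℤ) ∣ c * r ^ 2 - d := dvd_trans (dvd_pow_self _ k.succ_ne_zero) hr
      have := dvd_sub ((hr'.pow two_ne_zero).mul_left c) h3
      simpa using this
    have h2 : ¬ (p : ℤ) ∣ 2 := fun h =>
      hp2 ((Nat.prime_dvd_prime_iff_eq hp Nat.prime_two).1 (by exact_mod_cast h))
    have hset : {x : ZMod (p ^ (k + 1)) | (c : ZMod (p ^ (k + 1))) * x ^ 2 = d} =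
        {(r : ZMod (p ^ (k + 1))), -(r : ZMod (p ^ (k + 1)))} := by
      ext x
      obtain ⟨s, rfl⟩ := ZMod.intCast_surjective x
      simp only [Set.mem_ofPred_eq, Set.mem_insert_iff, Set.mem_singleton_iff]
      rw [hzero]
      have e1 : (s : ZMod (p ^ (k + 1))) = r ↔ (p : ℤ) ^ (k + 1) ∣ s - r := by
        rw [← sub_eq_zero, ← Int.cast_sub, ZMod.intCast_zmod_eq_zero_iff_dvd]; push_cast; rfl
      have e2 : (s : ZMod (p ^ (k + 1))) = -r ↔ (p : ℤ) ^ (k + 1) ∣ s + r := by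
        rw [← sub_eq_zero, sub_neg_eq_add, ← Int.cast_add, ZMod.intCast_zmod_eq_zero_iff_dvd]
        push_cast; rfl
      rw [e1, e2]
      constructor
      · intro hs
        have h3 : (p : ℤ) ^ (k + 1) ∣ c * ((s - r) * (s + r)) := by
          have := dvd_sub hs hr
          rwa [show c * s ^ 2 - d - (c * r ^ 2 - d) = c * ((s - r) * (s + r)) by ring] at this
        have h4 := ((hp'.coprime_iff_not_dvd.2 hc).pow_left (m := k + 1)).dvd_of_dvd_mul_left h3
        by_cases h5 : (p : ℤ) ∣ s - r
        · left
          refine ((hp'.coprime_iff_not_dvd.2 fun h6 => ?_).pow_left (m := k + 1)).dvd_of_dvd_mul_right h4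
          have := dvd_sub h6 h5
          rw [show s + r - (s - r) = 2 * r by ring] at this
          exact (hp'.dvd_or_dvd this).elim h2 hpr
        · right
          exact ((hp'.coprime_iff_not_dvd.2 h5).pow_left (m := k + 1)).dvd_of_dvd_mul_left h4
      · rintro (h | h)
        · have := dvd_add (h.mul_left (c * (s + r))) hr
          rwa [show c * (s + r) * (s - r) + (c * r ^ 2 - d) = c * s ^ 2 - d by ring] at this
        · have := dvd_add (h.mul_left (c * (s - r))) hr
          rwa [show c * (s - r) * (s + r) + (c * r ^ 2 - d) = c * s ^ 2 - d by ring] at this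
    have hne : (r : ZMod (p ^ (k + 1))) ≠ -(r : ZMod (p ^ (k + 1))) := by
      intro h
      rw [← sub_eq_zero, sub_neg_eq_add, ← Int.cast_add, ZMod.intCast_zmod_eq_zero_iff_dvd] at h
      push_cast at h
      have h3 := dvd_trans (dvd_pow_self (p : ℤ) k.succ_ne_zero) h
      rw [← two_mul] at h3
      exact (hp'.dvd_or_dvd h3).elim h2 hpr
    have : rootCount c d (p ^ (k + 1)) = 2 := by
      unfold rootCount
      have h := Set.ncard_pair hne
      rw [← hset] at h
      exact h
    rw [Nat.succ_eq_add_one, this]; rfl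
  · rw [h1]
    have : rootCount c d (p ^ (k + 1)) = 0 := by
      unfold rootCount
      rw [Nat.card_eq_zero]
      left
      refine ⟨fun ⟨x, hx⟩ => ?_⟩
      obtain ⟨s, rfl⟩ := ZMod.intCast_surjective x
      rw [hzero] at hx
      have h3 := dvd_trans (dvd_pow_self (p : ℤ) k.succ_ne_zero) hx
      rw [← ZMod.intCast_zmod_eq_zero_iff_dvd] at h3
      push_cast at h3
      refine (legendreSym.eq_neg_one_iff p).1 h1 ⟨c * s, ?_⟩
      push_cast
      linear_combination -(c : ZMod p) * h3
    rw [Nat.succ_eq_add_one, this]; rfl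

lemma rootCount_pow {n : ℕ} (hodd : Odd n) (hsq : Squarefree n) {c d : ℤ}
    (hc : IsCoprime c n) (hd : IsCoprime d n) {k : ℕ} (hk : k ≠ 0) :
    (rootCount c d (n ^ k) : ℤ) = ∏ p ∈ n.primeFactors.filter (· ≠ 2), (1 + jacobiSym (c * d) p) := by
  have h2 : 2 ∉ n.primeFactors := fun h =>
    Nat.not_even_iff_odd.2 hodd (even_iff_two_dvd.2 (Nat.dvd_of_mem_primeFactors h))
  rw [Finset.filter_true_of_mem (by rintro p hp rfl; exact h2 hp)]
  conv_lhs => rw [← Nat.prod_primeFactors_of_squarefree hsq, ← Finset.prod_pow]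
  rw [rootCount_prod _ _ _ _ fun p hp => Nat.prime_of_mem_primeFactors hp]
  push_cast
  refine Finset.prod_congr rfl fun p hp => ?_
  have hpp := Nat.prime_of_mem_primeFactors hp
  have hpn : (p : ℤ) ∣ n := by exact_mod_cast Nat.dvd_of_mem_primeFactors hp
  have hp' : Prime (p : ℤ) := Nat.prime_iff_prime_int.1 hpp
  exact rootCount_prime_pow hpp (by rintro rfl; exact h2 hp)
    (fun h => hp'.not_isUnit (hc.isUnit_of_dvd' h hpn))
    (fun h => hp'.not_isUnit (hd.isUnit_of_dvd' h hpn)) hk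

/-- Admissible residue classes of the roots in a `RootTriple`. -/
abbrev RootClass (a b w : ℕ) : Type :=
  {r : ZMod a // ((b : ℤ) : ZMod a) * r ^ 2 = ((w : ℤ) : ZMod a)} ×
  {r : ZMod b // ((a : ℤ) : ZMod b) * r ^ 2 = ((w : ℤ) : ZMod b)} ×
  {r : ZMod w // ((a : ℤ) : ZMod w) * r ^ 2 = ((-(b : ℤ) : ℤ) : ZMod w)}

/-- A root triple with the given residue classes. -/
noncomputable def RootClass.toRootTriple {a b w : ℕ} (C : RootClass a b w) : RootTriple a b w where
  ra := (C.1.1.cast : ℤ)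
  rb := (C.2.1.1.cast : ℤ)
  rw := (C.2.2.1.cast : ℤ)
  dvd_a := by
    rw [← ZMod.intCast_zmod_eq_zero_iff_dvd]
    have := C.1.2
    push_cast at this ⊢
    rw [this, sub_self]
  dvd_b := by
    rw [← ZMod.intCast_zmod_eq_zero_iff_dvd]
    have := C.2.1.2
    push_cast at this ⊢
    rw [this, sub_self]
  dvd_w := by
    rw [← ZMod.intCast_zmod_eq_zero_iff_dvd]
    have := C.2.2.2
    push_cast at this ⊢
    rw [this, neg_add_cancel]

/-- Coprime pairs in a box for which `a x² + b y²` is `w` times a nonzero square. -/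
def sqPairs (a b w : ℕ) (B : ℝ) : Set (ℤ × ℤ) :=
  {z | IsCoprime z.1 z.2 ∧ |(z.1 : ℝ)| ≤ B ∧ |(z.2 : ℝ)| ≤ B ∧
    ∃ u : ℤ, 0 < u ∧ a * z.1 ^ 2 + b * z.2 ^ 2 = w * u ^ 2}

lemma isCoprime_of_forall_prime {m n : ℤ} (hn : n ≠ 0)
    (h : ∀ p : ℤ, Prime p → p ∣ m → ¬ p ∣ n) : IsCoprime m n :=
  isCoprime_of_prime_dvd (fun h0 => hn h0.2) fun p hp h1 h2 => h p hp h1 h2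

lemma isCoprime_root_left {a b w x y u : ℤ} (ha : a ≠ 0) (hsa : Squarefree a) (hab : IsCoprime a b)
    (hxy : IsCoprime x y) (h : a * x ^ 2 + b * y ^ 2 = w * u ^ 2) : IsCoprime u a := by
  refine isCoprime_of_forall_prime ha fun p hp hu hpa => ?_
  have hb : ¬ p ∣ b := fun hb => hp.not_isUnit (hab.isUnit_of_dvd' hpa hb)
  have hy : p ∣ y := by
    have : p ∣ b * y ^ 2 := by
      have h1 := dvd_sub ((hu.pow two_ne_zero).mul_left w) (hpa.mul_right (x ^ 2))
      rwa [← h, add_sub_cancel_left] at h1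
    exact hp.dvd_of_dvd_pow ((hp.dvd_or_dvd this).resolve_left hb)
  have hx : ¬ p ∣ x := fun hx => hp.not_isUnit (hxy.isUnit_of_dvd' hx hy)
  have h2 : p * p ∣ a * x ^ 2 := by
    have h1 := dvd_sub ((pow_dvd_pow_of_dvd hu 2).mul_left w) ((pow_dvd_pow_of_dvd hy 2).mul_left b)
    rw [← h, add_sub_cancel_right] at h1
    rwa [← sq]
  have h3 : p * p ∣ a := by
    refine IsCoprime.dvd_of_dvd_mul_right ?_ h2
    have : IsCoprime p x := (hp.coprime_iff_not_dvd).2 hx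
    exact (this.mul_left this).pow_right
  exact hp.not_isUnit (hsa p h3)

lemma exists_root {a b w x y u : ℤ} (hu : IsCoprime u a)
    (h : a * x ^ 2 + b * y ^ 2 = w * u ^ 2) : ∃ r : ℤ, a ∣ b * r ^ 2 - w ∧ a ∣ y - r * u := by
  obtain ⟨s, t, hst⟩ := hu
  refine ⟨y * s, ⟨-s ^ 2 * x ^ 2 - w * t * (s * u + 1), ?_⟩, ⟨y * t, ?_⟩⟩
  · linear_combination s ^ 2 * h + w * (s * u + 1) * hst
  · linear_combination -y * hst

lemma isCoprime_of_conic {a b v : ℕ} (hsq : Squarefree (a * b * v)) {x y u : ℤ}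
    (hxy : IsCoprime x y) (h : a * x ^ 2 + b * y ^ 2 = ((v ^ 3 : ℕ) : ℤ) * u ^ 2) :
    IsCoprime u a ∧ IsCoprime u b ∧ IsCoprime y ((v ^ 3 : ℕ) : ℤ) := by
  have h0 := hsq.ne_zero
  have ha : (a : ℤ) ≠ 0 := by rintro h; simp_all
  have hb : (b : ℤ) ≠ 0 := by rintro h; simp_all
  have hv : (v : ℤ) ≠ 0 := by rintro h; simp_all
  have hab : IsCoprime (a : ℤ) b := Nat.isCoprime_iff_coprime.2 <|
    Nat.coprime_of_squarefree_mul (hsq.of_mul_left)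
  have habv : (a * b).Coprime v := Nat.coprime_of_squarefree_mul hsq
  have hav : IsCoprime (a : ℤ) v := Nat.isCoprime_iff_coprime.2 habv.coprime_mul_right
  have hsa : Squarefree (a : ℤ) := Int.squarefree_natCast.2 hsq.of_mul_left.of_mul_left
  have hsb : Squarefree (b : ℤ) := Int.squarefree_natCast.2 hsq.of_mul_left.of_mul_right
  have h' : (b : ℤ) * y ^ 2 + a * x ^ 2 = ((v ^ 3 : ℕ) : ℤ) * u ^ 2 := by rw [add_comm, h]
  refine ⟨isCoprime_root_left ha hsa hab hxy h, isCoprime_root_left hb hsb hab.symm hxy.symm h', ?_⟩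
  push_cast
  refine IsCoprime.pow_right (isCoprime_of_forall_prime hv fun p hp h1 h2 => ?_)
  have h3 : p ∣ a * x ^ 2 := by
    have := dvd_sub (((h2.pow three_ne_zero).mul_right (u ^ 2)))
      ((h1.pow two_ne_zero).mul_left (b : ℤ))
    push_cast at h
    rwa [← h, add_sub_cancel_right] at this
  rcases hp.dvd_or_dvd h3 with h4 | h4
  · exact hp.not_isUnit (hav.isUnit_of_dvd' h4 h2)
  · exact hp.not_isUnit (hxy.isUnit_of_dvd' (hp.dvd_of_dvd_pow h4) h1)

lemma sqPairs_eq_iUnion {a b v : ℕ} (hsq : Squarefree (a * b * v)) (B : ℝ) :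
    sqPairs a b (v ^ 3) B = ⋃ C : RootClass a b (v ^ 3), C.toRootTriple.pairs B := by
  ext ⟨x, y⟩
  simp only [sqPairs, RootTriple.pairs, Set.mem_ofPred_eq, Set.mem_iUnion]
  constructor
  · rintro ⟨hxy, hx, hy, u, hu, h⟩
    obtain ⟨hua, hub, hyv⟩ := isCoprime_of_conic hsq hxy h
    have h' : (b : ℤ) * y ^ 2 + a * x ^ 2 = ((v ^ 3 : ℕ) : ℤ) * u ^ 2 := by rw [add_comm, h]
    obtain ⟨r, hr, hr'⟩ := exists_root hua h
    obtain ⟨s, hs, hs'⟩ := exists_root hub h'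
    have h'' : ((v ^ 3 : ℕ) : ℤ) * u ^ 2 + (-a) * x ^ 2 = b * y ^ 2 := by rw [← h]; ring
    obtain ⟨t, ht, ht'⟩ := exists_root hyv h''
    have e1 : ((b : ℤ) : ZMod a) * (r : ZMod a) ^ 2 = (((v ^ 3 : ℕ) : ℤ) : ZMod a) := by
      rw [← sub_eq_zero, ← Int.cast_pow, ← Int.cast_mul, ← Int.cast_sub,
        ZMod.intCast_zmod_eq_zero_iff_dvd]
      exact hr
    have e2 : ((a : ℤ) : ZMod b) * (s : ZMod b) ^ 2 = (((v ^ 3 : ℕ) : ℤ) : ZMod b) := by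
      rw [← sub_eq_zero, ← Int.cast_pow, ← Int.cast_mul, ← Int.cast_sub,
        ZMod.intCast_zmod_eq_zero_iff_dvd]
      exact hs
    have e3 : ((a : ℤ) : ZMod (v ^ 3)) * (t : ZMod (v ^ 3)) ^ 2 =
        ((-(b : ℤ) : ℤ) : ZMod (v ^ 3)) := by
      rw [← sub_eq_zero, ← Int.cast_pow, ← Int.cast_mul, ← Int.cast_sub,
        ZMod.intCast_zmod_eq_zero_iff_dvd]
      rw [show (a : ℤ) * t ^ 2 - -(b : ℤ) = -(-a * t ^ 2 - b) by ring]
      exact ht.neg_right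
    refine ⟨⟨⟨r, e1⟩, ⟨s, e2⟩, ⟨t, e3⟩⟩, hxy, hx, hy, u, hu, h, ?_, ?_, ?_⟩
    · rw [← ZMod.intCast_zmod_eq_zero_iff_dvd] at hr' ⊢
      simp only [RootClass.toRootTriple]
      push_cast at hr' ⊢
      exact hr'
    · rw [← ZMod.intCast_zmod_eq_zero_iff_dvd] at hs' ⊢
      simp only [RootClass.toRootTriple]
      push_cast at hs' ⊢
      exact hs'
    · rw [← ZMod.intCast_zmod_eq_zero_iff_dvd] at ht' ⊢
      simp only [RootClass.toRootTriple]
      push_cast at ht' ⊢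
      exact ht'
  · rintro ⟨C, hxy, hx, hy, u, hu, h, -⟩
    exact ⟨hxy, hx, hy, u, hu, h⟩

lemma zmod_eq_of_dvd {n : ℕ} {r s : ZMod n} {y u : ℤ} (hu : IsCoprime u n)
    (h1 : (n : ℤ) ∣ y - r.cast * u) (h2 : (n : ℤ) ∣ y - s.cast * u) : r = s := by
  have h3 : (n : ℤ) ∣ (s.cast - r.cast) * u := by
    have := dvd_sub h1 h2
    rwa [show y - r.cast * u - (y - s.cast * u) = ((s.cast : ℤ) - r.cast) * u by ring] at this
  have h4 := hu.symm.dvd_of_dvd_mul_right h3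
  rw [← ZMod.intCast_zmod_eq_zero_iff_dvd] at h4
  push_cast at h4
  rw [sub_eq_zero] at h4
  exact h4.symm

lemma pairs_disjoint {a b v : ℕ} (hsq : Squarefree (a * b * v)) (B : ℝ) :
    Pairwise (Function.onFun Disjoint fun C : RootClass a b (v ^ 3) => C.toRootTriple.pairs B) := by
  intro C D hne
  refine Set.disjoint_left.2 ?_
  rintro ⟨x, y⟩ ⟨hxy, -, -, u, hu, h, h1, h2, h3⟩ ⟨-, -, -, u', hu', h', h1', h2', h3'⟩
  simp only at hxy h h1 h2 h3 h' h1' h2' h3'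
  have hv : ((v ^ 3 : ℕ) : ℤ) ≠ 0 := by
    have := hsq.ne_zero
    intro h0
    simp_all
  obtain ⟨hua, hub, hyv⟩ := isCoprime_of_conic hsq hxy h
  have huu : u = u' := by
    have : u ^ 2 = u' ^ 2 := mul_left_cancel₀ hv (h.symm.trans h')
    exact (pow_left_inj₀ hu.le hu'.le two_ne_zero).1 this
  subst huu
  apply hne
  refine Prod.ext (Subtype.ext ?_) (Prod.ext (Subtype.ext ?_) (Subtype.ext ?_))
  · exact zmod_eq_of_dvd hua h1 h1'
  · exact zmod_eq_of_dvd hub h2 h2'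
  · exact zmod_eq_of_dvd hyv h3 h3'

lemma jacobiSym_mul_pow_three {p v : ℕ} (b : ℤ) (h : v.Coprime p) :
    jacobiSym (b * ((v ^ 3 : ℕ) : ℤ)) p = jacobiSym (b * v) p := by
  have : b * ((v ^ 3 : ℕ) : ℤ) = b * v * (v : ℤ) ^ 2 := by push_cast; ring
  rw [this, jacobiSym.mul_left, jacobiSym.sq_one' (by simpa using h), mul_one]

lemma card_rootClass {a b v : ℕ} (hodd : Odd (a * b * v)) (hsq : Squarefree (a * b * v)) :
    (Nat.card (RootClass a b (v ^ 3)) : ℤ) = rho a b v := by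
  have hab : a.Coprime b := Nat.coprime_of_squarefree_mul hsq.of_mul_left
  have habv : (a * b).Coprime v := Nat.coprime_of_squarefree_mul hsq
  have hav : a.Coprime v := habv.coprime_mul_right
  have hbv : b.Coprime v := habv.coprime_mul_left
  have iab : IsCoprime (a : ℤ) b := Nat.isCoprime_iff_coprime.2 hab
  have iav : IsCoprime (a : ℤ) v := Nat.isCoprime_iff_coprime.2 hav
  have ibv : IsCoprime (b : ℤ) v := Nat.isCoprime_iff_coprime.2 hbv
  have hoa : Odd a := (Nat.odd_mul.1 (Nat.odd_mul.1 hodd).1).1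
  have hob : Odd b := (Nat.odd_mul.1 (Nat.odd_mul.1 hodd).1).2
  have hov : Odd v := (Nat.odd_mul.1 hodd).2
  have key : Nat.card (RootClass a b (v ^ 3)) = rootCount b ((v ^ 3 : ℕ) : ℤ) (a ^ 1) *
      (rootCount a ((v ^ 3 : ℕ) : ℤ) (b ^ 1) * rootCount a (-b) (v ^ 3)) := by
    rw [RootClass, Nat.card_prod, Nat.card_prod, pow_one, pow_one]
    rfl
  have e1 := rootCount_pow hoa hsq.of_mul_left.of_mul_left iab.symm
    (d := ((v ^ 3 : ℕ) : ℤ)) (by push_cast; exact iav.symm.pow_left) one_ne_zero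
  have e2 := rootCount_pow hob hsq.of_mul_left.of_mul_right iab
    (d := ((v ^ 3 : ℕ) : ℤ)) (by push_cast; exact ibv.symm.pow_left) one_ne_zero
  have e3 := rootCount_pow hov hsq.of_mul_right iav ibv.neg_left three_ne_zero
  rw [key]
  push_cast only [Nat.cast_mul]
  rw [e1, e2, e3, rho, mul_assoc]
  congr 1
  · refine Finset.prod_congr rfl fun p hp => ?_
    rw [jacobiSym_mul_pow_three]
    exact hav.symm.coprime_dvd_right (Nat.dvd_of_mem_primeFactors (Finset.mem_filter.1 hp).1)
  congr 1
  · refine Finset.prod_congr rfl fun p hp => ?_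
    rw [jacobiSym_mul_pow_three]
    exact hbv.symm.coprime_dvd_right (Nat.dvd_of_mem_primeFactors (Finset.mem_filter.1 hp).1)
  · refine Finset.prod_congr rfl fun p hp => ?_
    rw [mul_neg]

lemma finite_rootClass {a b v : ℕ} (h : a * b * v ≠ 0) : Finite (RootClass a b (v ^ 3)) := by
  have : NeZero a := ⟨by rintro rfl; simp at h⟩
  have : NeZero b := ⟨by rintro rfl; simp at h⟩
  have : NeZero (v ^ 3) := ⟨by apply pow_ne_zero; rintro rfl; simp at h⟩
  infer_instance

lemma sqPairs_finite (a b w : ℕ) (B : ℝ) : (sqPairs a b w B).Finite := by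
  refine ((Set.finite_Icc (-⌈B⌉) ⌈B⌉).prod (Set.finite_Icc (-⌈B⌉) ⌈B⌉)).subset ?_
  rintro ⟨x, y⟩ ⟨-, hx, hy, -⟩
  simp only [abs_le] at hx hy
  have := Int.le_ceil B
  simp only [Set.mem_prod, Set.mem_Icc]
  refine ⟨⟨?_, ?_⟩, ?_, ?_⟩ <;> rify <;> linarith

/-- The count of points on the conics `a x² + b y² = v³ u²`, uniformly in `v`. -/
lemma exists_ncard_sqPairs_bound (a b : ℕ) (ha : 0 < a) (hb : 0 < b) :
    ∃ K : ℝ, 0 < K ∧ ∀ v : ℕ, Odd (a * b * v) → Squarefree (a * b * v) → ∀ B : ℝ, 0 ≤ B →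
      0 ≤ rho a b v ∧
      |((sqPairs a b (v ^ 3) B).ncard : ℝ) - rho a b v * (4 / π ^ 2 * gammaF (a * b * v) *
        (sigmaInf a b * (B / √((v ^ 3 : ℕ) : ℝ))))| ≤
          rho a b v * (K * (v : ℝ) ^ 2 * B ^ (3 / 4 : ℝ)) ∧
      ((sqPairs a b (v ^ 3) B).ncard : ℝ) ≤ rho a b v * (K * (B / √((v ^ 3 : ℕ) : ℝ))) := by
  obtain ⟨K, hK, h⟩ := exists_ncard_pairs_bound a b ha hb
  refine ⟨K, hK, fun v hodd hsq B hB => ?_⟩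
  have : Finite (RootClass a b (v ^ 3)) := finite_rootClass hsq.ne_zero
  have : Fintype (RootClass a b (v ^ 3)) := Fintype.ofFinite _
  have hcard := card_rootClass hodd hsq
  rw [Nat.card_eq_fintype_card] at hcard
  have hcardR : ((Fintype.card (RootClass a b (v ^ 3)) : ℕ) : ℝ) = (rho a b v : ℝ) := by
    exact_mod_cast hcard
  have hn : (sqPairs a b (v ^ 3) B).ncard =
      ∑ C : RootClass a b (v ^ 3), (C.toRootTriple.pairs B).ncard := by
    rw [sqPairs_eq_iUnion hsq, Set.ncard_iUnion_of_finite
      (fun C => C.toRootTriple.finite_pairs B) (pairs_disjoint hsq B), finsum_eq_sum_of_fintype]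
  refine ⟨by rw [← hcard]; positivity, ?_, ?_⟩
  · rw [hn, ← hcardR, ← nsmul_eq_mul, ← nsmul_eq_mul, ← Finset.card_univ, ← Finset.sum_const,
      ← Finset.sum_const, Nat.cast_sum, ← Finset.sum_sub_distrib]
    exact (Finset.abs_sum_le_sum_abs _ _).trans
      (Finset.sum_le_sum fun C _ => (h v hodd hsq C.toRootTriple B hB).1)
  · rw [hn, ← hcardR, ← nsmul_eq_mul, ← Finset.card_univ, ← Finset.sum_const, Nat.cast_sum]
    exact Finset.sum_le_sum fun C _ => (h v hodd hsq C.toRootTriple B hB).2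

lemma gammaF_nonneg (d : ℕ) : 0 ≤ gammaF d :=
  Finset.prod_nonneg fun p _ => by positivity

lemma gammaF_le_one (d : ℕ) : gammaF d ≤ 1 :=
  Finset.prod_le_one (fun p _ => by positivity) fun p _ =>
    inv_le_one_of_one_le₀ (by linarith [show (0 : ℝ) ≤ (p : ℝ)⁻¹ by positivity])

lemma abs_jacobiSym_le_one (m : ℤ) (n : ℕ) : |jacobiSym m n| ≤ 1 := by
  rcases jacobiSym.trichotomy m n with h | h | h <;> simp [h]

lemma prod_one_add_jacobiSym_le (m : ℤ) (n : ℕ) :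
    |∏ p ∈ n.primeFactors.filter (· ≠ 2), (1 + jacobiSym m p)| ≤ 2 ^ n.primeFactors.card := by
  rw [Finset.abs_prod]
  calc ∏ p ∈ n.primeFactors.filter (· ≠ 2), |1 + jacobiSym m p|
      ≤ ∏ p ∈ n.primeFactors.filter (· ≠ 2), (2 : ℤ) :=
        Finset.prod_le_prod (fun _ _ => abs_nonneg _) fun p _ => by
          have := abs_le.1 (abs_jacobiSym_le_one m p)
          rw [abs_le]; omega
    _ = 2 ^ (n.primeFactors.filter (· ≠ 2)).card := by simp
    _ ≤ _ := pow_le_pow_right₀ (by norm_num) (Finset.card_filter_le _ _)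

lemma two_pow_card_primeFactors_le {n : ℕ} (hn : n ≠ 0) :
    (2 : ℝ) ^ n.primeFactors.card ≤ 2 ^ 16 * (n : ℝ) ^ (1 / 4 : ℝ) := by
  rw [← Finset.card_filter_add_card_filter_not (s := n.primeFactors) (· < 16), pow_add]
  have h1 : (n.primeFactors.filter (· < 16)).card ≤ 16 := by
    calc _ ≤ (Finset.range 16).card := Finset.card_le_card fun p hp =>
          Finset.mem_range.2 (Finset.mem_filter.1 hp).2
      _ = 16 := by simp
  refine mul_le_mul (pow_le_pow_right₀ (by norm_num) h1) ?_ (by positivity) (by positivity)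
  set T := n.primeFactors.filter fun p => ¬ p < 16 with hT
  have h2 : (∏ p ∈ T, p) ≤ n := (Nat.le_of_dvd (Nat.pos_of_ne_zero hn)
    ((Finset.prod_dvd_prod_of_subset _ _ _ (Finset.filter_subset _ _)).trans
      (Nat.prod_primeFactors_dvd n)))
  calc (2 : ℝ) ^ T.card = ∏ p ∈ T, (2 : ℝ) := by simp
    _ ≤ ∏ p ∈ T, (p : ℝ) ^ (1 / 4 : ℝ) := by
      refine Finset.prod_le_prod (fun _ _ => by norm_num) fun p hp => ?_
      have h16 : (16 : ℝ) ≤ p := by exact_mod_cast not_lt.1 (Finset.mem_filter.1 hp).2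
      calc (2 : ℝ) = (16 : ℝ) ^ (1 / 4 : ℝ) := by
            rw [show (16 : ℝ) = 2 ^ (4 : ℝ) by norm_num, ← Real.rpow_mul (by norm_num)]
            norm_num
        _ ≤ _ := Real.rpow_le_rpow (by norm_num) h16 (by norm_num)
    _ = (∏ p ∈ T, (p : ℝ)) ^ (1 / 4 : ℝ) := Real.finsetProd_rpow _ _ (fun _ _ => by positivity) _
    _ ≤ _ := Real.rpow_le_rpow (by positivity) (by rw [← Nat.cast_prod]; exact Nat.cast_le.2 h2) (by norm_num)

lemma exists_rho_bound (a b : ℕ) :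
    ∃ R : ℝ, 0 < R ∧ ∀ v : ℕ, v ≠ 0 → |(rho a b v : ℝ)| ≤ R * (v : ℝ) ^ (1 / 4 : ℝ) := by
  refine ⟨2 ^ a.primeFactors.card * 2 ^ b.primeFactors.card * 2 ^ 16, by positivity,
    fun v hv => ?_⟩
  have h : |rho a b v| ≤ 2 ^ a.primeFactors.card * 2 ^ b.primeFactors.card *
      2 ^ v.primeFactors.card := by
    rw [rho, abs_mul, abs_mul]
    gcongr <;> exact prod_one_add_jacobiSym_le _ _
  calc |(rho a b v : ℝ)| ≤ 2 ^ a.primeFactors.card * 2 ^ b.primeFactors.card *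
        2 ^ v.primeFactors.card := by exact_mod_cast h
    _ ≤ 2 ^ a.primeFactors.card * 2 ^ b.primeFactors.card * (2 ^ 16 * (v : ℝ) ^ (1 / 4 : ℝ)) := by
      gcongr
      exact two_pow_card_primeFactors_le hv
    _ = _ := by ring

lemma sqrt_cube_eq (v : ℕ) : √((v ^ 3 : ℕ) : ℝ) = (v : ℝ) ^ ((3 : ℝ) / 2) := by
  rw [Real.sqrt_eq_rpow]
  push_cast
  rw [← Real.rpow_natCast, ← Real.rpow_mul (by positivity)]
  norm_num

lemma le_rpow_mul_rpow {e X Y t : ℝ} (he : 0 ≤ e) (h1 : e ≤ X) (h2 : e ≤ Y)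
    (ht : 0 ≤ t) (ht' : t ≤ 1) : e ≤ X ^ t * Y ^ (1 - t) := by
  rcases he.eq_or_lt with rfl | he
  · positivity
  calc e = e ^ t * e ^ (1 - t) := by rw [← Real.rpow_add he]; simp
    _ ≤ _ := mul_le_mul (Real.rpow_le_rpow he.le h1 ht) (Real.rpow_le_rpow he.le h2 (by linarith))
      (by positivity) (Real.rpow_nonneg (he.le.trans h1) _)

lemma interpolate_bound {v : ℕ} (hv : v ≠ 0) {B e M : ℝ} (hB : 0 < B) (he : 0 ≤ e) (hM : 0 ≤ M)
    (h1 : e ≤ M * ((v : ℝ) ^ 2 * B ^ (3 / 4 : ℝ))) (h2 : e ≤ M * (B / (v : ℝ) ^ ((3 : ℝ) / 2))) :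
    e ≤ M * (B ^ (63 / 64 : ℝ) * (v : ℝ) ^ (-41 / 32 : ℝ)) := by
  have hv' : (0 : ℝ) < v := by positivity
  have h := le_rpow_mul_rpow (t := 1 / 16) he h1 h2 (by norm_num) (by norm_num)
  refine h.trans (le_of_eq ?_)
  rw [Real.mul_rpow hM (by positivity), Real.mul_rpow hM (by positivity),
    Real.mul_rpow (by positivity) (by positivity), Real.div_rpow hB.le (by positivity),
    ← Real.rpow_natCast, ← Real.rpow_mul hv'.le, ← Real.rpow_mul hB.le, ← Real.rpow_mul hv'.le]
  have hMM : M ^ (1 / 16 : ℝ) * M ^ (1 - 1 / 16 : ℝ) = M := by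
    rw [← Real.rpow_add_of_nonneg hM (by norm_num) (by norm_num)]; norm_num
  have hBB : B ^ (3 / 4 * (1 / 16) : ℝ) * B ^ (1 - 1 / 16 : ℝ) = B ^ (63 / 64 : ℝ) := by
    rw [← Real.rpow_add hB]; norm_num
  have hvv : (v : ℝ) ^ (((2 : ℕ) : ℝ) * (1 / 16)) / (v : ℝ) ^ ((3 : ℝ) / 2 * (1 - 1 / 16)) =
      (v : ℝ) ^ (-41 / 32 : ℝ) := by
    rw [← Real.rpow_sub hv']; norm_num
  rw [← hBB, ← hvv]
  nth_rewrite 3 [← hMM]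
  ring

lemma exists_eq_cube_mul_sq {z : ℤ} (hz : 0 < z) (h : Squareful z) :
    ∃ (v : ℕ) (u : ℤ), Squarefree v ∧ 0 < u ∧ z = ((v ^ 3 : ℕ) : ℤ) * u ^ 2 := by
  lift z to ℕ using hz.le
  have hz' : z ≠ 0 := by rintro rfl; simp at hz
  obtain ⟨v, s, -, hs0, hs, hv⟩ := Nat.sq_mul_squarefree_of_pos (Nat.pos_of_ne_zero hz')
  have hprime : ∀ p : ℕ, p.Prime → p ∣ v → p ∣ s := by
    intro p hp hpv
    have h1 := h.2 p hp (by rw [← hs]; exact_mod_cast hpv.mul_left _)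
    have h2 : p ^ 2 ∣ s ^ 2 * v := by rw [hs]; exact_mod_cast h1
    by_contra hps
    have h3 : (p ^ 2).Coprime (s ^ 2) := Nat.Coprime.pow _ _ ((hp.coprime_iff_not_dvd).2 hps)
    have h4 := h3.dvd_of_dvd_mul_left h2
    rw [sq] at h4
    exact hp.one_lt.ne' (Nat.isUnit_iff.1 (hv p h4))
  obtain ⟨t, ht⟩ := Nat.gcd_dvd_left v s
  have ht1 : t = 1 := by
    by_contra hne
    obtain ⟨p, hp, hpt⟩ := Nat.exists_prime_and_dvd hne
    have hpv : p ∣ v := ht ▸ hpt.mul_left _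
    have : p * p ∣ v := by
      have := mul_dvd_mul (Nat.dvd_gcd hpv (hprime p hp hpv)) hpt
      rwa [← ht] at this
    exact hp.one_lt.ne' (Nat.isUnit_iff.1 (hv p this))
  have hvs : v ∣ s := by
    rw [ht1, mul_one] at ht
    rw [ht]; exact Nat.gcd_dvd_right v s
  obtain ⟨u, rfl⟩ := hvs
  refine ⟨v, u, hv, ?_, ?_⟩
  · exact_mod_cast Nat.pos_of_mul_pos_left hs0
  · rw [← hs]; push_cast; ring

lemma squarefree_part_unique {s t v w : ℕ} (ht : t ≠ 0) (hv : Squarefree v) (hw : Squarefree w)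
    (h : s ^ 2 * v = t ^ 2 * w) : v = w := by
  have h1 : t ^ 2 * (w * v) = (s * v) ^ 2 := by rw [← mul_assoc, ← h]; ring
  obtain ⟨k, hk⟩ := (Nat.pow_dvd_pow_iff two_ne_zero).1 (Dvd.intro _ h1)
  rw [hk, mul_pow] at h1
  have h2 : w * v = k ^ 2 := mul_left_cancel₀ (pow_ne_zero 2 ht) h1
  obtain ⟨m, rfl⟩ := (hv.dvd_pow_iff_dvd two_ne_zero).1 (Dvd.intro_left _ h2)
  have h3 : w = v * m ^ 2 := by
    have : v * w = v * (v * m ^ 2) := by rw [mul_comm, h2]; ring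
    exact mul_left_cancel₀ hv.ne_zero this
  have h4 : m * m ∣ w := ⟨v, by rw [h3]; ring⟩
  rw [h3, Nat.isUnit_iff.1 (hw m h4)]; simp

lemma squareful_cube_mul_sq {v : ℕ} (hv : v ≠ 0) {u : ℤ} (hu : 0 < u) :
    Squareful (((v ^ 3 : ℕ) : ℤ) * u ^ 2) := by
  have hv' : (v : ℤ) ≠ 0 := by exact_mod_cast hv
  refine ⟨by push_cast; positivity, fun p hp hd => ?_⟩
  push_cast at hd ⊢
  have hp' := Nat.prime_iff_prime_int.1 hp
  rcases hp'.dvd_or_dvd hd with h | h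
  · have := pow_dvd_pow_of_dvd (hp'.dvd_of_dvd_pow h) 2
    exact Dvd.dvd.mul_right (this.trans (pow_dvd_pow _ (by norm_num))) _
  · exact Dvd.dvd.mul_left (pow_dvd_pow_of_dvd (hp'.dvd_of_dvd_pow h) 2) _

lemma conic_mod_four (x y v u : ZMod 4) (h : x ^ 2 + y ^ 2 = v ^ 3 * u ^ 2)
    (hxy : ¬ (2 * x = 0 ∧ 2 * y = 0)) : v = 1 := by
  revert x y v u
  decide

lemma mod_four_of_conic {a b v : ℕ} (ha4 : a % 4 = 1) (hb4 : b % 4 = 1) {x y u : ℤ}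
    (hxy : IsCoprime x y) (h : a * x ^ 2 + b * y ^ 2 = ((v ^ 3 : ℕ) : ℤ) * u ^ 2) : v % 4 = 1 := by
  have e : ∀ n : ℕ, (n : ZMod 4) = 1 ↔ n % 4 = 1 := fun n => by
    have := ZMod.natCast_eq_natCast_iff' n 1 4
    simpa using this
  have h' := congrArg (Int.cast : ℤ → ZMod 4) h
  push_cast at h'
  rw [(e a).2 ha4, (e b).2 hb4, one_mul, one_mul] at h'
  rw [← e]
  refine conic_mod_four _ _ _ _ h' fun ⟨h1, h2⟩ => ?_
  have e2 : ∀ n : ℤ, 2 * (n : ZMod 4) = 0 → 2 ∣ n := fun n hn => by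
    have : ((2 * n : ℤ) : ZMod 4) = 0 := by push_cast; exact hn
    rw [ZMod.intCast_zmod_eq_zero_iff_dvd] at this
    push_cast at this
    omega
  exact Int.prime_two.not_isUnit (hxy.isUnit_of_dvd' (e2 x h1) (e2 y h2))

lemma squarefree_of_conic {a b v : ℕ} (ha : 0 < a) (hb : 0 < b)
    (hab : Nat.Coprime a b) (hsa : Squarefree a) (hsb : Squarefree b) (hv : Squarefree v) {x y u : ℤ}
    (hxy : IsCoprime x y) (h : a * x ^ 2 + b * y ^ 2 = ((v ^ 3 : ℕ) : ℤ) * u ^ 2) :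
    Squarefree (a * b * v) := by
  have h1 : (a : ℤ) * x ^ 2 + b * y ^ 2 = v * (v * u) ^ 2 := by rw [h]; push_cast; ring
  have h2 : (b : ℤ) * y ^ 2 + a * x ^ 2 = v * (v * u) ^ 2 := by rw [add_comm, h1]
  have iab : IsCoprime (a : ℤ) b := Nat.isCoprime_iff_coprime.2 hab
  have c1 := isCoprime_root_left (by exact_mod_cast ha.ne') (Int.squarefree_natCast.2 hsa) iab hxy h1
  have c2 := isCoprime_root_left (by exact_mod_cast hb.ne') (Int.squarefree_natCast.2 hsb)
    iab.symm hxy.symm h2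
  have c1' := Nat.isCoprime_iff_coprime.1 c1.of_mul_left_left
  have c2' := Nat.isCoprime_iff_coprime.1 c2.of_mul_left_left
  exact Nat.squarefree_mul_iff.2 ⟨Nat.Coprime.mul_left c1'.symm c2'.symm,
    Nat.squarefree_mul_iff.2 ⟨hab, hsa, hsb⟩, hv⟩

/-- Coprime pairs in a box at which the form takes squareful values. -/
def squarefulPairs (a b : ℕ) (B : ℝ) : Set (ℤ × ℤ) :=
  {xy | Int.gcd xy.1 xy.2 = 1 ∧ |(xy.1 : ℝ)| ≤ B ∧ |(xy.2 : ℝ)| ≤ B ∧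
    Squareful ((a : ℤ) * xy.1 ^ 2 + (b : ℤ) * xy.2 ^ 2)}

lemma le_of_mem_sqPairs {a b v : ℕ} {B : ℝ} {z : ℤ × ℤ} (h : z ∈ sqPairs a b (v ^ 3) B) :
    v ≤ ⌊(a + b : ℝ) * B ^ 2⌋₊ := by
  obtain ⟨-, hx, hy, u, hu, h⟩ := h
  refine Nat.le_floor ?_
  have h1 : (v : ℤ) ≤ ((v ^ 3 : ℕ) : ℤ) * u ^ 2 := by
    have h2 : (v : ℤ) ≤ ((v ^ 3 : ℕ) : ℤ) := by exact_mod_cast Nat.le_self_pow three_ne_zero v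
    have h3 : (1 : ℤ) ≤ u ^ 2 := one_le_pow₀ hu
    exact h2.trans (le_mul_of_one_le_right (by positivity) h3)
  rw [← h] at h1
  have h4 : (v : ℝ) ≤ a * (z.1 : ℝ) ^ 2 + b * (z.2 : ℝ) ^ 2 := by exact_mod_cast h1
  have h5 : (z.1 : ℝ) ^ 2 ≤ B ^ 2 := sq_le_sq' (abs_le.1 hx).1 (abs_le.1 hx).2
  have h6 : (z.2 : ℝ) ^ 2 ≤ B ^ 2 := sq_le_sq' (abs_le.1 hy).1 (abs_le.1 hy).2
  have h7 := mul_le_mul_of_nonneg_left h5 (Nat.cast_nonneg (α := ℝ) a)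
  have h8 := mul_le_mul_of_nonneg_left h6 (Nat.cast_nonneg (α := ℝ) b)
  linarith

lemma hasSum_ncard_squarefulPairs {a b : ℕ} (ha : 0 < a) (hb : 0 < b)
    (hab : Nat.Coprime a b) (hsa : Squarefree a) (hsb : Squarefree b)
    (ha4 : a % 4 = 1) (hb4 : b % 4 = 1) (B : ℝ) :
    HasSum (fun v : ℕ => if v % 4 = 1 ∧ Squarefree (a * b * v) then
      ((sqPairs a b (v ^ 3) B).ncard : ℝ) else 0) (squarefulPairs a b B).ncard := by
  set S := (Finset.range (⌊(a + b : ℝ) * B ^ 2⌋₊ + 1)).filter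
    fun v => v % 4 = 1 ∧ Squarefree (a * b * v) with hS
  have hunion : squarefulPairs a b B = ⋃ v ∈ (S : Set ℕ), sqPairs a b (v ^ 3) B := by
    ext ⟨x, y⟩
    simp only [Set.mem_iUnion, exists_prop]
    constructor
    · rintro ⟨hg, hx, hy, hs⟩
      simp only at hg hx hy hs
      have hxy := Int.isCoprime_iff_gcd_eq_one.2 hg
      have hpos : 0 < (a : ℤ) * x ^ 2 + b * y ^ 2 := lt_of_le_of_ne (by positivity) hs.1.symm
      obtain ⟨v, u, hv, hu, h⟩ := exists_eq_cube_mul_sq hpos hs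
      have hmem : (x, y) ∈ sqPairs a b (v ^ 3) B := ⟨hxy, hx, hy, u, hu, h⟩
      refine ⟨v, ?_, hmem⟩
      rw [hS, Finset.mem_coe, Finset.mem_filter, Finset.mem_range]
      exact ⟨Nat.lt_succ_of_le (le_of_mem_sqPairs hmem), mod_four_of_conic ha4 hb4 hxy h,
        squarefree_of_conic ha hb hab hsa hsb hv hxy h⟩
    · rintro ⟨v, hv, hxy, hx, hy, u, hu, h⟩
      rw [hS, Finset.mem_coe, Finset.mem_filter] at hv
      have hv0 : v ≠ 0 := by rintro rfl; simp at hv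
      refine ⟨Int.isCoprime_iff_gcd_eq_one.1 hxy, hx, hy, ?_⟩
      rw [h]
      exact squareful_cube_mul_sq hv0 hu
  have hdisj : (S : Set ℕ).PairwiseDisjoint fun v => sqPairs a b (v ^ 3) B := by
    intro v hv w hw hne
    rw [hS, Finset.mem_coe, Finset.mem_filter] at hv hw
    refine Set.disjoint_left.2 ?_
    rintro ⟨x, y⟩ ⟨-, -, -, u, hu, h⟩ ⟨-, -, -, u', hu', h'⟩
    apply hne
    have h1 := h.symm.trans h'
    lift u to ℕ using hu.le
    lift u' to ℕ using hu'.le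
    norm_cast at h1 hu'
    have hw0 : w ≠ 0 := by rintro rfl; simp at hw
    refine squarefree_part_unique (s := v * u) (t := w * u') (mul_ne_zero hw0 hu'.ne')
      hv.2.2.of_mul_right hw.2.2.of_mul_right ?_
    linear_combination h1
  have hsum : ((squarefulPairs a b B).ncard : ℝ) =
      ∑ v ∈ S, if v % 4 = 1 ∧ Squarefree (a * b * v) then
        ((sqPairs a b (v ^ 3) B).ncard : ℝ) else 0 := by
    rw [hunion, Set.Finite.ncard_biUnion S.finite_toSet (fun v _ => sqPairs_finite ..) hdisj,
      finsum_mem_coe_finset, Nat.cast_sum]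
    refine Finset.sum_congr rfl fun v hv => ?_
    rw [if_pos (Finset.mem_filter.1 hv).2]
  rw [hsum]
  refine hasSum_sum_of_ne_finset_zero fun v hv => ?_
  split_ifs with hc
  · have : sqPairs a b (v ^ 3) B = ∅ := by
      refine Set.eq_empty_of_forall_notMem fun z hz => hv ?_
      exact Finset.mem_filter.2 ⟨Finset.mem_range.2 (Nat.lt_succ_of_le (le_of_mem_sqPairs hz)), hc⟩
    rw [this]; simp
  · rfl

lemma exists_term_bound (a b : ℕ) (ha : 0 < a) (hb : 0 < b) (ha4 : a % 4 = 1) (hb4 : b % 4 = 1) :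
    ∃ M : ℝ, 0 < M ∧ ∀ v : ℕ, v % 4 = 1 → Squarefree (a * b * v) → ∀ B : ℝ, 0 < B →
      |((sqPairs a b (v ^ 3) B).ncard : ℝ) - 4 * sigmaInf a b / π ^ 2 * B *
        (gammaF (a * b * v) * (rho a b v : ℝ) / (v : ℝ) ^ ((3 : ℝ) / 2))| ≤
      M * B ^ (63 / 64 : ℝ) * (v : ℝ) ^ (-33 / 32 : ℝ) := by
  obtain ⟨K, hK, h⟩ := exists_ncard_sqPairs_bound a b ha hb
  obtain ⟨R, hR, hrho⟩ := exists_rho_bound a b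
  have hσ := sigmaInf_nonneg a b
  set K' := K + 4 * sigmaInf a b / π ^ 2 with hK'
  have hq : 0 ≤ 4 * sigmaInf a b / π ^ 2 := by positivity
  refine ⟨R * K', by positivity, fun v hv4 hsq B hB => ?_⟩
  have hv : v ≠ 0 := by rintro rfl; simp at hv4
  have hv' : (0 : ℝ) < v := by positivity
  have hodd : Odd (a * b * v) := by
    refine Nat.odd_mul.2 ⟨Nat.odd_mul.2 ⟨?_, ?_⟩, ?_⟩ <;> rw [Nat.odd_iff] <;> omega
  obtain ⟨hρ, h1, h2⟩ := h v hodd hsq B hB.le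
  have hρ' : (0 : ℝ) ≤ rho a b v := by exact_mod_cast hρ
  have hρR := (le_abs_self _).trans (hrho v hv)
  rw [sqrt_cube_eq] at h1 h2
  set V := (v : ℝ) ^ ((3 : ℝ) / 2) with hV
  have hVpos : 0 < V := by positivity
  set main := 4 * sigmaInf a b / π ^ 2 * B * (gammaF (a * b * v) * (rho a b v : ℝ) / V) with hmain
  have e1 : (rho a b v : ℝ) * (4 / π ^ 2 * gammaF (a * b * v) * (sigmaInf a b * (B / V))) = main := by
    rw [hmain]; ring
  rw [e1] at h1
  have hγ := gammaF_nonneg (a * b * v)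
  have hmain0 : 0 ≤ main := by positivity
  have hmain1 : main ≤ rho a b v * (4 * sigmaInf a b / π ^ 2 * (B / V)) := by
    rw [← e1]
    refine mul_le_mul_of_nonneg_left ?_ hρ'
    calc 4 / π ^ 2 * gammaF (a * b * v) * (sigmaInf a b * (B / V))
        ≤ 4 / π ^ 2 * 1 * (sigmaInf a b * (B / V)) := by
          gcongr
          exact gammaF_le_one _
      _ = _ := by ring
  have hb1 : |((sqPairs a b (v ^ 3) B).ncard : ℝ) - main| ≤
      (rho a b v * K') * ((v : ℝ) ^ 2 * B ^ (3 / 4 : ℝ)) := by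
    refine h1.trans ?_
    calc (rho a b v : ℝ) * (K * (v : ℝ) ^ 2 * B ^ (3 / 4 : ℝ))
        = (rho a b v * K) * ((v : ℝ) ^ 2 * B ^ (3 / 4 : ℝ)) := by ring
      _ ≤ _ := by
        gcongr
        linarith
  have hb2 : |((sqPairs a b (v ^ 3) B).ncard : ℝ) - main| ≤ (rho a b v * K') * (B / V) := by
    have e2 : (rho a b v * K') * (B / V) = rho a b v * (K * (B / V)) +
        rho a b v * (4 * sigmaInf a b / π ^ 2 * (B / V)) := by rw [hK']; ring
    have h0 : (0 : ℝ) ≤ (sqPairs a b (v ^ 3) B).ncard := by positivity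
    have h3 : (0 : ℝ) ≤ rho a b v * (K * (B / V)) := by positivity
    rw [e2, abs_le]
    constructor <;> linarith
  refine (interpolate_bound hv hB (abs_nonneg _) (by positivity) hb1 hb2).trans ?_
  have e3 : (v : ℝ) ^ (-33 / 32 : ℝ) = (v : ℝ) ^ (1 / 4 : ℝ) * (v : ℝ) ^ (-41 / 32 : ℝ) := by
    rw [← Real.rpow_add hv']; norm_num
  calc (rho a b v : ℝ) * K' * (B ^ (63 / 64 : ℝ) * (v : ℝ) ^ (-41 / 32 : ℝ))
      ≤ (R * (v : ℝ) ^ (1 / 4 : ℝ)) * K' * (B ^ (63 / 64 : ℝ) * (v : ℝ) ^ (-41 / 32 : ℝ)) := by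
        gcongr
    _ = _ := by rw [e3]; ring

lemma summable_main (a b : ℕ) :
    Summable fun v : ℕ => if v % 4 = 1 ∧ Squarefree (a * b * v) then
      gammaF (a * b * v) * (rho a b v : ℝ) / (v : ℝ) ^ ((3 : ℝ) / 2) else 0 := by
  obtain ⟨R, hR, hrho⟩ := exists_rho_bound a b
  have hs : Summable fun v : ℕ => R * (v : ℝ) ^ (-5 / 4 : ℝ) :=
    (Real.summable_nat_rpow.2 (by norm_num)).mul_left R
  refine Summable.of_norm_bounded hs fun v => ?_
  split_ifs with hc
  · have hv : v ≠ 0 := by rintro rfl; simp at hc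
    have hv' : (0 : ℝ) < v := by positivity
    have e3 : (v : ℝ) ^ (-5 / 4 : ℝ) = (v : ℝ) ^ (1 / 4 : ℝ) / (v : ℝ) ^ ((3 : ℝ) / 2) := by
      rw [← Real.rpow_sub hv']; norm_num
    rw [norm_div, norm_mul, Real.norm_eq_abs, Real.norm_eq_abs, Real.norm_eq_abs,
      abs_of_nonneg (gammaF_nonneg _), abs_of_nonneg (by positivity : (0 : ℝ) ≤ (v : ℝ) ^ ((3 : ℝ) / 2)),
      e3, ← mul_div_assoc]
    refine div_le_div_of_nonneg_right ?_ (by positivity)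
    calc gammaF (a * b * v) * |(rho a b v : ℝ)| ≤ 1 * |(rho a b v : ℝ)| := by
          gcongr; exact gammaF_le_one _
      _ ≤ _ := by rw [one_mul]; exact hrho v hv
  · simp only [norm_zero]; positivity

/-- Theorem 1.4: the asymptotic formula for the number of coprime pairs
`(x,y)` with `|x|, |y| ≤ B` such that `ax² + by²` is squareful. -/
theorem squareful_binary_form_asymptotic (a b : ℕ) (ha : 0 < a) (hb : 0 < b)
    (hab : Nat.Coprime a b) (hsa : Squarefree a) (hsb : Squarefree b)
    (ha4 : a % 4 = 1) (hb4 : b % 4 = 1)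
    (σ : ℝ) (hσ : σ = 2 * (arsinh (Real.sqrt ((a : ℝ) / b)) / Real.sqrt (a : ℝ) +
      arsinh (Real.sqrt ((b : ℝ) / a)) / Real.sqrt (b : ℝ)))
    (c : ℝ) (hc : c = 2 * σ / π ^ 2 *
      ∑' v : ℕ, if v % 4 = 1 ∧ Squarefree (a * b * v) then
        gammaF (a * b * v) * (rho a b v : ℝ) / (v : ℝ) ^ ((3 : ℝ) / 2) else 0) :
    ∀ ε : ℝ, 0 < ε → ∃ C : ℝ, 0 < C ∧ ∀ B : ℝ, 2 ≤ B →
      |(Nat.card {xy : ℤ × ℤ // Int.gcd xy.1 xy.2 = 1 ∧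
          |(xy.1 : ℝ)| ≤ B ∧ |(xy.2 : ℝ)| ≤ B ∧
          Squareful ((a : ℤ) * xy.1 ^ 2 + (b : ℤ) * xy.2 ^ 2)} : ℝ)
        - 2 * c * B| ≤ C * B ^ ((85 : ℝ) / 86 + ε) := by
  intro ε hε
  obtain ⟨M, hM, hterm⟩ := exists_term_bound a b ha hb ha4 hb4
  have hs : Summable fun v : ℕ => (v : ℝ) ^ (-33 / 32 : ℝ) :=
    Real.summable_nat_rpow.2 (by norm_num)
  set Z := ∑' v : ℕ, (v : ℝ) ^ (-33 / 32 : ℝ) with hZ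
  have hZ0 : 0 ≤ Z := tsum_nonneg fun v => by positivity
  refine ⟨M * (Z + 1), by positivity, fun B hB => ?_⟩
  have hB0 : 0 < B := by linarith
  have hcard : Nat.card {xy : ℤ × ℤ // Int.gcd xy.1 xy.2 = 1 ∧
      |(xy.1 : ℝ)| ≤ B ∧ |(xy.2 : ℝ)| ≤ B ∧
      Squareful ((a : ℤ) * xy.1 ^ 2 + (b : ℤ) * xy.2 ^ 2)} = (squarefulPairs a b B).ncard := rfl
  have h1 := hasSum_ncard_squarefulPairs ha hb hab hsa hsb ha4 hb4 B
  have h2 := ((summable_main a b).mul_left (4 * sigmaInf a b / π ^ 2 * B)).hasSum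
  have e1 : ∑' v : ℕ, 4 * sigmaInf a b / π ^ 2 * B *
      (if v % 4 = 1 ∧ Squarefree (a * b * v) then
        gammaF (a * b * v) * (rho a b v : ℝ) / (v : ℝ) ^ ((3 : ℝ) / 2) else 0) = 2 * c * B := by
    rw [tsum_mul_left, hc, hσ, sigmaInf]
    ring_nf
  rw [e1] at h2
  have h3 := h1.sub h2
  have h4 := (hs.hasSum.mul_left (M * B ^ (63 / 64 : ℝ)))
  rw [hcard, ← h3.tsum_eq, ← Real.norm_eq_abs]
  refine (tsum_of_norm_bounded h4 fun v => ?_).trans ?_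
  · split_ifs with hv
    · exact hterm v hv.1 hv.2 B hB0
    · simp only [mul_zero, sub_zero, norm_zero]
      positivity
  · calc M * B ^ (63 / 64 : ℝ) * Z ≤ M * B ^ ((85 : ℝ) / 86 + ε) * (Z + 1) := by
          gcongr
          · linarith
          · linarith
          · linarith
      _ = _ := by ring
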